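/- arXiv:2009.12692 — 6 statements merged into one kernel-verified Lean document; each statement's English description precedes it below -/
import Mathlib

section
/- For every ε > 0 there exists N such that for all m > N and k > N, the choice number of the complete k-partite graph with all parts of size m satisfies (1-ε)·k·ln m ≤ ch(K_{m*k}) ≤ (1+ε)·k·ln m. In other words, as m and k both tend to infinity, ch(K_{m*k}) = (1+o(1))·k·ln m. -/
/-- A graph `G` is `s`-choosable if for every assignment of a list (finite set) of `s` colors to
each vertex there is a proper coloring choosing each vertex's color from its list. -/
def Choosable {V : Type*} (G : SimpleGraph V) (s : ℕ) : Prop :=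
  ∀ L : V → Finset ℕ, (∀ v, (L v).card = s) →
    ∃ f : V → ℕ, (∀ v, f v ∈ L v) ∧ ∀ u v, G.Adj u v → f u ≠ f v

/-- The choice number of `G`: the smallest `s` such that `G` is `s`-choosable. -/
noncomputable def choiceNumber {V : Type*} (G : SimpleGraph V) : ℕ :=
  sInf {s | Choosable G s}

/-- `K_{m*k}`: the complete `k`-partite graph with all `k` parts of size `m`. -/
abbrev Kmk (m k : ℕ) : SimpleGraph ((_ : Fin k) × Fin m) :=
  SimpleGraph.completeMultipartiteGraph fun _ : Fin k => Fin m

open Finset in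
lemma exists_good {α β ι : Type*} [Fintype α] [DecidableEq α] [Fintype β] [Fintype ι]
    (w : β → ℝ) (hw : ∀ b, 0 ≤ w b) (hs : ∑ b, w b = 1) (a : ι → ℝ) (g : ι → α → β → ℝ)
    (h : ∑ j, a j * ∏ x, ∑ b, w b * g j x b < 1) :
    ∃ f : α → β, ∑ j, a j * ∏ x, g j x (f x) < 1 := by
  by_contra! hc
  have h1 : ∑ f : α → β, ∏ x, w (f x) = 1 := by
    have := Finset.prod_univ_sum (fun _ : α => (Finset.univ : Finset β)) (fun _ b => w b)
    rw [Fintype.piFinset_univ] at this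
    rw [← this]; simp [hs]
  have h2 : ∑ j, a j * ∏ x, ∑ b, w b * g j x b
      = ∑ f : α → β, (∏ x, w (f x)) * ∑ j, a j * ∏ x, g j x (f x) := by
    simp_rw [Finset.mul_sum]
    rw [Finset.sum_comm]
    refine Finset.sum_congr rfl fun j _ => ?_
    have := Finset.prod_univ_sum (fun _ : α => (Finset.univ : Finset β)) (fun x b => w b * g j x b)
    rw [Fintype.piFinset_univ] at this
    rw [this, Finset.mul_sum]
    refine Finset.sum_congr rfl fun f _ => ?_
    rw [Finset.prod_mul_distrib]; ring
  have h3 : ∑ f : α → β, ∏ x, w (f x)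
      ≤ ∑ f : α → β, (∏ x, w (f x)) * ∑ j, a j * ∏ x, g j x (f x) := by
    refine Finset.sum_le_sum fun f _ => ?_
    exact le_mul_of_one_le_right (Finset.prod_nonneg fun _ _ => hw _) (hc f)
  linarith

lemma prod_ite_list {U L : Finset ℕ} (hLU : L ⊆ U) (y : ℝ) :
    ∏ x : U, (if (x : ℕ) ∈ L then y else 1) = y ^ L.card := by
  rw [Finset.prod_coe_sort U (fun x => if x ∈ L then y else 1), Finset.prod_ite_mem,
    Finset.inter_eq_right.2 hLU]
  simp

/-- core of the upper bound -/
lemma choosable_core (m k s : ℕ) (δ : ℝ) (hk : 0 < k) (hm : 0 < m) (hδ : 0 < δ) (hδ1 : δ < 1)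
    (h1 : k * Real.log m ≤ (1 - δ) * s)
    (h2 : (m * k : ℝ) * Real.exp (2 * k - δ * s / 2) < 1 / 2) :
    Choosable (Kmk m k) s := by
  classical
  intro L hL
  have hk' : (0 : ℝ) < k := by exact_mod_cast hk
  have hm' : (0 : ℝ) < m := by exact_mod_cast hm
  set U : Finset ℕ := Finset.univ.biUnion L with hU
  have hLU : ∀ v, L v ⊆ U := fun v => Finset.subset_biUnion_of_mem L (Finset.mem_univ v)
  let V := (_ : Fin k) × Fin m
  let w : Option (Fin k) → ℝ := fun o => o.elim δ (fun _ => (1 - δ) / k)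
  have hw : ∀ b, 0 ≤ w b := by
    rintro (_ | b)
    · exact hδ.le
    · exact div_nonneg (by linarith) hk'.le
  have hws : ∑ b, w b = 1 := by
    rw [Fintype.sum_option]
    simp only [w, Option.elim]
    rw [Finset.sum_const, Finset.card_univ, Fintype.card_fin, nsmul_eq_mul]
    field_simp; ring
  let a : V ⊕ V → ℝ := Sum.elim (fun _ => 1 / (2 * k)) (fun _ => Real.exp (2 * k))
  let g : V ⊕ V → U → Option (Fin k) → ℝ := Sum.elim
    (fun v x b => if (x : ℕ) ∈ L v then (if b = some v.1 then 0 else 1) else 1)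
    (fun v x b => if (x : ℕ) ∈ L v then (if b = none then Real.exp (-1) else 1) else 1)
  have hA : ∀ v : V, ∏ x : U, ∑ b, w b * g (Sum.inl v) x b = (1 - (1 - δ) / k) ^ s := by
    intro v
    rw [← hL v, ← prod_ite_list (hLU v)]
    refine Finset.prod_congr rfl fun x _ => ?_
    by_cases hx : (x : ℕ) ∈ L v
    · simp only [g, Sum.elim_inl, hx, if_true]
      have : ∀ b, w b * (if b = some v.1 then 0 else 1) = w b - (if b = some v.1 then w b else 0) := by
        intro b; split_ifs <;> simp
      simp_rw [this]
      rw [Finset.sum_sub_distrib, hws, Finset.sum_ite_eq' Finset.univ (some v.1) w]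
      simp [w]
    · simp only [g, Sum.elim_inl, hx, if_false, mul_one, hws]
  have hB : ∀ v : V, ∏ x : U, ∑ b, w b * g (Sum.inr v) x b = (1 - δ * (1 - Real.exp (-1))) ^ s := by
    intro v
    rw [← hL v, ← prod_ite_list (hLU v)]
    refine Finset.prod_congr rfl fun x _ => ?_
    by_cases hx : (x : ℕ) ∈ L v
    · simp only [g, Sum.elim_inr, hx, if_true]
      have : ∀ b, w b * (if b = none then Real.exp (-1) else 1)
          = w b - (if b = none then w b * (1 - Real.exp (-1)) else 0) := by
        intro b; split_ifs <;> ring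
      simp_rw [this]
      rw [Finset.sum_sub_distrib, hws,
        Finset.sum_ite_eq' Finset.univ none (fun b => w b * (1 - Real.exp (-1)))]
      simp [w]
    · simp only [g, Sum.elim_inr, hx, if_false, mul_one, hws]
  have hAb : (1 - (1 - δ) / k) ^ s ≤ 1 / (m : ℝ) := by
    have hnn : 0 ≤ 1 - (1 - δ) / (k : ℝ) := by
      rw [sub_nonneg, div_le_one hk']
      have : (1 : ℝ) ≤ k := by exact_mod_cast hk
      linarith
    calc (1 - (1 - δ) / k) ^ s ≤ (Real.exp (-((1 - δ) / k))) ^ s :=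
          pow_le_pow_left₀ hnn (Real.one_sub_le_exp_neg _) _
      _ = Real.exp (-((1 - δ) * s / k)) := by
          rw [← Real.exp_nat_mul]; congr 1; ring
      _ ≤ Real.exp (-Real.log m) := by
          apply Real.exp_le_exp.2
          rw [neg_le_neg_iff, le_div_iff₀ hk']
          linarith
      _ = 1 / (m : ℝ) := by rw [Real.exp_neg, Real.exp_log hm', one_div]
  have he : Real.exp (-1) ≤ 1 / 2 := by
    rw [Real.exp_neg, one_div]
    apply inv_anti₀ (by norm_num)
    have := Real.add_one_le_exp (1 : ℝ)
    linarith
  have hBb : (1 - δ * (1 - Real.exp (-1))) ^ s ≤ Real.exp (-(δ * s / 2)) := by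
    have he0 := Real.exp_pos (-1)
    have hnn : 0 ≤ 1 - δ * (1 - Real.exp (-1)) := by nlinarith
    calc _ ≤ (Real.exp (-(δ / 2))) ^ s := by
          apply pow_le_pow_left₀ hnn
          refine le_trans ?_ (Real.one_sub_le_exp_neg _)
          nlinarith
      _ = Real.exp (-(δ * s / 2)) := by
          rw [← Real.exp_nat_mul]; congr 1; ring
  have hcardV : (Fintype.card V : ℝ) = m * k := by
    simp [V]; ring
  obtain ⟨f, hf⟩ := exists_good w hw hws a g (by
    rw [Fintype.sum_sum_type]
    simp only [hA, hB]
    simp only [a, Sum.elim_inl, Sum.elim_inr, Finset.sum_const, Finset.card_univ, nsmul_eq_mul,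
      hcardV]
    have e1 : (m * k : ℝ) * (1 / (2 * k) * (1 - (1 - δ) / k) ^ s) ≤ 1 / 2 := by
      calc _ ≤ (m * k : ℝ) * (1 / (2 * k) * (1 / m)) := by gcongr
        _ = 1 / 2 := by field_simp
    have e2 : (m * k : ℝ) * (Real.exp (2 * k) * (1 - δ * (1 - Real.exp (-1))) ^ s) < 1 / 2 := by
      refine lt_of_le_of_lt ?_ h2
      rw [sub_eq_add_neg (2 * (k : ℝ)), Real.exp_add]
      gcongr
    linarith)
  -- colours outside `U` are irrelevant
  let F : Finset V := Finset.univ.filter fun v => ∀ x : U, (x : ℕ) ∈ L v → f x ≠ some v.1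
  let R : V → Finset ℕ := fun v => (Finset.univ.filter fun x : U => (x : ℕ) ∈ L v ∧ f x = none).map
    (Function.Embedding.subtype _)
  rw [Fintype.sum_sum_type] at hf
  simp only [a, Sum.elim_inl, Sum.elim_inr] at hf
  have hgA : ∀ v : V, ∏ x : U, g (Sum.inl v) x (f x) = if v ∈ F then 1 else 0 := by
    intro v
    split_ifs with h
    · apply Finset.prod_eq_one
      intro x _
      have := (Finset.mem_filter.1 h).2 x
      simp only [g, Sum.elim_inl]
      split_ifs with h1 h2
      · exact absurd h2 (this h1)
      · rfl
      · rfl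
    · have : ∃ x : U, (x : ℕ) ∈ L v ∧ f x = some v.1 := by
        by_contra! hc
        exact h (Finset.mem_filter.2 ⟨Finset.mem_univ _, hc⟩)
      obtain ⟨x, hx, hx'⟩ := this
      apply Finset.prod_eq_zero (Finset.mem_univ x)
      simp [g, hx, hx']
  have hgB : ∀ v : V, ∏ x : U, g (Sum.inr v) x (f x) = Real.exp (-((R v).card : ℝ)) := by
    intro v
    have : ∀ x : U, g (Sum.inr v) x (f x)
        = if ((x : ℕ) ∈ L v ∧ f x = none) then Real.exp (-1) else 1 := by
      intro x
      simp only [g, Sum.elim_inr]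
      split_ifs <;> simp_all
    simp_rw [this]
    rw [Finset.prod_ite, Finset.prod_const, Finset.prod_const_one, mul_one, ← Real.exp_nat_mul,
      Finset.card_map]
    congr 1; ring
  simp only [hgA, hgB] at hf
  have hS1 : ∑ v : V, 1 / (2 * (k : ℝ)) * (if v ∈ F then 1 else 0) = F.card / (2 * k) := by
    rw [← Finset.mul_sum]; simp; ring
  have hS2 : ∀ v : V, 0 ≤ Real.exp (2 * k) * Real.exp (-((R v).card : ℝ)) := fun v => by positivity
  have hF : F.card < 2 * k := by
    have h3 := Finset.sum_nonneg fun v (_ : v ∈ (Finset.univ : Finset V)) => hS2 v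
    have : (F.card : ℝ) / (2 * k) < 1 := by rw [← hS1]; linarith
    rw [div_lt_one (by positivity)] at this
    exact_mod_cast this
  have hR : ∀ v : V, 2 * k ≤ (R v).card := by
    intro v
    have h3 := Finset.single_le_sum (fun v (_ : v ∈ (Finset.univ : Finset V)) => hS2 v)
      (Finset.mem_univ v)
    have h4 : 0 ≤ (F.card : ℝ) / (2 * k) := by positivity
    have h5 : Real.exp (2 * k) * Real.exp (-((R v).card : ℝ)) < 1 := by
      rw [hS1] at hf
      linarith
    rw [← Real.exp_add, Real.exp_lt_one_iff] at h5
    have : (2 * k : ℝ) < (R v).card := by linarith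
    exact_mod_cast this.le
  obtain ⟨c, hc, hcR⟩ := (Finset.all_card_le_biUnion_card_iff_exists_injective
      (fun v : F => R v)).1 (by
    intro s
    rcases s.eq_empty_or_nonempty with rfl | ⟨v, hv⟩
    · simp
    · have e1 : s.card ≤ F.card := by
        simpa using Finset.card_le_univ s
      have e2 := Finset.card_le_card (Finset.subset_biUnion_of_mem (fun v : F => R v) hv)
      have e3 := hR v
      omega)
  have hRm : ∀ v x, x ∈ R v → ∃ h : x ∈ U, x ∈ L v ∧ f ⟨x, h⟩ = none := by
    intro v x hx
    simp only [R, Finset.mem_map, Finset.mem_filter, Function.Embedding.subtype_apply] at hx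
    obtain ⟨⟨y, hy⟩, ⟨_, h1, h2⟩, rfl⟩ := hx
    exact ⟨hy, h1, h2⟩
  have hnF : ∀ v : V, v ∉ F → ∃ x, ∃ h : x ∈ U, x ∈ L v ∧ f ⟨x, h⟩ = some v.1 := by
    intro v hv
    by_contra! hcon
    exact hv (Finset.mem_filter.2 ⟨Finset.mem_univ _, fun x hx => hcon x x.2 hx⟩)
  choose! d hd using hnF
  refine ⟨fun v => if h : v ∈ F then c ⟨v, h⟩ else d v, ?_, ?_⟩
  · intro v
    dsimp only
    split_ifs with h
    · exact (hRm v _ (hcR ⟨v, h⟩)).2.1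
    · exact (hd v h).2.1
  · intro u v huv
    have huv' : u.1 ≠ v.1 := by simpa using huv
    dsimp only
    split_ifs with h h' h'
    · intro e
      have := hc e
      simp only [Subtype.mk.injEq] at this
      exact huv' (by rw [this])
    · intro e
      obtain ⟨p1, _, p2⟩ := hRm u _ (hcR ⟨u, h⟩)
      obtain ⟨q1, _, q2⟩ := hd v h'
      simp only [e] at p2
      rw [p2] at q2; cases q2
    · intro e
      obtain ⟨p1, _, p2⟩ := hRm v _ (hcR ⟨v, h'⟩)
      obtain ⟨q1, _, q2⟩ := hd u h
      simp only [← e] at p2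
      rw [p2] at q2; cases q2
    · intro e
      obtain ⟨p1, _, p2⟩ := hd u h
      obtain ⟨q1, _, q2⟩ := hd v h'
      simp only [e] at p2
      rw [p2] at q2
      exact huv' (Option.some.inj q2)

lemma choosable_succ {V : Type*} {G : SimpleGraph V} {s t : ℕ} (hst : s ≤ t)
    (h : Choosable G s) : Choosable G t := by
  intro L hL
  have : ∀ v, ∃ M ⊆ L v, M.card = s := fun v =>
    Finset.exists_subset_card_eq (by rw [hL v]; exact hst)
  choose M hM hMs using this
  obtain ⟨f, hf, hp⟩ := h M hMs
  exact ⟨f, fun v => hM v (hf v), hp⟩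

/-- Blow-up of a uniform hypergraph with large cover number. -/
lemma not_choosable_blowup (m k r t b τ : ℕ) (E : Fin m → Finset (Fin t))
    (hE : ∀ j, (E j).card = b)
    (hcov : ∀ S : Finset (Fin t), S.card ≤ τ → ∃ j, Disjoint S (E j))
    (hlt : t * r < k * (τ + 1)) : ¬ Choosable (Kmk m k) (b * r) := by
  classical
  intro hch
  let e : Fin t × Fin r ↪ ℕ := ⟨Encodable.encode, Encodable.encode_injective⟩
  obtain ⟨f, hf, hp⟩ := hch (fun v => ((E v.2) ×ˢ (Finset.univ : Finset (Fin r))).map e) (by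
    intro v; simp [hE])
  have hf' : ∀ v, ∃ x : Fin t × Fin r, x.1 ∈ E v.2 ∧ e x = f v := by
    intro v
    obtain ⟨x, hx, hx'⟩ := Finset.mem_map.1 (hf v)
    exact ⟨x, (Finset.mem_product.1 hx).1, hx'⟩
  choose x hx hxe using hf'
  let W : Fin k → Finset (Fin t × Fin r) := fun i => Finset.univ.image fun j => x ⟨i, j⟩
  have hW : ∀ i, τ + 1 ≤ (W i).card := by
    intro i
    by_contra! hlt'
    have h1 : ((W i).image Prod.fst).card ≤ τ := le_trans Finset.card_image_le (by omega)
    obtain ⟨j, hj⟩ := hcov _ h1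
    refine (show _ → False from fun h => Finset.disjoint_left.1 hj h (hx ⟨i, j⟩)) ?_
    exact Finset.mem_image_of_mem _ (Finset.mem_image_of_mem _ (Finset.mem_univ j))
  have hdis : ∀ i ∈ (Finset.univ : Finset (Fin k)), ∀ i' ∈ (Finset.univ : Finset (Fin k)),
      i ≠ i' → Disjoint (W i) (W i') := by
    intro i _ i' _ hii
    rw [Finset.disjoint_left]
    intro y hy hy'
    obtain ⟨j, _, rfl⟩ := Finset.mem_image.1 hy
    obtain ⟨j', _, h⟩ := Finset.mem_image.1 hy'
    refine hp ⟨i, j⟩ ⟨i', j'⟩ (by simpa using hii) ?_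
    rw [← hxe, ← hxe]
    exact congrArg e h.symm
  have h1 := Finset.card_biUnion hdis
  have h2 : k * (τ + 1) ≤ ∑ i : Fin k, (W i).card := by
    have := Finset.card_nsmul_le_sum Finset.univ (fun i => (W i).card) (τ + 1) (fun i _ => hW i)
    simpa using this
  have h3 := Finset.card_le_univ (Finset.univ.biUnion W)
  simp only [Fintype.card_prod, Fintype.card_fin] at h3
  omega

/-- Counting: a hypergraph with large cover number. -/
lemma exists_hypergraph (m t b τ : ℕ) (hτ : τ ≤ t)
    (hc : (t.choose τ) * (t.choose b - (t - τ).choose b) ^ m < (t.choose b) ^ m) :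
    ∃ E : Fin m → Finset (Fin t), (∀ j, (E j).card = b) ∧
      ∀ S : Finset (Fin t), S.card ≤ τ → ∃ j, Disjoint S (E j) := by
  classical
  let P : Finset (Finset (Fin t)) := Finset.powersetCard b Finset.univ
  have hP : P.card = t.choose b := by simp [P]
  let T : Finset (Finset (Fin t)) := Finset.powersetCard τ Finset.univ
  have hT : T.card = t.choose τ := by simp [T]
  let Bad : Finset (Fin t) → Finset (Fin m → Finset (Fin t)) := fun S =>
    Fintype.piFinset fun _ : Fin m => P.filter fun e => ¬ Disjoint S e
  have hBad : ∀ S ∈ T, (Bad S).card = (t.choose b - (t - τ).choose b) ^ m := by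
    intro S hS
    have hSc : S.card = τ := (Finset.mem_powersetCard.1 hS).2
    have h1 : P.filter (fun e => Disjoint S e) = Finset.powersetCard b Sᶜ := by
      ext e
      simp only [P, Finset.mem_filter, Finset.mem_powersetCard, Finset.subset_univ, true_and]
      rw [Finset.subset_compl_iff_disjoint_left, and_comm]
    have h2 : (P.filter (fun e => Disjoint S e)).card = (t - τ).choose b := by
      rw [h1, Finset.card_powersetCard, Finset.card_compl, Fintype.card_fin, hSc]
    have h3 := Finset.card_filter_add_card_filter_not (s := P) (fun e => Disjoint S e)
    rw [Fintype.card_piFinset]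
    simp only [Finset.prod_const, Finset.card_univ, Fintype.card_fin]
    congr 1
    omega
  have hlt : (T.biUnion Bad).card < (Fintype.piFinset fun _ : Fin m => P).card := by
    calc _ ≤ ∑ S ∈ T, (Bad S).card := Finset.card_biUnion_le
      _ = t.choose τ * (t.choose b - (t - τ).choose b) ^ m := by
          rw [Finset.sum_congr rfl hBad, Finset.sum_const, hT, smul_eq_mul]
      _ < _ := by
          rw [Fintype.card_piFinset]
          simpa [hP] using hc
  obtain ⟨E, hE, hE'⟩ := Finset.exists_mem_notMem_of_card_lt_card hlt
  rw [Fintype.mem_piFinset] at hE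
  refine ⟨E, fun j => (Finset.mem_powersetCard.1 (hE j)).2, fun S hS => ?_⟩
  obtain ⟨S', hSS, hS'⟩ := Finset.exists_superset_card_eq hS (by simpa using hτ)
  by_contra! hcon
  apply hE'
  refine Finset.mem_biUnion.2 ⟨S', Finset.mem_powersetCard.2 ⟨Finset.subset_univ _, hS'⟩, ?_⟩
  rw [Fintype.mem_piFinset]
  intro j
  exact Finset.mem_filter.2 ⟨hE j, fun h => hcon j (Finset.disjoint_of_subset_left hSS h)⟩

/-- `C(qτ-τ, b) ≥ C(qτ, b) exp(-τ/(q-2))` for `b ≤ τ`. -/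
lemma choose_ratio (q τ b : ℕ) (hq : 3 ≤ q) (hb : b ≤ τ) :
    ((q * τ).choose b : ℝ) * Real.exp (-(b / (q - 2 : ℝ))) ≤ ((q * τ - τ).choose b : ℝ) := by
  have hq' : (3 : ℝ) ≤ q := by exact_mod_cast hq
  induction b with
  | zero => simp
  | succ b ih =>
    have ih := ih (by omega)
    have hτ : (b : ℝ) + 1 ≤ τ := by exact_mod_cast hb
    have hb0 : (0 : ℝ) ≤ b := by positivity
    have hle : τ ≤ q * τ := Nat.le_mul_of_pos_left _ (by omega)
    have hqτ : 3 * τ ≤ q * τ := Nat.mul_le_mul_right _ hq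
    have e1 := Nat.choose_succ_right_eq (q * τ) b
    have e2 := Nat.choose_succ_right_eq (q * τ - τ) b
    have e1' : ((q * τ).choose (b + 1) : ℝ) * (b + 1) = (q * τ).choose b * (q * τ - b) := by
      have := congrArg (Nat.cast : ℕ → ℝ) e1
      rw [Nat.cast_mul, Nat.cast_mul, Nat.cast_sub (by omega)] at this
      push_cast at this; exact this
    have e2' : ((q * τ - τ).choose (b + 1) : ℝ) * (b + 1)
        = (q * τ - τ).choose b * (q * τ - τ - b) := by
      have := congrArg (Nat.cast : ℕ → ℝ) e2
      rw [Nat.cast_mul, Nat.cast_mul, Nat.cast_sub (by omega), Nat.cast_sub hle] at this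
      push_cast at this; exact this
    have key : ((q : ℝ) * τ - b) * Real.exp (-(1 / (q - 2 : ℝ))) ≤ q * τ - τ - b := by
      have h1 := Real.add_one_le_exp (1 / (q - 2 : ℝ))
      have h2 : (q * τ - b : ℝ) ≤ (q * τ - τ - b) * (1 / (q - 2 : ℝ) + 1) := by
        have : (0 : ℝ) < q - 2 := by linarith
        have : (q * τ - τ - b : ℝ) * (1 / (q - 2 : ℝ) + 1) - (q * τ - b : ℝ)
            = (τ - b) / (q - 2) := by field_simp; ring
        have h3 : 0 ≤ ((τ : ℝ) - b) / (q - 2) := div_nonneg (by linarith) (by linarith)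
        linarith
      have h0 : (0 : ℝ) ≤ q * τ - τ - b := by nlinarith
      rw [Real.exp_neg, ← div_eq_mul_inv, div_le_iff₀ (Real.exp_pos _)]
      exact h2.trans (mul_le_mul_of_nonneg_left h1 h0)
    have hb1 : (0 : ℝ) < b + 1 := by linarith
    rw [← mul_le_mul_iff_left₀ hb1, e2']
    have hexp : Real.exp (-(((b + 1 : ℕ) : ℝ) / (q - 2 : ℝ)))
        = Real.exp (-(b / (q - 2 : ℝ))) * Real.exp (-(1 / (q - 2 : ℝ))) := by
      rw [← Real.exp_add]; congr 1; push_cast; ring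
    rw [hexp]
    have h0 : (0 : ℝ) ≤ q * τ - b := by nlinarith
    calc _ = (((q * τ).choose (b + 1) : ℝ) * (b + 1)) *
          (Real.exp (-(b / (q - 2 : ℝ))) * Real.exp (-(1 / (q - 2 : ℝ)))) := by ring
      _ = ((q * τ).choose b * Real.exp (-(b / (q - 2 : ℝ)))) *
          ((q * τ - b) * Real.exp (-(1 / (q - 2 : ℝ)))) := by rw [e1']; ring
      _ ≤ _ := mul_le_mul ih key (mul_nonneg h0 (Real.exp_pos _).le) (by positivity)

/-- core of the lower bound -/
lemma not_choosable_core (m k q τ : ℕ) (hq : 3 ≤ q) (hk : 0 < k)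
    (h : (q * τ : ℝ) < m * Real.exp (-(τ / (q - 2 : ℝ)))) :
    ¬ Choosable (Kmk m k) (τ * (k / q)) := by
  have hle : τ ≤ q * τ := Nat.le_mul_of_pos_left _ (by omega)
  obtain ⟨E, hE, hcov⟩ := exists_hypergraph m (q * τ) τ τ hle (by
    set A := (q * τ).choose τ with hA
    set B := (q * τ - τ).choose τ with hB
    have hA0 : 0 < A := Nat.choose_pos hle
    have hBA : B ≤ A := Nat.choose_le_choose _ (Nat.sub_le _ _)
    have hr := choose_ratio q τ τ hq le_rfl
    rw [← hA, ← hB] at hr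
    set ρ := Real.exp (-(τ / (q - 2 : ℝ))) with hρ
    have hA0' : (0 : ℝ) < A := by exact_mod_cast hA0
    have hA2 : (A : ℝ) ≤ Real.exp (q * τ) := by
      have h1 : (A : ℝ) ≤ 2 ^ (q * τ) := by exact_mod_cast Nat.choose_le_two_pow _ _
      have h2 : (2 : ℝ) ≤ Real.exp 1 := by
        have := Real.add_one_le_exp (1 : ℝ); linarith
      calc (A : ℝ) ≤ 2 ^ (q * τ) := h1
        _ ≤ (Real.exp 1) ^ (q * τ) := pow_le_pow_left₀ (by norm_num) h2 _
        _ = _ := by rw [← Real.exp_nat_mul]; push_cast; ring_nf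
    have h3 : ((A - B : ℕ) : ℝ) ≤ A * Real.exp (-ρ) := by
      rw [Nat.cast_sub hBA]
      have := Real.one_sub_le_exp_neg ρ
      nlinarith
    have : (A : ℝ) * ((A - B : ℕ) : ℝ) ^ m < (A : ℝ) ^ m := by
      calc (A : ℝ) * ((A - B : ℕ) : ℝ) ^ m ≤ Real.exp (q * τ) * (A * Real.exp (-ρ)) ^ m := by
            gcongr
        _ = Real.exp (q * τ - m * ρ) * (A : ℝ) ^ m := by
            rw [mul_pow, ← Real.exp_nat_mul, sub_eq_add_neg, Real.exp_add]; ring_nf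
        _ < 1 * (A : ℝ) ^ m := by
            apply mul_lt_mul_of_pos_right _ (by positivity)
            rw [Real.exp_lt_one_iff]; linarith
        _ = _ := one_mul _
    exact_mod_cast this)
  refine not_choosable_blowup m k (k / q) (q * τ) τ τ E hE hcov ?_
  have := Nat.mul_div_le k q
  nlinarith

lemma upper_bound (m k : ℕ) (ε : ℝ) (h0 : 0 < ε) (h1 : ε ≤ 1) (hm : 72 / ε ≤ Real.log m)
    (hk : 24 / ε ≤ k) : Choosable (Kmk m k) ⌊(1 + ε) * k * Real.log m⌋₊ := by
  set l := Real.log m with hl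
  have hm1 : 72 ≤ ε * l := by rw [div_le_iff₀ h0] at hm; linarith
  have hk1 : 24 ≤ ε * k := by rw [div_le_iff₀ h0] at hk; linarith
  have hl1 : 72 ≤ l := by nlinarith [div_pos (show (0 : ℝ) < 72 by norm_num) h0]
  have hk2 : (24 : ℝ) ≤ k := by nlinarith [div_pos (show (0 : ℝ) < 24 by norm_num) h0]
  have hk0 : 0 < k := by
    have : (0 : ℝ) < k := by linarith
    exact_mod_cast this
  have hm0 : 0 < m := by
    rcases Nat.eq_zero_or_pos m with rfl | h
    · simp at hl; linarith
    · exact h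
  have hm0' : (0 : ℝ) < m := by exact_mod_cast hm0
  have hs := (Nat.lt_floor_add_one ((1 + ε) * k * l)).le
  set s := ⌊(1 + ε) * k * l⌋₊
  have hkl : 24 * l ≤ ε * k * l := by nlinarith
  have hkl2 : 72 * k ≤ ε * k * l := by nlinarith
  have hs2 : (1 + ε / 2) * (k * l) ≤ s := by nlinarith
  have hklp : 0 ≤ k * l := by positivity
  refine choosable_core m k s (ε / 4) hk0 hm0 (by linarith) (by linarith) ?_ ?_
  · have : (1 - ε / 4) * ((1 + ε / 2) * (k * l)) ≤ (1 - ε / 4) * s :=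
      mul_le_mul_of_nonneg_left hs2 (by linarith)
    have h3 : (k * l) * 1 ≤ (k * l) * ((1 - ε / 4) * (1 + ε / 2)) :=
      mul_le_mul_of_nonneg_left (by nlinarith) hklp
    nlinarith
  · have hml : (m : ℝ) = Real.exp l := (Real.exp_log hm0').symm
    have hke : (k : ℝ) ≤ Real.exp k := by
      have := Real.add_one_le_exp (k : ℝ); linarith
    have hsl : k * l ≤ s := by nlinarith
    have hsl2 : ε * (k * l) ≤ ε * s := mul_le_mul_of_nonneg_left hsl h0.le
    calc (m * k : ℝ) * Real.exp (2 * k - ε / 4 * s / 2)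
        ≤ (Real.exp l * Real.exp k) * Real.exp (2 * k - ε / 4 * s / 2) := by
          rw [hml]; gcongr
      _ = Real.exp (l + k + (2 * k - ε / 4 * s / 2)) := by rw [Real.exp_add, Real.exp_add]
      _ ≤ Real.exp (-1) := by
          apply Real.exp_le_exp.2
          nlinarith
      _ < 1 / 2 := by
          rw [Real.exp_neg, one_div]
          apply inv_strictAnti₀ (by norm_num)
          have := Real.add_one_lt_exp (show (1 : ℝ) ≠ 0 by norm_num)
          linarith

lemma lower_bound (m k q : ℕ) (η : ℝ) (h0 : 0 < η) (h1 : η ≤ 1 / 4) (hq3 : 3 ≤ q)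
    (hq : 2 / η ≤ q) (hm : 2 * q ^ 2 / η ^ 2 < Real.log m) (hk : q / η ≤ k) :
    ∃ s : ℕ, (1 - 4 * η) * k * Real.log m ≤ s ∧ ¬ Choosable (Kmk m k) s := by
  set l := Real.log m with hl
  have hq3' : (3 : ℝ) ≤ q := by exact_mod_cast hq3
  have hm1 : 2 * (q : ℝ) ^ 2 < l * η ^ 2 := by rwa [div_lt_iff₀ (by positivity)] at hm
  have hk1 : (q : ℝ) ≤ k * η := by rwa [div_le_iff₀ h0] at hk
  have hq1 : 2 ≤ q * η := by rwa [div_le_iff₀ h0] at hq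
  have hl0 : 0 < l := lt_of_le_of_lt (by positivity) hm
  have hk0' : (0 : ℝ) < k := lt_of_lt_of_le (by positivity) hk
  have hk0 : 0 < k := by exact_mod_cast hk0'
  have hm0' : (0 : ℝ) < m := by
    rcases Nat.eq_zero_or_pos m with rfl | h
    · simp at hl; linarith
    · exact_mod_cast h
  have hq2 : (0 : ℝ) < q - 2 := by linarith
  have hnn : 0 ≤ (1 - η) * (q - 2) * l := by
    have : 0 ≤ 1 - η := by linarith
    positivity
  have hτ1 := Nat.floor_le hnn
  have hτ2 := (Nat.lt_floor_add_one ((1 - η) * (q - 2) * l)).le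
  set τ := ⌊(1 - η) * (q - 2) * l⌋₊
  refine ⟨τ * (k / q), ?_, not_choosable_core m k q τ hq3 hk0 ?_⟩
  · have hd : (k : ℝ) / q ≤ (k / q : ℕ) + 1 := by
      have h2 : k < q * (k / q + 1) := Nat.lt_mul_div_succ k (by omega)
      have h2' : (k : ℝ) < q * ((k / q : ℕ) + 1) := by exact_mod_cast h2
      rw [div_le_iff₀ (by linarith)]
      linarith
    set r := k / q
    have hr : (1 - η) * (k / q) ≤ r := by
      have : 1 ≤ η * (k / q : ℝ) := by
        rw [← mul_div_assoc, le_div_iff₀ (by linarith)]; linarith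
      linarith
    have hηl : 1 ≤ η * l := by nlinarith
    have hτ : (1 - 3 * η) * (q * l) ≤ τ := by
      have e1 : (1 - η) * q ≤ q - 2 := by linarith
      have e2 : (1 - η) * ((1 - η) * q) ≤ (1 - η) * (q - 2) :=
        mul_le_mul_of_nonneg_left e1 (by linarith)
      have e3 := mul_le_mul_of_nonneg_right e2 hl0.le
      have e4 : 1 ≤ η * l * q := by nlinarith
      nlinarith [mul_pos (mul_pos h0 h0) (mul_pos (show (0 : ℝ) < q by linarith) hl0)]
    push_cast
    calc (1 - 4 * η) * k * l ≤ ((1 - 3 * η) * (1 - η)) * (k * l) := by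
          have : 0 < k * l := by positivity
          nlinarith [mul_pos (mul_pos h0 h0) this]
      _ = ((1 - 3 * η) * (q * l)) * ((1 - η) * (k / q)) := by
          field_simp
      _ ≤ τ * r := by
          apply mul_le_mul hτ hr
          · have : 0 ≤ 1 - η := by linarith
            positivity
          · positivity
  · have e1 : (τ : ℝ) / (q - 2) ≤ (1 - η) * l := by
      rw [div_le_iff₀ hq2]; linarith
    have e2 : Real.exp (η * l) ≤ m * Real.exp (-(τ / (q - 2 : ℝ))) := by
      nth_rewrite 1 [show (m : ℝ) = Real.exp l from (Real.exp_log hm0').symm]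
      rw [← Real.exp_add]
      apply Real.exp_le_exp.2
      linarith
    refine lt_of_lt_of_le ?_ e2
    have e3 := Real.quadratic_le_exp_of_nonneg (show 0 ≤ η * l by positivity)
    have e4 : (τ : ℝ) ≤ q * l := by
      refine hτ1.trans ?_
      apply mul_le_mul_of_nonneg_right _ hl0.le
      nlinarith
    have e5 : (q : ℝ) * τ ≤ q * (q * l) := mul_le_mul_of_nonneg_left e4 (by linarith)
    have e6 := mul_lt_mul_of_pos_right hm1 hl0
    have : 0 < η * l := by positivity
    nlinarith

/-- **Asymptotics of the choice number of `K_{m*k}`.** As `m` and `k` both tend to infinity,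
`ch(K_{m*k}) = (1+o(1))·k·ln m`. -/
theorem choiceNumber_Kmk_asymptotics :
    ∀ ε : ℝ, 0 < ε → ∃ N : ℕ, ∀ m k : ℕ, N < m → N < k →
      (1 - ε) * k * Real.log m ≤ (choiceNumber (Kmk m k) : ℝ) ∧
      (choiceNumber (Kmk m k) : ℝ) ≤ (1 + ε) * k * Real.log m := by
  intro ε hε
  obtain ⟨δ, hδ⟩ : ∃ δ, δ = min ε 1 := ⟨_, rfl⟩
  have hδ0 : 0 < δ := by rw [hδ]; exact lt_min hε one_pos
  have hδ1 : δ ≤ 1 := by rw [hδ]; exact min_le_right _ _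
  have hδε : δ ≤ ε := by rw [hδ]; exact min_le_left _ _
  obtain ⟨q, hq⟩ : ∃ q : ℕ, q = ⌈2 / (δ / 4)⌉₊ + 3 := ⟨_, rfl⟩
  have hq2 : 2 / (δ / 4) ≤ q := by
    have := Nat.le_ceil (2 / (δ / 4))
    rw [hq]; push_cast; linarith
  set Λ : ℝ := 72 / δ + 2 * q ^ 2 / (δ / 4) ^ 2 + 1 with hΛ
  set Κ : ℝ := 24 / δ + q / (δ / 4) with hΚ
  have p1 : 0 < 72 / δ := by positivity
  have p2 : 0 ≤ 2 * (q : ℝ) ^ 2 / (δ / 4) ^ 2 := by positivity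
  have p3 : 0 < 24 / δ := by positivity
  have p4 : 0 ≤ (q : ℝ) / (δ / 4) := by positivity
  refine ⟨⌈Real.exp Λ⌉₊ + ⌈Κ⌉₊, fun m k hm hk => ?_⟩
  have hm' : Real.exp Λ ≤ m := (Nat.le_ceil _).trans (by exact_mod_cast (by omega))
  have hk' : Κ ≤ k := (Nat.le_ceil _).trans (by exact_mod_cast (by omega))
  have hl : Λ ≤ Real.log m :=
    (Real.le_log_iff_exp_le (lt_of_lt_of_le (Real.exp_pos _) hm')).2 hm'
  have hkl : 0 ≤ k * Real.log m := mul_nonneg (by positivity) (by linarith)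
  have hup := upper_bound m k δ hδ0 hδ1 (by linarith) (by linarith)
  obtain ⟨s, hs, hns⟩ := lower_bound m k q (δ / 4) (by linarith) (by linarith) (by omega) hq2
    (by linarith) (by linarith)
  constructor
  · have hlt : s ≤ choiceNumber (Kmk m k) := by
      by_contra! hcon
      have hmem : Choosable (Kmk m k) (choiceNumber (Kmk m k)) :=
        Nat.sInf_mem (s := {s | Choosable (Kmk m k) s}) ⟨_, hup⟩
      exact hns (choosable_succ hcon.le hmem)
    have hlt' : (s : ℝ) ≤ choiceNumber (Kmk m k) := by exact_mod_cast hlt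
    nlinarith
  · have hle : choiceNumber (Kmk m k) ≤ ⌊(1 + δ) * k * Real.log m⌋₊ := Nat.sInf_le hup
    have hle' : (choiceNumber (Kmk m k) : ℝ) ≤ ⌊(1 + δ) * k * Real.log m⌋₊ := by
      exact_mod_cast hle
    have := Nat.floor_le (show 0 ≤ (1 + δ) * k * Real.log m by
      rw [mul_assoc]; exact mul_nonneg (by linarith) hkl)
    nlinarith
end

section
/- For any fixed integer m ≥ 1, the limit as k tends to infinity of ch(K_{m*k})/k exists. Moreover, there exist absolute positive constants c1 and c2 such that for all m ≥ 2 this limit lies between c1·ln m and c2·ln m. -/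
theorem Choosable.mono_card {V : Type*} {G : SimpleGraph V} {s : ℕ} (h : Choosable G s)
    (L : V → Finset ℕ) (hL : ∀ v, s ≤ (L v).card) :
    ∃ f : V → ℕ, (∀ v, f v ∈ L v) ∧ ∀ u v, G.Adj u v → f u ≠ f v := by
  choose L' hsub hcard using fun v => Finset.exists_subset_card_eq (hL v)
  obtain ⟨f, hf, hadj⟩ := h L' hcard
  exact ⟨f, fun v => hsub v (hf v), hadj⟩

theorem Choosable.mono {V : Type*} {G : SimpleGraph V} {s s' : ℕ} (h : Choosable G s)
    (hs : s ≤ s') : Choosable G s' :=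
  fun L hL => h.mono_card L fun v => by rw [hL v]; exact hs

theorem choosable_card {V : Type*} [Fintype V] (G : SimpleGraph V) :
    Choosable G (Fintype.card V) := by
  classical
  intro L hL
  have := (Finset.all_card_le_biUnion_card_iff_exists_injective L).1 (by
    intro s
    rcases s.eq_empty_or_nonempty with rfl | ⟨v, hv⟩
    · simp
    · calc s.card ≤ Fintype.card V := Finset.card_le_univ s
        _ = (L v).card := (hL v).symm
        _ ≤ _ := Finset.card_le_card (Finset.subset_biUnion_of_mem L hv))
  obtain ⟨f, hinj, hf⟩ := this
  exact ⟨f, hf, fun u v huv h => huv.ne (hinj h)⟩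

theorem choosable_choiceNumber {V : Type*} [Fintype V] (G : SimpleGraph V) :
    Choosable G (choiceNumber G) :=
  Nat.sInf_mem (s := {s | Choosable G s}) ⟨_, choosable_card G⟩

theorem choiceNumber_le {V : Type*} {G : SimpleGraph V} {s : ℕ} (h : Choosable G s) :
    choiceNumber G ≤ s := Nat.sInf_le h

theorem le_choiceNumber {V : Type*} [Fintype V] {G : SimpleGraph V} {s : ℕ}
    (h : ¬ Choosable G s) : s ≤ choiceNumber G := by
  by_contra! hlt
  exact h ((choosable_choiceNumber G).mono hlt.le)

theorem choiceNumber_Kmk_le (m k : ℕ) : choiceNumber (Kmk m k) ≤ k * m := by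
  have := choiceNumber_le (choosable_card (Kmk m k))
  simpa using this

theorem choosable_Kmk_mono {m k k' s : ℕ} (hk : k ≤ k') (h : Choosable (Kmk m k') s) :
    Choosable (Kmk m k) s := by
  intro L hL
  rcases Nat.eq_zero_or_pos k with rfl | hk0
  · exact ⟨fun _ => 0, fun v => v.1.elim0, fun v => v.1.elim0⟩
  obtain ⟨f, hf, hadj⟩ := h (fun v => L ⟨if h : v.1.1 < k then ⟨v.1.1, h⟩ else ⟨0, hk0⟩, v.2⟩)
    (fun v => hL _)
  refine ⟨fun v => f ⟨Fin.castLE hk v.1, v.2⟩, fun v => ?_, fun u v huv => ?_⟩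
  · have := hf ⟨Fin.castLE hk v.1, v.2⟩
    simpa using this
  · apply hadj
    simp only [SimpleGraph.comap_adj, SimpleGraph.top_adj] at huv ⊢
    intro h
    exact huv (Fin.castLE_injective hk h)

theorem choiceNumber_Kmk_mono {m k k' : ℕ} (hk : k ≤ k') :
    choiceNumber (Kmk m k) ≤ choiceNumber (Kmk m k') :=
  choiceNumber_le (choosable_Kmk_mono hk (choosable_choiceNumber _))

/-- Random splitting of the colors, by an exponential moment argument. -/
theorem exists_split {V α : Type*} [Fintype V] [Fintype α] [DecidableEq α] (q s t : ℕ) (hq : 1 ≤ q)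
    (L : V → Finset α) (hL : ∀ v, (L v).card = s) (h : V → Fin q) (x : ℝ) (hx0 : 0 ≤ x)
    (hx1 : x ≤ 1)
    (hlt : (Fintype.card V : ℝ) * (1 - (1 - x) / q) ^ s < x ^ (t - 1)) :
    ∃ g : α → Fin q, ∀ v, t ≤ ((L v).filter fun c => g c = h v).card := by
  classical
  by_contra! hbad
  have hq0 : (0 : ℝ) < q := by exact_mod_cast hq
  have key : ∀ v, ∑ g : α → Fin q, x ^ ((L v).filter fun c => g c = h v).card
      = (q : ℝ) ^ (Fintype.card α) * (1 - (1 - x) / q) ^ s := by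
    intro v
    have h1 : ∀ g : α → Fin q, x ^ ((L v).filter fun c => g c = h v).card
        = ∏ c, (if c ∈ L v then (if g c = h v then x else 1) else 1) := by
      intro g
      rw [Finset.prod_ite_mem, Finset.univ_inter, ← Finset.prod_filter, Finset.prod_const]
    simp_rw [h1]
    rw [← Fintype.prod_sum (fun c j => if c ∈ L v then (if j = h v then x else 1) else (1 : ℝ))]
    have h2 : ∀ c, ∑ j : Fin q, (if c ∈ L v then (if j = h v then x else 1) else (1 : ℝ))
        = q * (if c ∈ L v then (1 - (1 - x) / q) else 1) := by
      intro c
      split_ifs with hc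
      · have : ∀ j : Fin q, (if j = h v then x else 1) = 1 - (if j = h v then 1 - x else 0) := by
          intro j; split_ifs <;> ring
        simp_rw [this]
        rw [Finset.sum_sub_distrib]
        simp
        field_simp
      · simp
    simp_rw [h2]
    rw [Finset.prod_mul_distrib, Finset.prod_ite_mem, Finset.univ_inter, Finset.prod_const,
      Finset.prod_const, hL v, Finset.card_univ]
  have hge : ∀ g : α → Fin q,
      x ^ (t - 1) ≤ ∑ v, x ^ ((L v).filter fun c => g c = h v).card := by
    intro g
    obtain ⟨v, hv⟩ := hbad g
    calc x ^ (t - 1) ≤ x ^ ((L v).filter fun c => g c = h v).card :=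
          pow_le_pow_of_le_one hx0 hx1 (by omega)
      _ ≤ _ := Finset.single_le_sum
          (f := fun v => x ^ ((L v).filter fun c => g c = h v).card)
          (fun v _ => pow_nonneg hx0 _) (Finset.mem_univ v)
  have hsum := Finset.sum_le_sum (fun g (_ : g ∈ (Finset.univ : Finset (α → Fin q))) => hge g)
  rw [Finset.sum_comm] at hsum
  simp_rw [key] at hsum
  simp only [Finset.sum_const, Finset.card_univ, Fintype.card_fun, Fintype.card_fin, nsmul_eq_mul]
    at hsum
  push_cast at hsum
  have hpos : (0 : ℝ) < (q : ℝ) ^ (Fintype.card α) := by positivity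
  have := mul_lt_mul_of_pos_left hlt hpos
  nlinarith

theorem choosable_split {m k q s t : ℕ} (hq : 1 ≤ q) (ht : Choosable (Kmk m k) t) (x : ℝ)
    (hx0 : 0 ≤ x) (hx1 : x ≤ 1)
    (hlt : ((q * k * m : ℕ) : ℝ) * (1 - (1 - x) / q) ^ s < x ^ (t - 1)) :
    Choosable (Kmk m (q * k)) s := by
  classical
  intro L hL
  let C : Finset ℕ := Finset.univ.biUnion L
  have hLC : ∀ v, L v ⊆ C := fun v => Finset.subset_biUnion_of_mem L (Finset.mem_univ v)
  let L' : ((_ : Fin (q * k)) × Fin m) → Finset C := fun v => (L v).subtype (· ∈ C)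
  have hL' : ∀ v, (L' v).card = s := by
    intro v
    rw [Finset.card_subtype, Finset.filter_true_of_mem (fun c hc => hLC v hc), hL v]
  obtain ⟨g, hg⟩ := exists_split q s t hq L' hL'
    (fun v => (finProdFinEquiv.symm v.1).1) x hx0 hx1 (by simpa using hlt)
  have hcol : ∀ j : Fin q, ∃ f : ((_ : Fin k) × Fin m) → ℕ,
      (∀ v, f v ∈ ((L' ⟨finProdFinEquiv (j, v.1), v.2⟩).filter fun c => g c = j).map
        (Function.Embedding.subtype _)) ∧
      ∀ u v, (Kmk m k).Adj u v → f u ≠ f v := by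
    intro j
    apply ht.mono_card
    intro v
    rw [Finset.card_map]
    have := hg ⟨finProdFinEquiv (j, v.1), v.2⟩
    simpa using this
  choose f hf hadj using hcol
  have hmem : ∀ v : (_ : Fin (q * k)) × Fin m, ∃ c : C,
      (c : ℕ) = f (finProdFinEquiv.symm v.1).1 ⟨(finProdFinEquiv.symm v.1).2, v.2⟩ ∧
      (c : ℕ) ∈ L v ∧ g c = (finProdFinEquiv.symm v.1).1 := by
    intro v
    have := hf (finProdFinEquiv.symm v.1).1 ⟨(finProdFinEquiv.symm v.1).2, v.2⟩
    rw [Finset.mem_map] at this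
    obtain ⟨c, hc, hcf⟩ := this
    rw [Finset.mem_filter] at hc
    refine ⟨c, hcf, ?_, hc.2⟩
    have h3 := hc.1
    simp only [L', Finset.mem_subtype, Prod.mk.eta, Equiv.apply_symm_apply] at h3
    exact h3
  refine ⟨fun v => f (finProdFinEquiv.symm v.1).1 ⟨(finProdFinEquiv.symm v.1).2, v.2⟩,
    fun v => ?_, fun u v huv heq => ?_⟩
  · obtain ⟨c, h1, h2, h3⟩ := hmem v
    simp only
    rw [← h1]; exact h2
  · obtain ⟨c, h1, h2, h3⟩ := hmem u
    obtain ⟨c', h1', h2', h3'⟩ := hmem v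
    simp only at heq
    have hcc : c = c' := Subtype.ext (by rw [h1, h1', heq])
    have hgrp : (finProdFinEquiv.symm u.1).1 = (finProdFinEquiv.symm v.1).1 := by
      rw [← h3, ← h3', hcc]
    rw [hgrp] at heq
    refine hadj _ _ _ ?_ heq
    simp only [SimpleGraph.comap_adj, SimpleGraph.top_adj] at huv ⊢
    intro h
    exact huv (finProdFinEquiv.symm.injective (Prod.ext hgrp h))

/-- The lower bound construction. -/
theorem not_choosable_Kmk {m k t r : ℕ} (hm : (2 * t).choose t ≤ m)
    (hk : 2 * t * r < k * (t + 1)) : ¬ Choosable (Kmk m k) (t * r) := by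
  classical
  intro hch
  let P := Finset.powersetCard t (Finset.range (2 * t))
  have hPcard : P.card = (2 * t).choose t := by simp [P]
  have hPne : P.Nonempty := by
    rw [← Finset.card_pos, hPcard]; exact Nat.choose_pos (by omega)
  obtain ⟨A, hAP, hsurj⟩ : ∃ A : Fin m → Finset ℕ, (∀ j, A j ∈ P) ∧ ∀ B ∈ P, ∃ j, A j = B := by
    let e := P.equivFin
    have hP0 : 0 < P.card := Finset.card_pos.2 hPne
    refine ⟨fun j => (e.symm (if h : j.1 < P.card then ⟨j.1, h⟩ else ⟨0, hP0⟩)).1,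
      fun j => Subtype.mem _, fun B hB => ?_⟩
    refine ⟨⟨(e ⟨B, hB⟩).1, lt_of_lt_of_le (e ⟨B, hB⟩).2 (by omega)⟩, ?_⟩
    simp
  obtain ⟨f, hf, hadj⟩ := hch
    (fun v => (A v.2 ×ˢ Finset.range r).map Nat.pairEquiv.toEmbedding) (by
      intro v
      have := (Finset.mem_powersetCard.1 (hAP v.2)).2
      simp [this])
  have hf' : ∀ v, (Nat.unpair (f v)).1 ∈ A v.2 ∧ (Nat.unpair (f v)).2 < r := by
    intro v
    have := hf v
    rw [Finset.mem_map] at this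
    obtain ⟨⟨a, b⟩, hab, he⟩ := this
    rw [← he]
    simpa using hab
  let T : Fin k → Finset ℕ := fun i => Finset.univ.image fun j : Fin m => f ⟨i, j⟩
  have hTdisj : ∀ i ∈ (Finset.univ : Finset (Fin k)), ∀ i' ∈ (Finset.univ : Finset (Fin k)),
      i ≠ i' → Disjoint (T i) (T i') := by
    intro i _ i' _ hne
    rw [Finset.disjoint_left]
    intro c hc hc'
    simp only [T, Finset.mem_image, Finset.mem_univ, true_and] at hc hc'
    obtain ⟨j, rfl⟩ := hc
    obtain ⟨j', hj'⟩ := hc'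
    refine hadj ⟨i', j'⟩ ⟨i, j⟩ ?_ hj'
    simpa [SimpleGraph.completeMultipartiteGraph] using hne.symm
  have hTU : Finset.univ.biUnion T ⊆
      (Finset.range (2 * t) ×ˢ Finset.range r).map Nat.pairEquiv.toEmbedding := by
    intro c hc
    simp only [T, Finset.mem_biUnion, Finset.mem_image, Finset.mem_univ, true_and] at hc
    obtain ⟨i, j, rfl⟩ := hc
    have h1 := hf' ⟨i, j⟩
    rw [Finset.mem_map]
    refine ⟨Nat.unpair (f ⟨i, j⟩), ?_, Nat.pairEquiv.apply_symm_apply _⟩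
    rw [Finset.mem_product]
    exact ⟨(Finset.mem_powersetCard.1 (hAP j)).1 h1.1, Finset.mem_range.2 h1.2⟩
  have hTcard : ∀ i, t + 1 ≤ (T i).card := by
    intro i
    by_contra! hlt
    let B := (T i).image fun c => (Nat.unpair c).1
    have hB : B.card ≤ t := Finset.card_image_le.trans (by omega)
    have hcomp : t ≤ (Finset.range (2 * t) \ B).card := by
      have := Finset.le_card_sdiff B (Finset.range (2 * t))
      rw [Finset.card_range] at this
      omega
    obtain ⟨D, hD, hDc⟩ := Finset.exists_subset_card_eq hcomp
    obtain ⟨j, hj⟩ := hsurj D (Finset.mem_powersetCard.2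
      ⟨hD.trans Finset.sdiff_subset, hDc⟩)
    have h1 := (hf' ⟨i, j⟩).1
    simp only [hj] at h1
    have h2 := (Finset.mem_sdiff.1 (hD h1)).2
    exact h2 (Finset.mem_image.2 ⟨f ⟨i, j⟩, Finset.mem_image.2 ⟨j, Finset.mem_univ _, rfl⟩, rfl⟩)
  have h1 := Finset.card_le_card hTU
  rw [Finset.card_biUnion hTdisj] at h1
  have h2 : k * (t + 1) ≤ ∑ i, (T i).card := by
    have := Finset.sum_le_sum (fun i (_ : i ∈ (Finset.univ : Finset (Fin k))) => hTcard i)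
    simpa using this
  simp only [Finset.card_map, Finset.card_product, Finset.card_range] at h1
  omega

/-- Fourth root. -/
noncomputable def qroot (k : ℕ) : ℝ := Real.sqrt (Real.sqrt k)

theorem qroot_pow (k : ℕ) : qroot k ^ 4 = (k : ℝ) := by
  have h1 : qroot k ^ 2 = Real.sqrt k := Real.sq_sqrt (Real.sqrt_nonneg _)
  have h2 : Real.sqrt k ^ 2 = (k : ℝ) := Real.sq_sqrt (Nat.cast_nonneg k)
  calc qroot k ^ 4 = (qroot k ^ 2) ^ 2 := by ring
    _ = (k : ℝ) := by rw [h1, h2]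

theorem qroot_mono {a b : ℕ} (h : a ≤ b) : qroot a ≤ qroot b :=
  Real.sqrt_le_sqrt (Real.sqrt_le_sqrt (by exact_mod_cast h))

theorem one_le_qroot {k : ℕ} (hk : 1 ≤ k) : 1 ≤ qroot k := by
  have := qroot_mono hk
  simpa [qroot] using this

theorem qroot_mul_two (k : ℕ) : 10 / 9 * qroot k ≤ qroot (2 * k) := by
  have h0 : 0 ≤ qroot k := Real.sqrt_nonneg _
  refine le_of_pow_le_pow_left₀ (n := 4) (by norm_num) (Real.sqrt_nonneg _) ?_
  have h1 := qroot_pow (2 * k)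
  have h2 := qroot_pow k
  change (10 / 9 * qroot k) ^ 4 ≤ (qroot (2 * k)) ^ 4
  rw [h1, mul_pow, h2]
  push_cast
  have : (0 : ℝ) ≤ k := Nat.cast_nonneg k
  linarith

theorem exp_neg_le_one_sub {l : ℝ} (h0 : 0 ≤ l) (h1 : l ≤ 1 / 2) :
    Real.exp (-(l + l ^ 2)) ≤ 1 - l := by
  have hz : 0 ≤ l + l ^ 2 := by positivity
  have h2 := Real.quadratic_le_exp_of_nonneg hz
  rw [Real.exp_neg, inv_le_comm₀ (Real.exp_pos _) (by linarith)]
  refine le_trans ?_ h2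
  rw [inv_le_iff_one_le_mul₀ (by linarith)]
  have h3 : 0 ≤ l ^ 2 * (1 - l - l ^ 2 - l ^ 3) := by
    apply mul_nonneg (by positivity)
    have e2 : l ^ 2 ≤ 1 / 4 := by nlinarith
    have e3 : l ^ 3 ≤ 1 / 8 := by nlinarith [mul_nonneg h0 h0]
    linarith
  nlinarith

theorem choiceNumber_split {m k q : ℕ} (hm : 1 ≤ m) (hk : 4 ≤ k) (hq : 1 ≤ q) (hqk : q ≤ k ^ 2) :
    (choiceNumber (Kmk m (q * k)) : ℝ) ≤
      q * (choiceNumber (Kmk m k) + 16 * m * qroot k ^ 3) := by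
  set t := choiceNumber (Kmk m k) with ht
  set y := qroot k with hy
  have hy1 : 1 ≤ y := one_le_qroot (by omega)
  have hy4 : y ^ 4 = k := qroot_pow k
  have hm1 : (1 : ℝ) ≤ m := by exact_mod_cast hm
  have hk4 : (4 : ℝ) ≤ k := by exact_mod_cast hk
  have hq1 : (1 : ℝ) ≤ q := by exact_mod_cast hq
  have hy2 : 2 ≤ y ^ 2 := by
    nlinarith [sq_nonneg y]
  have htm : (t : ℝ) ≤ k * m := by exact_mod_cast choiceNumber_Kmk_le m k
  set w : ℝ := 12 * y ^ 3 + 2 * m * y ^ 2 with hw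
  have hw0 : 0 ≤ w := by positivity
  set d := ⌊w⌋₊ + 1 with hd
  have hdw : w < d := by
    have := Nat.lt_floor_add_one w
    rw [hd]; push_cast; exact this
  have hdw' : (d : ℝ) ≤ w + 1 := by
    have := Nat.floor_le hw0
    rw [hd]; push_cast; linarith
  have hdb : (d : ℝ) ≤ 16 * m * y ^ 3 := by
    have e1 : y ^ 2 ≤ y ^ 3 := pow_le_pow_right₀ hy1 (by norm_num)
    have e2 : 1 ≤ y ^ 3 := one_le_pow₀ hy1
    have e3 : y ^ 3 ≤ m * y ^ 3 := le_mul_of_one_le_left (by linarith) hm1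
    have e4 : m * y ^ 2 ≤ m * y ^ 3 := mul_le_mul_of_nonneg_left e1 (by linarith)
    linarith
  set l : ℝ := 1 / y ^ 2 with hl
  have hl0 : 0 < l := by positivity
  have hl1 : l ≤ 1 / 2 := one_div_le_one_div_of_le (by norm_num) hy2
  have hch : Choosable (Kmk m (q * k)) (q * (t + d)) := by
    apply choosable_split hq (choosable_choiceNumber (Kmk m k)) (1 - l) (by linarith) (by linarith)
    rw [← ht]
    have hA : (1 - (1 - (1 - l)) / (q : ℝ)) ^ (q * (t + d)) ≤ Real.exp (-(l * (t + d))) := by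
      have hlq : l / q ≤ 1 := by
        rw [div_le_one (by linarith)]; linarith
      have e1 : 1 - (1 - (1 - l)) / (q : ℝ) = 1 - l / q := by ring
      rw [e1]
      calc (1 - l / (q : ℝ)) ^ (q * (t + d))
          ≤ (Real.exp (-(l / q))) ^ (q * (t + d)) :=
            pow_le_pow_left₀ (by linarith) (Real.one_sub_le_exp_neg _) _
        _ = Real.exp (-(l * (t + d))) := by
            rw [← Real.exp_nat_mul]
            congr 1
            push_cast
            field_simp
    have hB : Real.exp (-(t * (l + l ^ 2))) ≤ (1 - l) ^ (t - 1) := by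
      calc Real.exp (-(t * (l + l ^ 2))) = (Real.exp (-(l + l ^ 2))) ^ t := by
            rw [← Real.exp_nat_mul]; congr 1; ring
        _ ≤ (1 - l) ^ t :=
            pow_le_pow_left₀ (Real.exp_pos _).le (exp_neg_le_one_sub hl0.le hl1) _
        _ ≤ (1 - l) ^ (t - 1) :=
            pow_le_pow_of_le_one (by linarith) (by linarith) (by omega)
    have hM : ((q * k * m : ℕ) : ℝ) < Real.exp (l * d - t * l ^ 2) := by
      have e1 : ((q * k * m : ℕ) : ℝ) ≤ Real.exp (m + 12 * y) := by
        have f1 : (m : ℝ) ≤ Real.exp m := by linarith [Real.add_one_le_exp (m : ℝ)]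
        have f2 : y ≤ Real.exp y := by linarith [Real.add_one_le_exp y]
        have f3 : ((q * k : ℕ) : ℝ) ≤ Real.exp (12 * y) := by
          calc ((q * k : ℕ) : ℝ) ≤ (k : ℝ) ^ 2 * k := by
                push_cast
                gcongr
                exact_mod_cast hqk
            _ = y ^ 12 := by rw [← hy4]; ring
            _ ≤ (Real.exp y) ^ 12 := pow_le_pow_left₀ (by linarith) f2 _
            _ = Real.exp (12 * y) := by rw [← Real.exp_nat_mul]; norm_num
        rw [Nat.cast_mul, Real.exp_add, mul_comm]
        exact mul_le_mul f1 f3 (Nat.cast_nonneg _) (Real.exp_pos _).le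
      refine e1.trans_lt (Real.exp_lt_exp.2 ?_)
      have e2 : t * l ^ 2 ≤ m := by
        have : l ^ 2 = 1 / k := by rw [hl, ← hy4]; field_simp
        rw [this, mul_one_div, div_le_iff₀ (by linarith)]
        linarith
      have e3 : 12 * y + 2 * m < l * d := by
        have : l * w = 12 * y + 2 * m := by
          rw [hl, hw]; field_simp
        rw [← this]
        exact mul_lt_mul_of_pos_left hdw hl0
      linarith
    calc ((q * k * m : ℕ) : ℝ) * (1 - (1 - (1 - l)) / (q : ℝ)) ^ (q * (t + d))
        ≤ ((q * k * m : ℕ) : ℝ) * Real.exp (-(l * (t + d))) :=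
          mul_le_mul_of_nonneg_left hA (Nat.cast_nonneg _)
      _ < Real.exp (l * d - t * l ^ 2) * Real.exp (-(l * (t + d))) :=
          mul_lt_mul_of_pos_right hM (Real.exp_pos _)
      _ = Real.exp (-(t * (l + l ^ 2))) := by
          rw [← Real.exp_add]; congr 1; ring
      _ ≤ _ := hB
  have h1 : (choiceNumber (Kmk m (q * k)) : ℝ) ≤ ((q * (t + d) : ℕ) : ℝ) := by
    exact_mod_cast choiceNumber_le hch
  push_cast at h1
  refine h1.trans ?_
  gcongr

/-- The normalized choice number. -/
noncomputable def chRatio (m k : ℕ) : ℝ := (choiceNumber (Kmk m k) : ℝ) / k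

theorem chRatio_nonneg (m k : ℕ) : 0 ≤ chRatio m k := by unfold chRatio; positivity

theorem chRatio_le (m k : ℕ) (hk : 1 ≤ k) : chRatio m k ≤ m := by
  unfold chRatio
  have : (0 : ℝ) < k := by exact_mod_cast hk
  rw [div_le_iff₀ this, mul_comm]
  exact_mod_cast choiceNumber_Kmk_le m k

theorem chRatio_split {m k q : ℕ} (hm : 1 ≤ m) (hk : 4 ≤ k) (hq : 1 ≤ q) (hqk : q ≤ k ^ 2) :
    chRatio m (q * k) ≤ chRatio m k + 16 * m / qroot k := by
  have h := choiceNumber_split hm hk hq hqk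
  have hy1 : 1 ≤ qroot k := one_le_qroot (by omega)
  have hk0 : (0 : ℝ) < k := by exact_mod_cast (by omega : 0 < k)
  have hq0 : (0 : ℝ) < q := by exact_mod_cast hq
  unfold chRatio
  rw [Nat.cast_mul, div_le_iff₀ (by positivity)]
  refine h.trans (le_of_eq ?_)
  have hy4 := qroot_pow k
  have e : 16 * m * qroot k ^ 3 = 16 * m / qroot k * k := by
    rw [← hy4]; field_simp
  rw [e]
  field_simp

theorem chRatio_dyadic {m k : ℕ} (hm : 1 ≤ m) (hk : 4 ≤ k) (i : ℕ) :
    chRatio m (2 ^ i * k) + 160 * m / qroot (2 ^ i * k) ≤ chRatio m k + 160 * m / qroot k := by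
  induction i with
  | zero => simp
  | succ i ih =>
    refine le_trans ?_ ih
    have hk' : 4 ≤ 2 ^ i * k := hk.trans (Nat.le_mul_of_pos_left k (by positivity))
    have e : 2 ^ (i + 1) * k = 2 * (2 ^ i * k) := by ring
    rw [e]
    generalize 2 ^ i * k = n at hk'
    have h1 := chRatio_split (q := 2) hm hk' (by norm_num) (by nlinarith)
    have h2 := qroot_mul_two n
    have hy1 : 1 ≤ qroot n := one_le_qroot (by omega)
    have h3 : 160 * (m : ℝ) / qroot (2 * n) ≤ 144 * m / qroot n := by
      calc 160 * (m : ℝ) / qroot (2 * n) ≤ 160 * m / (10 / 9 * qroot n) := by gcongr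
        _ = _ := by field_simp; norm_num
    have h4 : 160 * (m : ℝ) / qroot n = 144 * m / qroot n + 16 * m / qroot n := by ring
    linarith

theorem chRatio_eventually {m K : ℕ} (hm : 1 ≤ m) (hK : 4 ≤ K) (n : ℕ) (hn : K ^ 2 ≤ n) :
    chRatio m n ≤ chRatio m K + 353 * m / qroot K := by
  have hK2 : 0 < K ^ 2 := by positivity
  have hne : n / K ^ 2 ≠ 0 := (Nat.div_pos hn hK2).ne'
  set i := Nat.log 2 (n / K ^ 2) with hi
  have hi1 : 2 ^ i * K ^ 2 ≤ n :=
    (Nat.le_div_iff_mul_le hK2).1 (Nat.pow_log_le_self 2 hne)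
  have hi2 : n < 2 ^ (i + 1) * K ^ 2 :=
    (Nat.div_lt_iff_lt_mul hK2).1 (Nat.lt_pow_succ_log_self (by norm_num) _)
  have hpos : 0 < 2 ^ i * K := by positivity
  set q := n / (2 ^ i * K) + 1 with hq
  have hq0 : 0 < q := Nat.succ_pos _
  have hq1 : n ≤ 2 ^ i * (q * K) := by
    have := Nat.lt_div_mul_add (a := n) hpos
    calc n ≤ n / (2 ^ i * K) * (2 ^ i * K) + 2 ^ i * K := this.le
      _ = 2 ^ i * (q * K) := by rw [hq]; ring
  have hq2 : q ≤ 2 * K := by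
    have : n / (2 ^ i * K) < 2 * K := by
      rw [Nat.div_lt_iff_lt_mul hpos]
      calc n < _ := hi2
        _ = _ := by ring
    omega
  have hq3 : 2 ^ i * (q * K) ≤ n + 2 ^ i * K := by
    have := Nat.div_mul_le_self n (2 ^ i * K)
    calc 2 ^ i * (q * K) = n / (2 ^ i * K) * (2 ^ i * K) + 2 ^ i * K := by rw [hq]; ring
      _ ≤ _ := by omega
  have hqK : 4 ≤ q * K := hK.trans (Nat.le_mul_of_pos_left K hq0)
  set N := 2 ^ i * (q * K) with hN
  have hKr : (4 : ℝ) ≤ K := by exact_mod_cast hK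
  have hNn : (N : ℝ) * K ≤ n * (K + 1) := by
    have : N * K ≤ n * (K + 1) := by
      calc N * K ≤ (n + 2 ^ i * K) * K := Nat.mul_le_mul_right _ hq3
        _ = n * K + 2 ^ i * K ^ 2 := by ring
        _ ≤ n * K + n := by omega
        _ = _ := by ring
    exact_mod_cast this
  have hn0 : (0 : ℝ) < n := by exact_mod_cast (lt_of_lt_of_le hK2 hn)
  have hN0 : (0 : ℝ) < N := lt_of_lt_of_le hn0 (by exact_mod_cast hq1)
  have hy1 : 1 ≤ qroot K := one_le_qroot (by omega)
  have hm0 : (0 : ℝ) ≤ m := Nat.cast_nonneg m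
  have s1 : chRatio m n ≤ chRatio m N * (1 + 1 / K) := by
    unfold chRatio
    have : (choiceNumber (Kmk m n) : ℝ) ≤ choiceNumber (Kmk m N) := by
      exact_mod_cast choiceNumber_Kmk_mono hq1
    rw [div_le_iff₀ hn0]
    refine this.trans ?_
    have hc : (0 : ℝ) ≤ choiceNumber (Kmk m N) := Nat.cast_nonneg _
    rw [div_mul_eq_mul_div, div_mul_eq_mul_div, le_div_iff₀ hN0, mul_assoc]
    apply mul_le_mul_of_nonneg_left _ hc
    have : (1 + 1 / (K : ℝ)) * n = n * (K + 1) / K := by field_simp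
    rw [this, le_div_iff₀ (by linarith)]
    exact hNn
  have s2 := chRatio_dyadic hm hqK i
  have s3 := chRatio_split (q := q) hm hK hq0 (by nlinarith)
  have s4 : 0 ≤ 160 * m / qroot N := by
    have : 0 ≤ qroot N := Real.sqrt_nonneg _
    positivity
  have s5 : 160 * m / qroot (q * K) ≤ 160 * m / qroot K := by
    have : qroot K ≤ qroot (q * K) := qroot_mono (Nat.le_mul_of_pos_left K hq0)
    gcongr
  have s6 : chRatio m N ≤ chRatio m K + 176 * m / qroot K := by
    have : 176 * m / qroot K = 160 * m / qroot K + 16 * m / qroot K := by ring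
    linarith
  have s7 := chRatio_le m K (by omega)
  have s8 : (m : ℝ) / K ≤ m / qroot K := by
    have : qroot K ≤ K := by
      calc qroot K ≤ qroot K ^ 4 := le_self_pow₀ hy1 (by norm_num)
        _ = K := qroot_pow K
    gcongr
  have s9 : 176 * m / qroot K * (1 / K) ≤ 176 * m / qroot K :=
    mul_le_of_le_one_right (by positivity) ((div_le_one (by linarith)).2 (by linarith))
  calc chRatio m n ≤ chRatio m N * (1 + 1 / K) := s1
    _ ≤ (chRatio m K + 176 * m / qroot K) * (1 + 1 / K) :=
        mul_le_mul_of_nonneg_right s6 (by positivity)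
    _ = chRatio m K + 176 * m / qroot K + chRatio m K / K + 176 * m / qroot K * (1 / K) := by
        ring
    _ ≤ chRatio m K + 176 * m / qroot K + m / K + 176 * m / qroot K := by gcongr
    _ ≤ chRatio m K + 176 * m / qroot K + m / qroot K + 176 * m / qroot K := by gcongr
    _ = chRatio m K + 353 * m / qroot K := by ring

theorem tendsto_err (m : ℕ) :
    Filter.Tendsto (fun K : ℕ => 353 * (m : ℝ) / qroot K) Filter.atTop (nhds 0) := by
  apply Filter.Tendsto.div_atTop tendsto_const_nhds
  exact Real.tendsto_sqrt_atTop.comp (Real.tendsto_sqrt_atTop.comp tendsto_natCast_atTop_atTop)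

theorem chRatio_tendsto {m : ℕ} (hm : 1 ≤ m) :
    ∃ L : ℝ, Filter.Tendsto (chRatio m) Filter.atTop (nhds L) ∧
      ∀ K, 4 ≤ K → L ≤ chRatio m K + 353 * m / qroot K := by
  let S : Set ℝ := (fun K : ℕ => chRatio m K + 353 * m / qroot K) '' {K | 4 ≤ K}
  have hne : S.Nonempty := ⟨_, 4, le_refl 4, rfl⟩
  have hbdd : BddBelow S := by
    refine ⟨0, ?_⟩
    rintro _ ⟨K, _, rfl⟩
    have h1 := chRatio_nonneg m K
    have h2 : 0 ≤ qroot K := Real.sqrt_nonneg _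
    have : 0 ≤ 353 * m / qroot K := by positivity
    simp only
    linarith
  have hle : ∀ K, 4 ≤ K → sInf S ≤ chRatio m K + 353 * m / qroot K :=
    fun K hK => csInf_le hbdd ⟨K, hK, rfl⟩
  refine ⟨sInf S, ?_, hle⟩
  rw [tendsto_order]
  constructor
  · intro a ha
    have := (tendsto_err m).eventually_lt_const (sub_pos.2 ha)
    filter_upwards [this, Filter.eventually_ge_atTop 4] with n h1 h2
    have := hle n h2
    linarith
  · intro a ha
    obtain ⟨_, ⟨K, hK, rfl⟩, hlt⟩ := exists_lt_of_csInf_lt hne ha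
    filter_upwards [Filter.eventually_ge_atTop (K ^ 2)] with n hn
    exact (chRatio_eventually hm hK n hn).trans_lt hlt

theorem choosable_Kmk_one (m : ℕ) : Choosable (Kmk m 1) 1 := by
  intro L hL
  choose f hf using fun v => Finset.card_pos.1 (by rw [hL v]; norm_num : 0 < (L v).card)
  refine ⟨f, hf, fun u v huv => ?_⟩
  exact absurd (Subsingleton.elim u.1 v.1) (by simpa using huv)

theorem chRatio_log {m K : ℕ} (hm : 1 ≤ m) (hK : 1 ≤ K) :
    chRatio m K ≤ Real.log (m * K) + 1 := by
  have hK1 : (1 : ℝ) ≤ K := by exact_mod_cast hK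
  have hm1 : (1 : ℝ) ≤ m := by exact_mod_cast hm
  have hmK : (1 : ℝ) ≤ m * K := by nlinarith
  have hlog : 0 ≤ Real.log (m * K) := Real.log_nonneg hmK
  set s := ⌊K * Real.log (m * K)⌋₊ + 1 with hs
  have h1 : K * Real.log (m * K) < s := by
    have := Nat.lt_floor_add_one (K * Real.log (m * K))
    rw [hs]; push_cast; exact this
  have h2 : (s : ℝ) ≤ K * Real.log (m * K) + 1 := by
    have := Nat.floor_le (a := K * Real.log (m * K)) (by positivity)
    rw [hs]; push_cast; linarith
  have hch : Choosable (Kmk m (K * 1)) s := by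
    apply choosable_split hK (choosable_Kmk_one m) 0 le_rfl zero_le_one
    have hA : (1 - (1 - 0) / (K : ℝ)) ^ s ≤ Real.exp (-(s / K)) := by
      have : 1 / (K : ℝ) ≤ 1 := (div_le_one (by linarith)).2 hK1
      calc (1 - (1 - 0) / (K : ℝ)) ^ s ≤ (Real.exp (-(1 / K))) ^ s := by
            rw [sub_zero]
            exact pow_le_pow_left₀ (by linarith) (Real.one_sub_le_exp_neg _) _
        _ = _ := by rw [← Real.exp_nat_mul]; congr 1; ring
    have hB : (m * K : ℝ) < Real.exp (s / K) := by
      rw [← Real.log_lt_iff_lt_exp (by linarith), lt_div_iff₀ (by linarith)]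
      linarith
    calc ((K * 1 * m : ℕ) : ℝ) * (1 - (1 - 0) / (K : ℝ)) ^ s
        ≤ (m * K : ℝ) * Real.exp (-(s / K)) := by
          have : ((K * 1 * m : ℕ) : ℝ) = m * K := by push_cast; ring
          rw [this]
          exact mul_le_mul_of_nonneg_left hA (by linarith)
      _ < Real.exp (s / K) * Real.exp (-(s / K)) := mul_lt_mul_of_pos_right hB (Real.exp_pos _)
      _ = 0 ^ (1 - 1) := by rw [← Real.exp_add]; simp
  rw [mul_one] at hch
  have h3 : (choiceNumber (Kmk m K) : ℝ) ≤ s := by exact_mod_cast choiceNumber_le hch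
  unfold chRatio
  rw [div_le_iff₀ (by linarith)]
  nlinarith

theorem chRatio_lower {m t k : ℕ} (ht : 1 ≤ t) (hm : (2 * t).choose t ≤ m) (hk : 1 ≤ k) :
    ((t : ℝ) + 1) / 2 - t / k ≤ chRatio m k := by
  have hpos : 0 < k * (t + 1) := by positivity
  have h2t : 0 < 2 * t := by omega
  set r := (k * (t + 1) - 1) / (2 * t) with hr
  have h1 : 2 * t * r < k * (t + 1) := by
    have := Nat.mul_div_le (k * (t + 1) - 1) (2 * t)
    rw [← hr] at this
    omega
  have h2 : k * (t + 1) ≤ 2 * t * r + 2 * t := by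
    have := Nat.lt_div_mul_add (a := k * (t + 1) - 1) h2t
    rw [← hr, mul_comm r] at this
    omega
  have h3 := le_choiceNumber (not_choosable_Kmk hm h1)
  have h4 : k * (t + 1) ≤ 2 * choiceNumber (Kmk m k) + 2 * t := by
    nlinarith
  have h5 : (k : ℝ) * (t + 1) ≤ 2 * choiceNumber (Kmk m k) + 2 * t := by exact_mod_cast h4
  have hk0 : (0 : ℝ) < k := by exact_mod_cast hk
  unfold chRatio
  rw [sub_le_iff_le_add, ← add_div, div_le_div_iff₀ (by norm_num) hk0]
  linarith

theorem choose_le_two_pow {t : ℕ} (ht : 1 ≤ t) : (2 * t).choose t ≤ 2 ^ (2 * t - 1) := by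
  obtain ⟨u, rfl⟩ : ∃ u, t = u + 1 := ⟨t - 1, by omega⟩
  have h1 := Nat.add_one_mul_choose_eq (2 * u + 1) u
  have h2 : (2 * (u + 1)).choose (u + 1) = 2 * (2 * u + 1).choose u := by
    have e : 2 * u + 1 + 1 = 2 * (u + 1) := by omega
    rw [e] at h1
    have : (u + 1) * (2 * (u + 1)).choose (u + 1) = (u + 1) * (2 * (2 * u + 1).choose u) := by
      linarith
    exact Nat.eq_of_mul_eq_mul_left (by omega) this
  have h3 := Nat.choose_middle_le_pow u
  have h4 : (2 * u + 1).choose u ≤ 4 ^ u := h3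
  rw [h2]
  calc 2 * (2 * u + 1).choose u ≤ 2 * 4 ^ u := by omega
    _ = 2 ^ (2 * (u + 1) - 1) := by
        have : 2 * (u + 1) - 1 = 2 * u + 1 := by omega
        rw [this, pow_succ, pow_mul]; ring

/-- **Existence of the limit of `ch(K_{m*k})/k`.** For every fixed `m ≥ 1` the limit of
`ch(K_{m*k})/k` as `k → ∞` exists, and there are absolute positive constants `c1, c2` such that
for all `m ≥ 2` this limit lies between `c1·ln m` and `c2·ln m`. -/
theorem choiceNumber_Kmk_limit_exists :
    ∃ c1 c2 : ℝ, 0 < c1 ∧ 0 < c2 ∧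
      ∀ m : ℕ, 1 ≤ m → ∃ L : ℝ,
        Filter.Tendsto (fun k : ℕ => (choiceNumber (Kmk m k) : ℝ) / k)
          Filter.atTop (nhds L) ∧
        (2 ≤ m → c1 * Real.log m ≤ L ∧ L ≤ c2 * Real.log m) := by
  refine ⟨1 / 4, 1000, by norm_num, by norm_num, fun m hm => ?_⟩
  obtain ⟨L, hL, hLK⟩ := chRatio_tendsto hm
  refine ⟨L, hL, fun hm2 => ⟨?_, ?_⟩⟩
  · set a := Nat.log 2 m with ha
    have ha1 : 1 ≤ a := Nat.log_pos (by norm_num) hm2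
    set t := (a + 1) / 2 with ht
    have ht1 : 1 ≤ t := by omega
    have hch : (2 * t).choose t ≤ m :=
      calc (2 * t).choose t ≤ 2 ^ (2 * t - 1) := choose_le_two_pow ht1
        _ ≤ 2 ^ a := Nat.pow_le_pow_right (by norm_num) (by omega)
        _ ≤ m := Nat.pow_log_le_self 2 (by omega)
    have hlim : Filter.Tendsto (fun k : ℕ => ((t : ℝ) + 1) / 2 - t / k) Filter.atTop
        (nhds (((t : ℝ) + 1) / 2)) := by
      have : Filter.Tendsto (fun k : ℕ => (t : ℝ) / k) Filter.atTop (nhds 0) :=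
        tendsto_const_nhds.div_atTop tendsto_natCast_atTop_atTop
      simpa using this.const_sub (((t : ℝ) + 1) / 2)
    have h1 : ((t : ℝ) + 1) / 2 ≤ L :=
      le_of_tendsto_of_tendsto hlim hL (by
        filter_upwards [Filter.eventually_ge_atTop 1] with k hk
        exact chRatio_lower ht1 hch hk)
    refine le_trans ?_ h1
    have h2 : (m : ℝ) ≤ 2 ^ (a + 1) := by
      exact_mod_cast (Nat.lt_pow_succ_log_self (by norm_num) m).le
    have h3 : Real.log m ≤ (a + 1 : ℕ) * Real.log 2 := by
      rw [← Real.log_pow]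
      exact Real.log_le_log (by exact_mod_cast hm) h2
    have h4 : Real.log 2 < 1 := by linarith [Real.log_two_lt_d9]
    have h5 : ((a + 1 : ℕ) : ℝ) ≤ 2 * t + 1 := by
      exact_mod_cast (by omega : a + 1 ≤ 2 * t + 1)
    have h6 : ((a + 1 : ℕ) : ℝ) * Real.log 2 ≤ (a + 1 : ℕ) :=
      mul_le_of_le_one_right (Nat.cast_nonneg _) h4.le
    linarith
  · have hmr : (2 : ℝ) ≤ m := by exact_mod_cast hm2
    have hK4 : 4 ≤ m ^ 4 := by
      have := Nat.pow_le_pow_left hm2 4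
      omega
    have h1 := hLK (m ^ 4) hK4
    have h2 := chRatio_log hm (by omega : 1 ≤ m ^ 4)
    have h3 : qroot (m ^ 4) = m := by
      have := qroot_pow (m ^ 4)
      push_cast at this
      exact (pow_left_inj₀ (Real.sqrt_nonneg _) (Nat.cast_nonneg m) (by norm_num)).1 this
    have h4 : Real.log (m * (m ^ 4 : ℕ)) = 5 * Real.log m := by
      have : (m : ℝ) * (m ^ 4 : ℕ) = m ^ 5 := by push_cast; ring
      rw [this, Real.log_pow]; norm_num
    have h5 : Real.log 2 ≤ Real.log m := Real.log_le_log (by norm_num) hmr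
    have h6 := Real.log_two_gt_d9
    have h7 : 353 * (m : ℝ) / qroot (m ^ 4) = 353 := by
      rw [h3]; field_simp
    rw [h7] at h1
    rw [h4] at h2
    linarith
end

section
/- There exists an integer m0 such that for all m > m0 and every integer k ≥ 1, the choice number of the complete k-partite graph with all parts of size m satisfies ch(K_{m*k}) > (k - 1 - k/ln m)·(ln m - 4·ln ln m)·(1 - (ln m)/m). -/
lemma exists_choosable (m k : ℕ) : ∃ s, Choosable (Kmk m k) s := by
  classical
  refine ⟨Fintype.card ((_ : Fin k) × Fin m), fun L hL => ?_⟩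
  have h := (Finset.all_card_le_biUnion_card_iff_exists_injective L).1 (by
    intro S
    rcases S.eq_empty_or_nonempty with rfl | ⟨v, hv⟩
    · simp
    · calc S.card ≤ Fintype.card ((_ : Fin k) × Fin m) := Finset.card_le_univ S
        _ = (L v).card := (hL v).symm
        _ ≤ _ := Finset.card_le_card (Finset.subset_biUnion_of_mem L hv))
  obtain ⟨f, hf, hfL⟩ := h
  exact ⟨f, hfL, fun u v huv hh => huv.ne (hf hh)⟩

lemma choosable_mono {V : Type*} {G : SimpleGraph V} {s t : ℕ} (h : Choosable G s) (hst : s ≤ t) :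
    Choosable G t := by
  intro L hL
  have : ∀ v, ∃ M, M ⊆ L v ∧ M.card = s := fun v =>
    Finset.exists_subset_card_eq (by rw [hL v]; exact hst)
  choose M hM hc using this
  obtain ⟨f, hf, hp⟩ := h M hc
  exact ⟨f, fun v => hM v (hf v), hp⟩

lemma not_choosable_of_hyper {m k s t q u : ℕ} (E : Fin m → Finset ℕ)
    (hsub : ∀ v, E v ⊆ Finset.range t) (hcard : ∀ v, (E v).card = s)
    (hit : ∀ C : Finset ℕ, (∀ v, ∃ x ∈ E v, x ∈ C) → u + 1 ≤ C.card)
    (hk : t * q < k * (u + 1)) : ¬ Choosable (Kmk m k) (s * q) := by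
  classical
  intro h
  have hinj : Function.Injective (fun p : ℕ × ℕ => Nat.pair p.1 p.2) := by
    intro a b hab
    have := Nat.pair_eq_pair.1 hab
    exact Prod.ext this.1 this.2
  obtain ⟨f, hf, hp⟩ := h (fun v => (E v.2 ×ˢ Finset.range q).image
    (fun p : ℕ × ℕ => Nat.pair p.1 p.2)) (by
      intro v
      rw [Finset.card_image_of_injective _ hinj, Finset.card_product, hcard, Finset.card_range])
  let C : Fin k → Finset ℕ := fun i => Finset.univ.image (fun j : Fin m => f ⟨i, j⟩)
  have hC : ∀ i, u + 1 ≤ (C i).card := by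
    intro i
    refine (hit ((C i).image fun x => x.unpair.1) ?_).trans Finset.card_image_le
    intro v
    have := hf ⟨i, v⟩
    simp only [Finset.mem_image, Finset.mem_product] at this
    obtain ⟨p, ⟨hp1, hp2⟩, hpe⟩ := this
    refine ⟨p.1, hp1, ?_⟩
    refine Finset.mem_image.2 ⟨f ⟨i, v⟩, Finset.mem_image.2 ⟨v, Finset.mem_univ _, rfl⟩, ?_⟩
    rw [← hpe, Nat.unpair_pair]
  have hdis : ∀ i ∈ (Finset.univ : Finset (Fin k)), ∀ j ∈ (Finset.univ : Finset (Fin k)),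
      i ≠ j → Disjoint (C i) (C j) := by
    intro i _ j _ hij
    rw [Finset.disjoint_left]
    intro x hx hy
    obtain ⟨a, _, rfl⟩ := Finset.mem_image.1 hx
    obtain ⟨b, _, hb⟩ := Finset.mem_image.1 hy
    exact hp ⟨i, a⟩ ⟨j, b⟩ hij hb.symm
  have hU : (Finset.univ.biUnion C) ⊆ (Finset.range t ×ˢ Finset.range q).image
      (fun p : ℕ × ℕ => Nat.pair p.1 p.2) := by
    intro x hx
    obtain ⟨i, _, hx⟩ := Finset.mem_biUnion.1 hx
    obtain ⟨a, _, rfl⟩ := Finset.mem_image.1 hx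
    have := hf ⟨i, a⟩
    refine Finset.image_subset_image ?_ this
    exact Finset.product_subset_product (hsub _) (le_refl _)
  have h1 := Finset.card_le_card hU
  rw [Finset.card_biUnion hdis, Finset.card_image_of_injective _ hinj, Finset.card_product,
    Finset.card_range, Finset.card_range] at h1
  have h2 : k * (u + 1) ≤ ∑ i, (C i).card := by
    calc k * (u + 1) = ∑ _i : Fin k, (u + 1) := by simp
      _ ≤ _ := Finset.sum_le_sum fun i _ => hC i
  omega

lemma exists_hyper {m t s u : ℕ} (hu : u ≤ t)
    (hlt : t.choose u * (t.choose s - (t - u).choose s) ^ m < t.choose s ^ m) :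
    ∃ E : Fin m → Finset ℕ, (∀ v, E v ⊆ Finset.range t) ∧ (∀ v, (E v).card = s) ∧
      ∀ C : Finset ℕ, (∀ v, ∃ x ∈ E v, x ∈ C) → u + 1 ≤ C.card := by
  classical
  let P := (Finset.range t).powersetCard s
  let All : Finset (Fin m → Finset ℕ) := Fintype.piFinset fun _ => P
  let Bad : Finset ℕ → Finset (Fin m → Finset ℕ) := fun U =>
    Fintype.piFinset fun _ => P \ ((Finset.range t \ U).powersetCard s)
  let Us := (Finset.range t).powersetCard u
  have hBad : ∀ U ∈ Us, (Bad U).card = (t.choose s - (t - u).choose s) ^ m := by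
    intro U hU
    obtain ⟨h1, h2⟩ := Finset.mem_powersetCard.1 hU
    have hs : (Finset.range t \ U).powersetCard s ⊆ P :=
      Finset.powersetCard_mono Finset.sdiff_subset
    simp only [Bad, Fintype.card_piFinset, Finset.prod_const, Finset.card_univ, Fintype.card_fin]
    rw [Finset.card_sdiff_of_subset hs, Finset.card_powersetCard, Finset.card_powersetCard,
      Finset.card_sdiff_of_subset h1, Finset.card_range, h2]
  have hAll : All.card = t.choose s ^ m := by
    simp [All, P, Fintype.card_piFinset]
  have hc : (Us.biUnion Bad).card < All.card := by
    refine lt_of_le_of_lt Finset.card_biUnion_le ?_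
    rw [Finset.sum_congr rfl hBad, hAll]
    simpa [Us] using hlt
  obtain ⟨E, hE, hnE⟩ := Finset.exists_mem_notMem_of_card_lt_card hc
  have hEP : ∀ v, E v ∈ P := fun v => Fintype.mem_piFinset.1 hE v
  refine ⟨E, fun v => (Finset.mem_powersetCard.1 (hEP v)).1,
    fun v => (Finset.mem_powersetCard.1 (hEP v)).2, ?_⟩
  intro C hC
  by_contra hcon
  have hcard : (C ∩ Finset.range t).card ≤ u :=
    (Finset.card_le_card Finset.inter_subset_left).trans (by omega)
  obtain ⟨U, hU1, hU2, hU3⟩ := Finset.exists_subsuperset_card_eq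
    (Finset.inter_subset_right : C ∩ Finset.range t ⊆ _) hcard (by simpa using hu)
  apply hnE
  refine Finset.mem_biUnion.2 ⟨U, Finset.mem_powersetCard.2 ⟨hU2, hU3⟩, ?_⟩
  refine Fintype.mem_piFinset.2 fun v => Finset.mem_sdiff.2 ⟨hEP v, fun hv => ?_⟩
  obtain ⟨x, hx, hxC⟩ := hC v
  have h1 := (Finset.mem_powersetCard.1 hv).1 hx
  exact (Finset.mem_sdiff.1 h1).2 (hU1 (Finset.mem_inter.2 ⟨hxC, (Finset.mem_sdiff.1 h1).1⟩))

lemma descFactorial_ratio (t u s : ℕ) (h : u + s ≤ t) (j : ℕ) (hj : j ≤ s) :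
    t.descFactorial j * (t - u - s) ^ j ≤ (t - u).descFactorial j * (t - s) ^ j := by
  induction j with
  | zero => simp
  | succ j ih =>
    have ih := ih (by omega)
    rw [Nat.descFactorial_succ, Nat.descFactorial_succ, pow_succ, pow_succ]
    have key : (t - j) * (t - u - s) ≤ (t - u - j) * (t - s) := by
      obtain ⟨a, rfl⟩ := Nat.exists_eq_add_of_le h
      obtain ⟨b, rfl⟩ := Nat.exists_eq_add_of_le (show j ≤ s by omega)
      have e1 : u + (j + b) + a - j = u + b + a := by omega
      have e2 : u + (j + b) + a - u - (j + b) = a := by omega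
      have e3 : u + (j + b) + a - u - j = b + a := by omega
      have e4 : u + (j + b) + a - (j + b) = u + a := by omega
      rw [e1, e2, e3, e4]
      nlinarith [Nat.zero_le (b * u)]
    calc (t - j) * t.descFactorial j * ((t - u - s) ^ j * (t - u - s))
        = (t.descFactorial j * (t - u - s) ^ j) * ((t - j) * (t - u - s)) := by ring
      _ ≤ ((t - u).descFactorial j * (t - s) ^ j) * ((t - u - j) * (t - s)) :=
        Nat.mul_le_mul ih key
      _ = _ := by ring

lemma choose_ratio_s9 (t u s : ℕ) (h : u + s < t) :
    (t.choose s : ℝ) * Real.exp (-(s * u / ((t : ℝ) - u - s))) ≤ ((t - u).choose s : ℝ) := by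
  have h1 := descFactorial_ratio t u s h.le s le_rfl
  rw [Nat.descFactorial_eq_factorial_mul_choose, Nat.descFactorial_eq_factorial_mul_choose,
    mul_assoc, mul_assoc] at h1
  have h2 := Nat.le_of_mul_le_mul_left h1 (Nat.factorial_pos s)
  have h3 : (t.choose s : ℝ) * ((t : ℝ) - u - s) ^ s ≤ ((t - u).choose s : ℝ) * ((t : ℝ) - s) ^ s := by
    have : ((t.choose s * (t - u - s) ^ s : ℕ) : ℝ) ≤ (((t - u).choose s * (t - s) ^ s : ℕ) : ℝ) := by
      exact_mod_cast h2
    push_cast at this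
    rwa [Nat.cast_sub (by omega : s ≤ t - u), Nat.cast_sub (by omega : u ≤ t),
      Nat.cast_sub (by omega : s ≤ t)] at this
  have hpos : (0 : ℝ) < (t : ℝ) - u - s := by
    have : ((u + s : ℕ) : ℝ) < t := by exact_mod_cast h
    push_cast at this; linarith
  have hu0 : (0 : ℝ) ≤ u := Nat.cast_nonneg u
  set d : ℝ := (t : ℝ) - u - s with hd
  have hts : (t : ℝ) - s = d + u := by rw [hd]; ring
  rw [hts] at h3
  have hdu : 0 < d + u := by linarith
  -- (d+u)/d = 1 + u/d ≤ exp (u/d)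
  have h4 : (d + u) ≤ d * Real.exp (u / d) := by
    have := Real.add_one_le_exp ((u : ℝ) / d)
    calc d + u = d * (u / d + 1) := by field_simp; ring
      _ ≤ _ := by gcongr
  have h5 : (d + u) ^ s ≤ d ^ s * Real.exp (s * u / d) := by
    calc (d + u) ^ s ≤ (d * Real.exp (u / d)) ^ s := by gcongr
      _ = _ := by rw [mul_pow, ← Real.exp_nat_mul, mul_div_assoc]
  have h6 : (t.choose s : ℝ) * d ^ s ≤ ((t - u).choose s : ℝ) * (d ^ s * Real.exp (s * u / d)) :=
    h3.trans (by gcongr)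
  have hds : 0 < d ^ s := by positivity
  have h7 : (t.choose s : ℝ) ≤ ((t - u).choose s : ℝ) * Real.exp (s * u / d) := by
    refine le_of_mul_le_mul_right ?_ hds
    linarith
  rw [Real.exp_neg, ← div_eq_mul_inv, div_le_iff₀ (Real.exp_pos _)]
  exact h7

lemma union_bound {m t s u : ℕ} (h : u + s < t) {p : ℝ}
    (hp : Real.exp (-(s * u / ((t : ℝ) - u - s))) ≥ p)
    (hlt : u * Real.log t < m * p) :
    t.choose u * (t.choose s - (t - u).choose s) ^ m < t.choose s ^ m := by
  have hr := choose_ratio_s9 t u s h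
  have hle : (t - u).choose s ≤ t.choose s := Nat.choose_le_choose s (by omega)
  have hN : (0 : ℝ) < t.choose s := by exact_mod_cast Nat.choose_pos (by omega)
  have ht : (0 : ℝ) < t := by exact_mod_cast (by omega : 0 < t)
  have h1 : ((t.choose s - (t - u).choose s : ℕ) : ℝ) ≤ t.choose s * Real.exp (-p) := by
    rw [Nat.cast_sub hle]
    have := Real.add_one_le_exp (-p)
    have a1 : (t.choose s : ℝ) * p ≤ ((t - u).choose s : ℝ) :=
      le_trans (by gcongr) hr
    have a2 : (t.choose s : ℝ) * (-p + 1) ≤ t.choose s * Real.exp (-p) := by gcongr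
    linarith
  have h2 : (t.choose u : ℝ) ≤ Real.exp (u * Real.log t) := by
    rw [Real.exp_nat_mul, Real.exp_log ht]
    exact_mod_cast Nat.choose_le_pow t u
  have : ((t.choose u * (t.choose s - (t - u).choose s) ^ m : ℕ) : ℝ) < ((t.choose s ^ m : ℕ) : ℝ) := by
    push_cast
    calc (t.choose u : ℝ) * ((t.choose s - (t - u).choose s : ℕ) : ℝ) ^ m
        ≤ Real.exp (u * Real.log t) * (t.choose s * Real.exp (-p)) ^ m := by gcongr
      _ = Real.exp (u * Real.log t - m * p) * (t.choose s : ℝ) ^ m := by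
          rw [mul_pow, ← Real.exp_nat_mul, sub_eq_add_neg, Real.exp_add, mul_neg]; ring
      _ < 1 * (t.choose s : ℝ) ^ m := by
          gcongr
          rw [Real.exp_lt_one_iff]; linarith
      _ = _ := one_mul _
  exact_mod_cast this

lemma hyper_main {m k s : ℕ} (hl : 5 ≤ Real.log m)
    (hA : 1 ≤ Real.log m - 4 * Real.log (Real.log m)) (hk : 2 ≤ k) (hkm : k ≤ m ^ 2)
    (hs : (s : ℝ) ≤ ((k : ℝ) - 1 - k / Real.log m) * (Real.log m - 4 * Real.log (Real.log m))) :
    ∃ u : ℕ, ∃ E : Fin m → Finset ℕ, (∀ v, E v ⊆ Finset.range (k * u)) ∧ (∀ v, (E v).card = s) ∧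
      ∀ C : Finset ℕ, (∀ v, ∃ x ∈ E v, x ∈ C) → u + 1 ≤ C.card := by
  set l := Real.log m with hldef
  set A := l - 4 * Real.log l with hAdef
  have hm : (0 : ℝ) < m := by
    rcases Nat.eq_zero_or_pos m with rfl | h
    · simp [l] at hl; linarith
    · exact_mod_cast h
  have hk' : (2 : ℝ) ≤ k := by exact_mod_cast hk
  have hl0 : 0 < l := by linarith
  have hAl : A ≤ l := by
    have : 0 ≤ Real.log l := Real.log_nonneg (by linarith)
    linarith
  have hkl : (k : ℝ) / l ≤ k / 5 := by gcongr
  have hB : 0 < (k : ℝ) - 1 - k / l := by linarith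
  have hkl0 : 0 ≤ (k : ℝ) / l := by positivity
  let u := ⌈l ^ 2⌉₊
  have hu1 : l ^ 2 ≤ u := Nat.le_ceil _
  have hu2 : (u : ℝ) < l ^ 2 + 1 := Nat.ceil_lt_add_one (by positivity)
  have hu0 : (0 : ℝ) < u := lt_of_lt_of_le (by positivity) hu1
  -- s ≤ (k / l) * u
  have hs1 : (s : ℝ) ≤ k / l * u := by
    calc (s : ℝ) ≤ ((k : ℝ) - 1 - k / l) * A := hs
      _ ≤ k * l := by gcongr; linarith
      _ = k / l * l ^ 2 := by field_simp
      _ ≤ _ := by gcongr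
  have hgap : ((k : ℝ) - 1 - k / l) * u ≤ ((k * u : ℕ) : ℝ) - u - s := by
    push_cast; linarith
  have hgap0 : 0 < ((k : ℝ) - 1 - k / l) * u := by positivity
  have hlt : u + s < k * u := by
    have : ((u + s : ℕ) : ℝ) < ((k * u : ℕ) : ℝ) := by
      push_cast at hgap ⊢; linarith
    exact_mod_cast this
  refine ⟨u, exists_hyper (by omega) (union_bound (p := l ^ 4 / m) hlt ?_ ?_)⟩
  · have e : l ^ 4 / m = Real.exp (-A) := by
      rw [hAdef, neg_sub, Real.exp_sub, hldef, Real.exp_log hm, ← hldef]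
      congr 1
      rw [show (4 : ℝ) * Real.log l = ((4 : ℕ) : ℝ) * Real.log l by norm_num, Real.exp_nat_mul,
        Real.exp_log hl0]
    rw [e, ge_iff_le, Real.exp_le_exp, neg_le_neg_iff, div_le_iff₀ (lt_of_lt_of_le hgap0 hgap)]
    calc (s : ℝ) * u ≤ (((k : ℝ) - 1 - k / l) * A) * u := by gcongr
      _ = A * (((k : ℝ) - 1 - k / l) * u) := by ring
      _ ≤ _ := by gcongr
  · have e : (m : ℝ) * (l ^ 4 / m) = l ^ 4 := by field_simp
    rw [e]
    have h1 : Real.log ((k * u : ℕ) : ℝ) ≤ 4 * l := by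
      push_cast
      rw [Real.log_mul (by positivity) (by positivity)]
      have a1 : Real.log k ≤ 2 * l := by
        calc Real.log k ≤ Real.log ((m : ℝ) ^ 2) := by
              apply Real.log_le_log (by linarith); exact_mod_cast hkm
          _ = 2 * l := by rw [Real.log_pow]; norm_num [l]
      have a2 : Real.log u ≤ 2 * l := by
        calc Real.log u ≤ Real.log ((l + 1) ^ 2) := by
              apply Real.log_le_log hu0; nlinarith
          _ = 2 * Real.log (l + 1) := by rw [Real.log_pow]; norm_num
          _ ≤ 2 * l := by
              have := Real.log_le_sub_one_of_pos (show 0 < l + 1 by linarith)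
              linarith
      linarith
    calc (u : ℝ) * Real.log ((k * u : ℕ) : ℝ) ≤ (l ^ 2 + 1) * (4 * l) := by gcongr
      _ < l ^ 4 := by
        have b1 : l ^ 2 + 1 < l ^ 2 * (5 / 4) := by nlinarith
        have b2 : l ^ 4 = l ^ 2 * l * l := by ring
        have b3 : 0 < l ^ 2 * l := by positivity
        nlinarith

lemma eventually_ok : ∃ m0 : ℕ, ∀ m : ℕ, m0 < m →
    5 ≤ Real.log m ∧ 1 ≤ Real.log m - 4 * Real.log (Real.log m) ∧ Real.log m < m := by
  have hlog : Filter.Tendsto (fun m : ℕ => Real.log m) Filter.atTop Filter.atTop :=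
    Real.tendsto_log_atTop.comp tendsto_natCast_atTop_atTop
  have h1 : ∀ᶠ x : ℝ in Filter.atTop, 5 ≤ x ∧ 1 ≤ x - 4 * Real.log x := by
    have := Real.isLittleO_log_id_atTop.def (show (0 : ℝ) < 1 / 8 by norm_num)
    filter_upwards [this, Filter.eventually_ge_atTop 5] with x hx h5
    refine ⟨h5, ?_⟩
    simp only [Real.norm_eq_abs, id] at hx
    rw [abs_of_pos (show 0 < x by linarith)] at hx
    have := le_abs_self (Real.log x)
    linarith
  obtain ⟨m0, h⟩ := Filter.eventually_atTop.1 (hlog.eventually h1)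
  refine ⟨m0, fun m hm => ?_⟩
  obtain ⟨a, b⟩ := h m hm.le
  refine ⟨a, b, ?_⟩
  have : (0 : ℝ) < m := by exact_mod_cast (by omega : 0 < m)
  have := Real.log_le_sub_one_of_pos this
  linarith

/-- **Lower bound for the choice number of `K_{m*k}`.** There is an `m0` such that for all
`m > m0` and every `k ≥ 1`,
`ch(K_{m*k}) > (k - 1 - k/ln m)·(ln m - 4 ln ln m)·(1 - (ln m)/m)`. -/
theorem choiceNumber_Kmk_lower :
    ∃ m0 : ℕ, ∀ m k : ℕ, m0 < m → 1 ≤ k →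
      ((k : ℝ) - 1 - k / Real.log m) * (Real.log m - 4 * Real.log (Real.log m)) *
        (1 - Real.log m / m) < (choiceNumber (Kmk m k) : ℝ) := by
  obtain ⟨m0, h0⟩ := eventually_ok
  refine ⟨m0, fun m k hm hk => ?_⟩
  obtain ⟨hl, hA, hlm⟩ := h0 m hm
  have hch : Choosable (Kmk m k) (choiceNumber (Kmk m k)) := Nat.sInf_mem (exists_choosable m k)
  set c := choiceNumber (Kmk m k)
  by_contra hcon
  push Not at hcon
  set l := Real.log m with hldef
  set A := l - 4 * Real.log l with hAdef
  have hl0 : 0 < l := by linarith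
  have hm0 : (0 : ℝ) < m := by linarith
  have hf1 : 0 < 1 - l / m := by
    rw [sub_pos, div_lt_one hm0]; exact hlm
  have hf2 : 1 - l / m ≤ 1 := by
    have : 0 ≤ l / m := by positivity
    linarith
  rcases Nat.lt_or_ge k 2 with hk2 | hk2
  · obtain rfl : k = 1 := by omega
    have hc : (0 : ℝ) ≤ c := Nat.cast_nonneg c
    have : ((1 : ℕ) : ℝ) - 1 - ((1 : ℕ) : ℝ) / l < 0 := by
      have : 0 < 1 / l := by positivity
      push_cast; linarith
    have := mul_neg_of_neg_of_pos (mul_neg_of_neg_of_pos this (show 0 < A by linarith)) hf1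
    linarith
  have hk' : (2 : ℝ) ≤ k := by exact_mod_cast hk2
  have hB : ∀ x : ℝ, 2 ≤ x → 0 < x - 1 - x / l := by
    intro x hx
    have : x / l ≤ x / 5 := by gcongr
    linarith
  rcases le_or_gt k (m ^ 2) with hkm | hkm
  · have hc : (c : ℝ) ≤ ((k : ℝ) - 1 - k / l) * A := by
      refine hcon.trans (mul_le_of_le_one_right ?_ hf2)
      have := hB k hk'
      positivity
    obtain ⟨u, E, h1, h2, h3⟩ := hyper_main hl hA hk2 hkm hc
    have := not_choosable_of_hyper (k := k) (q := 1) E h1 h2 h3 (by nlinarith)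
    rw [mul_one] at this
    exact this hch
  · have hm5 : (5 : ℝ) < m := by linarith
    have hm2 : 2 ≤ m := by
      have : 5 < m := by exact_mod_cast hm5
      omega
    have hBm := hB m (by linarith)
    let s := ⌊((m : ℝ) - 1 - m / l) * A⌋₊
    have hs : (s : ℝ) ≤ ((m : ℝ) - 1 - m / l) * A := Nat.floor_le (by positivity)
    have hs' : ((m : ℝ) - 1 - m / l) * A - 1 < s := Nat.sub_one_lt_floor _
    obtain ⟨u, E, h1, h2, h3⟩ := hyper_main hl hA hm2 (by nlinarith) hs
    let q := k / m
    have hq : m * q ≤ k := Nat.mul_div_le k m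
    have hq' : (k : ℝ) / m - 1 < q := by
      have : k < m * (q + 1) := Nat.lt_mul_div_succ k (by omega)
      have : (k : ℝ) < m * (q + 1) := by exact_mod_cast this
      rw [sub_lt_iff_lt_add, div_lt_iff₀ hm0]; linarith
    have hnot := not_choosable_of_hyper (k := k) (q := q) E h1 h2 h3 (by
      calc m * u * q = (m * q) * u := by ring
        _ ≤ k * u := Nat.mul_le_mul_right _ hq
        _ < k * (u + 1) := by nlinarith)
    apply hnot
    refine choosable_mono hch ?_
    have hfin : (c : ℝ) ≤ s * q := by
      refine hcon.trans ?_
      have hkm' : (m : ℝ) ^ 2 < k := by exact_mod_cast hkm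
      set y : ℝ := k / m with hy
      have hky : (k : ℝ) = y * m := by rw [hy]; field_simp
      have hym : (m : ℝ) ≤ y := by rw [hy, le_div_iff₀ hm0]; nlinarith
      set x : ℝ := 1 - 1 / l with hx
      have hxl : x * l = l - 1 := by rw [hx]; field_simp
      have hx1 : x ≤ 1 := by
        have : 0 ≤ 1 / l := by positivity
        linarith
      have hx0 : 0 ≤ x := by
        have : 1 / l ≤ 1 / 5 := by gcongr
        linarith
      -- left side at most (y * A) * (x * m - x * l)
      have e1 : ((k : ℝ) - 1 - k / l) * A * (1 - l / m) ≤ y * A * (x * m - x * l) := by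
        have : y * A * (x * m - x * l) = (k - k / l) * A * (1 - l / m) := by
          rw [hky, hx]; field_simp
        rw [this]
        gcongr
        linarith
      have e2 : (m : ℝ) - 1 - m / l = x * m - 1 := by rw [hx]; ring
      rw [e2] at hs' hBm
      have e3 : (x * m - 2) * A ≤ s := by nlinarith
      have hxm : 2 ≤ x * m := by
        have : x * l ≤ x * m := by gcongr
        linarith
      have e4 : (x * m - 2) * A * (y - 1) ≤ s * q := by
        have : 0 ≤ (x * m - 2) * A := mul_nonneg (by linarith) (by linarith)
        gcongr
        linarith
      refine e1.trans (le_trans ?_ e4)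
      rw [hxl]
      have e5 : y * (x * m - (l - 1)) ≤ (x * m - 2) * (y - 1) := by
        have g1 : x * m ≤ 1 * m := mul_le_mul_of_nonneg_right hx1 hm0.le
        have g2 : 0 ≤ y * (l - 5) := mul_nonneg (by linarith) (by linarith)
        linarith
      have hA0 : 0 ≤ A := by linarith
      have e6 := mul_le_mul_of_nonneg_left e5 hA0
      linarith
    exact_mod_cast hfin
end

section
/- Let k ≥ 3 and r ≥ 2 be integers, let N = {1, 2, ..., n} with n ≥ max(k+1, r), and let R = {1, 2, ..., r}. Then R is not a successful coalition: for any choice of sets S_i ⊆ N for i ∈ R with |S_i| = k and i ∉ S_i, there exist sets S_j ⊆ N for j ∈ N\R with |S_j| = k and j ∉ S_j, and a partition of N into parts such that (i) for every part N_i of the partition and every j ∈ N_i we have S_j ∩ N_i ≠ ∅, and (ii) the elements of R do not all lie in the same part of the partition. -/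
/-- A nonempty set in which every vertex has an out-neighbour inside the set. -/
def GoodSet {α : Type*} (N : α → Finset α) (A : Finset α) : Prop :=
  A.Nonempty ∧ ∀ x ∈ A, ∃ y ∈ N x, y ∈ A

/-- A nonempty finite set with internal in-degrees at least one contains a good set. -/
lemma exists_good_of_in {α : Type*} [DecidableEq α] (N : α → Finset α) :
    ∀ (m : ℕ) (T : Finset α), T.card = m → T.Nonempty →
      (∀ x ∈ T, ∃ y ∈ T, x ∈ N y) → ∃ A, A ⊆ T ∧ GoodSet N A := by
  intro m
  induction m with
  | zero =>
    intro T hT hne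
    rw [Finset.card_eq_zero] at hT
    simp [hT] at hne
  | succ m ih =>
    intro T hT hne hin
    by_cases hg : ∀ x ∈ T, ∃ y ∈ N x, y ∈ T
    · exact ⟨T, Finset.Subset.refl _, hne, hg⟩
    · push Not at hg
      obtain ⟨x, hx, hxN⟩ := hg
      have key : ∀ z ∈ T, ∃ y ∈ T.erase x, z ∈ N y := by
        intro z hz
        obtain ⟨y, hy, hzy⟩ := hin z hz
        refine ⟨y, Finset.mem_erase.2 ⟨?_, hy⟩, hzy⟩
        rintro rfl
        exact hxN z hzy hz
      obtain ⟨A, hA, hgA⟩ := ih (T.erase x) (by rw [Finset.card_erase_of_mem hx]; omega)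
        (by obtain ⟨y, hy, _⟩ := key x hx; exact ⟨y, hy⟩)
        (fun z hz => key z (Finset.mem_of_mem_erase hz))
      exact ⟨A, hA.trans (Finset.erase_subset _ _), hgA⟩

/-- Two disjoint good sets in every digraph with all out-degrees three. -/
lemma exists_two_good {α : Type*} [DecidableEq α] :
    ∀ (m : ℕ) (V : Finset α) (N : α → Finset α), V.card = m → V.Nonempty →
      (∀ x ∈ V, N x ⊆ V ∧ x ∉ N x ∧ (N x).card = 3) →
      ∃ A B, A ⊆ V ∧ B ⊆ V ∧ Disjoint A B ∧ GoodSet N A ∧ GoodSet N B := by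
  intro m
  induction m with
  | zero =>
    intro V N hV hne
    rw [Finset.card_eq_zero] at hV
    simp [hV] at hne
  | succ m ih =>
    intro V N hV hne hN
    by_contra hno
    -- no 2-cycles
    have h2 : ∀ u ∈ V, ∀ v ∈ N u, u ∉ N v := by
      intro u hu v hv huv
      have hvV : v ∈ V := (hN u hu).1 hv
      have hout : ∀ x ∈ V, ∃ y ∈ N x, y ∈ V \ {u, v} := by
        intro x hx
        have h1 : ((N x) \ {u, v}).Nonempty := by
          rw [← Finset.card_pos]
          have := Finset.le_card_sdiff ({u, v} : Finset α) (N x)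
          have h3 := (hN x hx).2.2
          have h4 : ({u, v} : Finset α).card ≤ 2 := Finset.card_le_two
          omega
        obtain ⟨y, hy⟩ := h1
        rw [Finset.mem_sdiff] at hy
        exact ⟨y, hy.1, Finset.mem_sdiff.2 ⟨(hN x hx).1 hy.1, hy.2⟩⟩
      refine hno ⟨{u, v}, V \ {u, v}, ?_, Finset.sdiff_subset, Finset.disjoint_sdiff, ?_, ?_⟩
      · intro x hx
        simp only [Finset.mem_insert, Finset.mem_singleton] at hx
        rcases hx with rfl | rfl <;> assumption
      · refine ⟨⟨u, by simp⟩, ?_⟩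
        intro x hx
        simp only [Finset.mem_insert, Finset.mem_singleton] at hx
        rcases hx with rfl | rfl
        · exact ⟨v, hv, by simp⟩
        · exact ⟨u, huv, by simp⟩
      · refine ⟨?_, ?_⟩
        · obtain ⟨y, _, hy⟩ := hout u hu
          exact ⟨y, hy⟩
        · intro x hx
          exact hout x (Finset.mem_sdiff.1 hx).1
    -- no sources
    have hin0 : ∀ v ∈ V, ∃ u ∈ V, v ∈ N u := by
      intro v hv
      by_contra hcon
      push Not at hcon
      have hsub : ∀ x ∈ V, N x ⊆ V.erase v := by
        intro x hx y hy
        refine Finset.mem_erase.2 ⟨?_, (hN x hx).1 hy⟩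
        rintro rfl
        exact hcon x hx hy
      obtain ⟨A, B, hA, hB, hd, hgA, hgB⟩ := ih (V.erase v) N
        (by rw [Finset.card_erase_of_mem hv]; omega)
        (by
          have h3 := (hN v hv).2.2
          have : (N v).Nonempty := by rw [← Finset.card_pos]; omega
          exact this.mono (hsub v hv))
        (fun x hx => by
          have hx' := Finset.mem_of_mem_erase hx
          exact ⟨hsub x hx', (hN x hx').2⟩)
      exact hno ⟨A, B, hA.trans (Finset.erase_subset _ _), hB.trans (Finset.erase_subset _ _),
        hd, hgA, hgB⟩
    -- every arc has a common in-neighbour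
    have hcon : ∀ u ∈ V, ∀ v ∈ N u, ∃ w ∈ V, u ∈ N w ∧ v ∈ N w := by
      intro u hu v hv
      by_contra hc
      push Not at hc
      have hvV : v ∈ V := (hN u hu).1 hv
      have huv : u ≠ v := by
        rintro rfl
        exact (hN u hu).2.1 hv
      set N' : α → Finset α := fun x => if u ∈ N x then insert v ((N x).erase u) else N x with hN'
      have hN'mem : ∀ x y, y ∈ N' x → (y ∈ N x ∧ y ≠ u) ∨ (y = v ∧ u ∈ N x) ∨ (y ∈ N x ∧ u ∉ N x) := by
        intro x y hy
        simp only [hN'] at hy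
        split_ifs at hy with h
        · simp only [Finset.mem_insert, Finset.mem_erase] at hy
          tauto
        · tauto
      obtain ⟨A, B, hA, hB, hd, hgA, hgB⟩ := ih (V.erase u) N'
        (by rw [Finset.card_erase_of_mem hu]; omega)
        ⟨v, Finset.mem_erase.2 ⟨huv.symm, hvV⟩⟩
        (fun x hx => by
          have hx' := Finset.mem_of_mem_erase hx
          obtain ⟨a1, a2, a3⟩ := hN x hx'
          refine ⟨?_, ?_, ?_⟩
          · intro y hy
            rw [Finset.mem_erase]
            rcases hN'mem x y hy with h | h | h
            · exact ⟨h.2, a1 h.1⟩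
            · rw [h.1]; exact ⟨huv.symm, hvV⟩
            · exact ⟨fun e => h.2 (e ▸ h.1), a1 h.1⟩
          · intro hxx
            rcases hN'mem x x hxx with h | h | h
            · exact a2 h.1
            · exact h2 u hu v hv (h.1 ▸ h.2)
            · exact a2 h.1
          · simp only [hN']
            split_ifs with h
            · rw [Finset.card_insert_of_notMem, Finset.card_erase_of_mem h, a3]
              intro hh
              exact hc x hx' h (Finset.mem_of_mem_erase hh)
            · exact a3)
      have hlift0 : ∀ A, GoodSet N' A → v ∉ A → GoodSet N A := by
        intro A hg hvA
        refine ⟨hg.1, fun x hx => ?_⟩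
        obtain ⟨y, hy, hyA⟩ := hg.2 x hx
        rcases hN'mem x y hy with h | h | h
        · exact ⟨y, h.1, hyA⟩
        · exact absurd (h.1 ▸ hyA) hvA
        · exact ⟨y, h.1, hyA⟩
      have hlift1 : ∀ A, GoodSet N' A → v ∈ A → GoodSet N (insert u A) := by
        intro A hg hvA
        refine ⟨⟨u, by simp⟩, fun x hx => ?_⟩
        rcases Finset.mem_insert.1 hx with rfl | hx
        · exact ⟨v, hv, by simp [hvA]⟩
        obtain ⟨y, hy, hyA⟩ := hg.2 x hx
        rcases hN'mem x y hy with h | h | h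
        · exact ⟨y, h.1, by simp [hyA]⟩
        · exact ⟨u, h.2, by simp⟩
        · exact ⟨y, h.1, by simp [hyA]⟩
      have huA : u ∉ A := fun h => by simpa using hA h
      have huB : u ∉ B := fun h => by simpa using hB h
      have hA' := hA.trans (Finset.erase_subset _ _)
      have hB' := hB.trans (Finset.erase_subset _ _)
      by_cases hvA : v ∈ A
      · have hvB : v ∉ B := Finset.disjoint_left.1 hd hvA
        exact hno ⟨insert u A, B, Finset.insert_subset hu hA', hB',
          Finset.disjoint_insert_left.2 ⟨huB, hd⟩, hlift1 A hgA hvA, hlift0 B hgB hvB⟩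
      · by_cases hvB : v ∈ B
        · exact hno ⟨A, insert u B, hA', Finset.insert_subset hu hB',
            Finset.disjoint_insert_right.2 ⟨huA, hd⟩, hlift0 A hgA hvA, hlift1 B hgB hvB⟩
        · exact hno ⟨A, B, hA', hB', hd, hlift0 A hgA hvA, hlift0 B hgB hvB⟩
    -- every in-neighbourhood contains a good set
    have hinGood : ∀ v ∈ V, ∃ A, A ⊆ V.filter (fun u => v ∈ N u) ∧ GoodSet N A := by
      intro v hv
      refine exists_good_of_in N _ _ rfl ?_ ?_
      · obtain ⟨u, hu, huv⟩ := hin0 v hv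
        exact ⟨u, Finset.mem_filter.2 ⟨hu, huv⟩⟩
      · intro u hu
        rw [Finset.mem_filter] at hu
        obtain ⟨w, hw, h1, hvw⟩ := hcon u hu.1 v hu.2
        exact ⟨w, Finset.mem_filter.2 ⟨hw, hvw⟩, h1⟩
    -- some vertex has in-degree at most three
    have hsmall : ∃ v ∈ V, (V.filter (fun u => v ∈ N u)).card ≤ 3 := by
      by_contra hbig
      push Not at hbig
      have hsum : ∑ v ∈ V, (V.filter (fun u => v ∈ N u)).card
          = ∑ u ∈ V, (V.filter (fun v => v ∈ N u)).card := by
        simp only [Finset.card_filter]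
        exact Finset.sum_comm
      have hr : ∑ u ∈ V, (V.filter (fun v => v ∈ N u)).card = ∑ u ∈ V, 3 := by
        refine Finset.sum_congr rfl fun u hu => ?_
        rw [Finset.filter_mem_eq_inter, Finset.inter_eq_right.2 (hN u hu).1, (hN u hu).2.2]
      have hl := Finset.sum_lt_sum_of_nonempty hne hbig
      omega
    obtain ⟨v, hv, hv3⟩ := hsmall
    obtain ⟨C, hC, hgC⟩ := hinGood v hv
    have hCV : C ⊆ V := hC.trans (Finset.filter_subset _ _)
    have hvC : v ∉ C := fun h => (hN v hv).2.1 (Finset.mem_filter.1 (hC h)).2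
    have hC3 : C.card ≤ 3 := (Finset.card_le_card hC).trans hv3
    have hw : ∃ w ∈ V, N w = C := by
      by_contra hw
      push Not at hw
      refine hno ⟨C, V \ C, hCV, Finset.sdiff_subset, Finset.disjoint_sdiff, hgC,
        ⟨v, Finset.mem_sdiff.2 ⟨hv, hvC⟩⟩, ?_⟩
      intro x hx
      have hxV := (Finset.mem_sdiff.1 hx).1
      by_contra hc
      push Not at hc
      refine hw x hxV (Finset.eq_of_subset_of_card_le ?_ (by rw [(hN x hxV).2.2]; exact hC3))
      intro y hy
      by_contra hyC
      exact hc y hy (Finset.mem_sdiff.2 ⟨(hN x hxV).1 hy, hyC⟩)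
    obtain ⟨w, hwV, hwC⟩ := hw
    obtain ⟨A, hA, hgA⟩ := hinGood w hwV
    refine hno ⟨A, C, hA.trans (Finset.filter_subset _ _), hCV, ?_, hgA, hgC⟩
    rw [Finset.disjoint_left]
    intro x hxA hxC
    exact h2 w hwV x (hwC ▸ hxC) (Finset.mem_filter.1 (hA hxA)).2

/-- Disjoint good sets extend to a partition into two good sets. -/
lemma exists_split_s13 {α : Type*} [DecidableEq α] [Fintype α] (N : α → Finset α)
    (hN : ∀ x, (N x).Nonempty) (A B : Finset α) (hd : Disjoint A B)
    (hA : GoodSet N A) (hB : GoodSet N B) :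
    ∃ A' : Finset α, A ⊆ A' ∧ Disjoint A' B ∧ ∀ x, ∃ y ∈ N x, (y ∈ A' ↔ x ∈ A') := by
  classical
  obtain ⟨M, hM, hmax⟩ := Finset.exists_max_image
    (Finset.univ.filter (fun M : Finset α => A ⊆ M ∧ Disjoint M B ∧ GoodSet N M))
    Finset.card ⟨A, by simp [hd, hA]⟩
  simp only [Finset.mem_filter, Finset.mem_univ, true_and] at hM hmax
  obtain ⟨hAM, hMB, hgM⟩ := hM
  refine ⟨M, hAM, hMB, fun x => ?_⟩
  by_cases hxM : x ∈ M
  · obtain ⟨y, hy, hyM⟩ := hgM.2 x hxM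
    exact ⟨y, hy, by simp [hyM, hxM]⟩
  by_cases hxB : x ∈ B
  · obtain ⟨y, hy, hyB⟩ := hB.2 x hxB
    exact ⟨y, hy, by simp [Finset.disjoint_right.1 hMB hyB, hxM]⟩
  obtain ⟨y, hy⟩ := hN x
  refine ⟨y, hy, ?_⟩
  simp only [hxM, iff_false]
  intro hyM
  have := hmax (insert x M) ⟨hAM.trans (Finset.subset_insert _ _),
    Finset.disjoint_insert_left.2 ⟨hxB, hMB⟩, ⟨x, by simp⟩, fun z hz => by
      rcases Finset.mem_insert.1 hz with rfl | hz
      · exact ⟨y, hy, by simp [hyM]⟩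
      · obtain ⟨t, ht, htM⟩ := hgM.2 z hz
        exact ⟨t, ht, by simp [htM]⟩⟩
  rw [Finset.card_insert_of_notMem hxM] at this
  omega


/-- **No successful coalition for `k ≥ 3`.** Let `k ≥ 3`, `r ≥ 2`, `n ≥ max(k+1, r)`, and let
`R = {1,…,r}` (here the first `r` elements of `Fin n`). For any choice of sets `S i ⊆ N` with
`|S i| = k` and `i ∉ S i` for `i ∈ R`, there are sets `S' j` for the remaining elements
(`|S' j| = k`, `j ∉ S' j`, agreeing with `S` on `R`) and a partition of `N` (given by the fibers
of a function `f`) such that every element has a member of its set in its own part, while the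
elements of `R` do not all lie in the same part. -/
theorem no_successful_coalition (k r n : ℕ) (hk : 3 ≤ k) (hr : 2 ≤ r)
    (hn1 : k + 1 ≤ n) (hn2 : r ≤ n)
    (S : Fin n → Finset (Fin n))
    (hS : ∀ i : Fin n, (i : ℕ) < r → (S i).card = k ∧ i ∉ S i) :
    ∃ S' : Fin n → Finset (Fin n),
      (∀ i : Fin n, (i : ℕ) < r → S' i = S i) ∧
      (∀ j : Fin n, (S' j).card = k ∧ j ∉ S' j) ∧
      ∃ f : Fin n → Fin n,
        (∀ j : Fin n, ∃ x ∈ S' j, f x = f j) ∧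
        ∃ i j : Fin n, (i : ℕ) < r ∧ (j : ℕ) < r ∧ f i ≠ f j := by

  classical
  set R : Finset (Fin n) := Finset.univ.filter (fun i => (i : ℕ) < r) with hR
  have hmemR : ∀ i, i ∈ R ↔ (i : ℕ) < r := by simp [hR]
  have hRcard : R.card = r := by
    have : R = Finset.univ.filter (fun i : Fin n => (i : ℕ) < r) := hR
    rw [this, Fin.card_filter_val_lt]
    omega
  -- it is enough to find two disjoint good sets meeting `R`
  suffices h : ∃ S' : Fin n → Finset (Fin n),
      (∀ i : Fin n, (i : ℕ) < r → S' i = S i) ∧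
      (∀ j : Fin n, (S' j).card = k ∧ j ∉ S' j) ∧
      ∃ A B, Disjoint A B ∧ GoodSet S' A ∧ GoodSet S' B ∧ (∃ i ∈ A, i ∈ R) ∧ (∃ j ∈ B, j ∈ R) by
    obtain ⟨S', h1, h2, A, B, hd, hA, hB, ⟨i, hiA, hiR⟩, ⟨j, hjB, hjR⟩⟩ := h
    refine ⟨S', h1, h2, ?_⟩
    obtain ⟨M, hAM, hMB, hM⟩ := exists_split_s13 S'
      (fun x => by rw [← Finset.card_pos, (h2 x).1]; omega) A B hd hA hB
    refine ⟨fun x => if x ∈ M then ⟨0, by omega⟩ else ⟨1, by omega⟩, ?_, i, j,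
      (hmemR i).1 hiR, (hmemR j).1 hjR, ?_⟩
    · intro x
      obtain ⟨y, hy, hyx⟩ := hM x
      exact ⟨y, hy, by simp [hyx]⟩
    · simp [hAM hiA, Finset.disjoint_right.1 hMB hjB]
  rcases Nat.lt_or_ge r k with hrk | hrk
  · -- small coalition
    have hex : ∀ j : Fin n, j ∉ R → ∃ T : Finset (Fin n), R ⊆ T ∧ T.card = k ∧ j ∉ T := by
      intro j hj
      obtain ⟨T, hT1, hT2, hT3⟩ := Finset.exists_subsuperset_card_eq
        (s := R) (t := Finset.univ.erase j) (n := k)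
        (fun x hx => Finset.mem_erase.2 ⟨fun e => hj (e ▸ hx), Finset.mem_univ _⟩)
        (by omega) (by rw [Finset.card_erase_of_mem (Finset.mem_univ _)]; simp; omega)
      exact ⟨T, hT1, hT3, fun h => by simpa using hT2 h⟩
    choose! T hT using hex
    have hout : ∀ i ∈ R, 2 ≤ (S i \ R).card := by
      intro i hi
      obtain ⟨c1, c2⟩ := hS i ((hmemR i).1 hi)
      have e : S i \ R = S i \ (R.erase i) := by
        ext x
        simp only [Finset.mem_sdiff, Finset.mem_erase]
        constructor
        · tauto
        · rintro ⟨a, b⟩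
          exact ⟨a, fun h => b ⟨fun e => c2 (e ▸ a), h⟩⟩
      rw [e]
      have := Finset.le_card_sdiff (R.erase i) (S i)
      rw [Finset.card_erase_of_mem hi] at this
      omega
    set p : Fin n := ⟨0, by omega⟩ with hp
    set q : Fin n := ⟨1, by omega⟩ with hq
    have hpR : p ∈ R := by rw [hmemR]; simp [hp]; omega
    have hqR : q ∈ R := by rw [hmemR]; simp [hq]; omega
    have hpq : p ≠ q := by simp [hp, hq]
    obtain ⟨a, ha⟩ : (S p \ R).Nonempty := by
      rw [← Finset.card_pos]; have := hout p hpR; omega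
    obtain ⟨b, hb⟩ : ((S q \ R).erase a).Nonempty := by
      rw [← Finset.card_pos]
      have := hout q hqR
      have := Finset.pred_card_le_card_erase (s := S q \ R) (a := a)
      omega
    simp only [Finset.mem_sdiff, Finset.mem_erase] at ha hb
    refine ⟨fun i => if i ∈ R then S i else T i, ?_, ?_, {p, a}, {q, b}, ?_, ?_, ?_,
      ⟨p, by simp, hpR⟩, ⟨q, by simp, hqR⟩⟩
    · intro i hi
      simp [(hmemR i).2 hi]
    · intro j
      by_cases hj : j ∈ R
      · simpa [hj] using hS j ((hmemR j).1 hj)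
      · simpa [hj] using (hT j hj).2
    · rw [Finset.disjoint_left]
      intro x hx hx'
      simp only [Finset.mem_insert, Finset.mem_singleton] at hx hx'
      rcases hx with rfl | rfl <;> rcases hx' with h | h
      · exact hpq h
      · exact hb.2.2 (h ▸ hpR)
      · exact ha.2 (h ▸ hqR)
      · exact hb.1 h.symm
    · refine ⟨⟨p, by simp⟩, fun x hx => ?_⟩
      simp only [Finset.mem_insert, Finset.mem_singleton] at hx
      rcases hx with h | h
      · exact ⟨a, by simp only [h, hpR, if_true]; exact ha.1, by simp⟩
      · exact ⟨p, by simp only [h, ha.2, if_false]; exact (hT a ha.2).1 hpR, by simp⟩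
    · refine ⟨⟨q, by simp⟩, fun x hx => ?_⟩
      simp only [Finset.mem_insert, Finset.mem_singleton] at hx
      rcases hx with h | h
      · exact ⟨b, by simp only [h, hqR, if_true]; exact hb.2.1, by simp⟩
      · exact ⟨q, by simp only [h, hb.2.2, if_false]; exact (hT b hb.2.2).1 hqR, by simp⟩
  · -- large coalition
    obtain ⟨T, hTR, hTk⟩ := Finset.exists_subset_card_eq (s := R) (n := k) (by omega)
    set S' : Fin n → Finset (Fin n) := fun i => if i ∈ R then S i else T with hS'
    have hS'2 : ∀ j : Fin n, (S' j).card = k ∧ j ∉ S' j := by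
      intro j
      by_cases hj : j ∈ R
      · simpa [hS', hj] using hS j ((hmemR j).1 hj)
      · simp only [hS', hj, if_false]
        exact ⟨hTk, fun h => hj (hTR h)⟩
    have hsub : ∀ j : Fin n, ∃ U, U ⊆ S' j ∧ U.card = 3 := fun j =>
      Finset.exists_subset_card_eq (by rw [(hS'2 j).1]; exact hk)
    choose N hN using hsub
    obtain ⟨A, B, _, _, hd, hA, hB⟩ := exists_two_good _ (Finset.univ : Finset (Fin n)) N rfl
      ⟨⟨0, by omega⟩, Finset.mem_univ _⟩
      (fun x _ => ⟨Finset.subset_univ _, fun h => (hS'2 x).2 ((hN x).1 h), (hN x).2⟩)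
    have hup : ∀ A, GoodSet N A → GoodSet S' A := fun A h => ⟨h.1, fun x hx => by
      obtain ⟨y, hy, hyA⟩ := h.2 x hx
      exact ⟨y, (hN x).1 hy, hyA⟩⟩
    have hmeet : ∀ A, GoodSet S' A → ∃ i ∈ A, i ∈ R := by
      intro A h
      obtain ⟨x, hx⟩ := h.1
      by_cases hxR : x ∈ R
      · exact ⟨x, hx, hxR⟩
      · obtain ⟨y, hy, hyA⟩ := h.2 x hx
        simp only [hS', hxR, if_false] at hy
        exact ⟨y, hyA, hTR hy⟩
    refine ⟨S', ?_, hS'2, A, B, hd, hup A hA, hup B hB, hmeet A (hup A hA), hmeet B (hup B hB)⟩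
    intro i hi
    simp [hS', (hmemR i).2 hi]
end

section
/- Let d be a positive integer, let x = (x_1, ..., x_n) be any point of ℝ^n, and let A be any subset of B(x,d) ∩ {0,1}^n, where B(x,d) denotes the ℓ1-ball of radius d centered at x. Then there exists a point y ∈ {0,1}^n such that |A ∩ B(y,d)| ≥ |A|/2. -/
open Polynomial in
/-- partial sum of coefficients -/
noncomputable def cdfP (d : ℕ) (R : Polynomial ℝ) : ℝ := ∑ i ∈ Finset.range (d + 1), R.coeff i

open Polynomial in
/-- generating polynomial of a Poisson binomial law -/
noncomputable def pbP {n : ℕ} (p : Fin n → ℝ) (s : Finset (Fin n)) : Polynomial ℝ :=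
  ∏ i ∈ s, (C (1 - p i) + C (p i) * X)

lemma cdfP_add (d : ℕ) (R S : Polynomial ℝ) : cdfP d (R + S) = cdfP d R + cdfP d S := by
  simp [cdfP, Finset.sum_add_distrib]

open Polynomial in
lemma cdfP_C_mul (d : ℕ) (a : ℝ) (R : Polynomial ℝ) : cdfP d (C a * R) = a * cdfP d R := by
  simp [cdfP, Finset.mul_sum]

lemma cdfP_sum {ι : Type*} (d : ℕ) (s : Finset ι) (R : ι → Polynomial ℝ) :
    cdfP d (∑ i ∈ s, R i) = ∑ i ∈ s, cdfP d (R i) := by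
  simp only [cdfP, Polynomial.finset_sum_coeff]
  exact Finset.sum_comm

open Polynomial in
lemma cdfP_X_pow (d k : ℕ) : cdfP d ((X : Polynomial ℝ) ^ k) = if k ≤ d then 1 else 0 := by
  simp [cdfP, Polynomial.coeff_X_pow, Nat.lt_succ_iff]

open Polynomial in
lemma cdfP_mul_X_pow (e k : ℕ) (R : Polynomial ℝ) : cdfP (k + e) (R * X ^ k) = cdfP e R := by
  unfold cdfP
  rw [show k + e + 1 = k + (e + 1) by ring, Finset.sum_range_add]
  have h1 : ∑ i ∈ Finset.range k, (R * X ^ k).coeff i = 0 := by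
    apply Finset.sum_eq_zero
    intro i hi
    rw [Polynomial.coeff_mul_X_pow', if_neg]
    have := Finset.mem_range.1 hi
    omega
  rw [h1, zero_add]
  apply Finset.sum_congr rfl
  intro i _
  rw [Polynomial.coeff_mul_X_pow', if_pos (by omega)]
  congr 1
  omega

open Polynomial in
lemma pbP_coeff_continuous {n : ℕ} (s : Finset (Fin n)) :
    ∀ k, Continuous fun p : Fin n → ℝ => (pbP p s).coeff k := by
  classical
  induction s using Finset.induction_on with
  | empty => intro k; simp only [pbP, Finset.prod_empty]; exact continuous_const
  | insert i s hi ih =>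
    intro k
    have h : ∀ p : Fin n → ℝ, pbP p (insert i s) =
        C (1 - p i) * pbP p s + C (p i) * (X * pbP p s) := by
      intro p
      simp only [pbP, Finset.prod_insert hi]
      ring
    simp only [h, Polynomial.coeff_add, Polynomial.coeff_C_mul]
    cases k with
    | zero =>
      have := ih 0
      simp only [Polynomial.coeff_X_mul_zero]
      fun_prop
    | succ k =>
      have := ih k
      have := ih (k + 1)
      simp only [Polynomial.coeff_X_mul]
      fun_prop

lemma cdfP_continuous {n : ℕ} (d : ℕ) (s : Finset (Fin n)) :
    Continuous fun p : Fin n → ℝ => cdfP d (pbP p s) := by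
  unfold cdfP
  exact continuous_finset_sum _ fun k _ => pbP_coeff_continuous s k

/-- A sequence comparison: one sign change plus a moment inequality. -/
lemma sign_change_sum (M : ℕ) (u v : ℕ → ℝ) (J : ℕ) (hJ : 0 < J) (hv : ∀ j, 0 ≤ v j)
    (h1 : ∀ j, j < J → v j ≤ u j) (h2 : ∀ j, J ≤ j → u j ≤ v j)
    (hm : ∑ j ∈ Finset.range M, ((j : ℝ) + 1) * v j ≤ ∑ j ∈ Finset.range M, (j : ℝ) * u j) :
    ∑ j ∈ Finset.range M, v j ≤ ∑ j ∈ Finset.range M, u j := by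
  have hs : ∑ j ∈ Finset.range M, ((j : ℝ) - J) * (u j - v j) ≤ 0 := by
    apply Finset.sum_nonpos
    intro j _
    rcases lt_or_ge j J with h | h
    · have : (j : ℝ) ≤ J := by exact_mod_cast h.le
      nlinarith [h1 j h]
    · have : (J : ℝ) ≤ j := by exact_mod_cast h
      nlinarith [h2 j h]
  have e : ∑ j ∈ Finset.range M, ((j : ℝ) - J) * (u j - v j) =
      ∑ j ∈ Finset.range M, (j : ℝ) * u j - ∑ j ∈ Finset.range M, ((j : ℝ) + 1) * v j
      + ∑ j ∈ Finset.range M, v j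
      - J * (∑ j ∈ Finset.range M, u j - ∑ j ∈ Finset.range M, v j) := by
    rw [← Finset.sum_sub_distrib, ← Finset.sum_sub_distrib, Finset.mul_sum,
      ← Finset.sum_add_distrib, ← Finset.sum_sub_distrib]
    apply Finset.sum_congr rfl
    intro j _
    ring
  have hv' : 0 ≤ ∑ j ∈ Finset.range M, v j := Finset.sum_nonneg fun j _ => hv j
  have hJ' : (0 : ℝ) < J := by exact_mod_cast hJ
  by_contra hc
  push Not at hc
  nlinarith

/-- binomial probabilities -/
noncomputable def binP (m : ℕ) (p : ℝ) (i : ℕ) : ℝ := (m.choose i : ℝ) * p ^ i * (1 - p) ^ (m - i)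

lemma binP_rec (m : ℕ) (p : ℝ) (i : ℕ) :
    binP m p (i + 1) * ((i : ℝ) + 1) * (1 - p) = binP m p i * ((m : ℝ) - i) * p := by
  unfold binP
  rcases lt_or_ge i m with h | h
  · have h1 : (m.choose (i + 1) : ℝ) * ((i : ℝ) + 1) = m.choose i * ((m : ℝ) - i) := by
      have := Nat.choose_succ_right_eq m i
      rw [← Nat.cast_sub h.le]
      exact_mod_cast this
    have h2 : m - i = (m - (i + 1)) + 1 := by omega
    rw [h2, pow_succ, pow_succ]
    linear_combination p ^ i * p * (1 - p) ^ (m - (i + 1)) * (1 - p) * h1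
  · rw [Nat.choose_eq_zero_of_lt (show m < i + 1 by omega)]
    rcases h.eq_or_lt with h | h
    · subst h; simp
    · rw [Nat.choose_eq_zero_of_lt h]; simp

lemma binP_sum (m : ℕ) (p : ℝ) : ∑ i ∈ Finset.range (m + 1), binP m p i = 1 := by
  have h := congrArg (Polynomial.eval p) (bernsteinPolynomial.sum ℝ m)
  simpa [Polynomial.eval_finset_sum, bernsteinPolynomial, binP] using h

lemma binP_mean (m : ℕ) (p : ℝ) : ∑ i ∈ Finset.range (m + 1), (i : ℝ) * binP m p i = m * p := by
  have h := congrArg (Polynomial.eval p) (bernsteinPolynomial.sum_smul ℝ m)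
  simpa [Polynomial.eval_finset_sum, bernsteinPolynomial, binP] using h

lemma binP_zero (m : ℕ) (p : ℝ) (i : ℕ) (h : m < i) : binP m p i = 0 := by
  simp [binP, Nat.choose_eq_zero_of_lt h]

lemma binP_pos (m : ℕ) (p : ℝ) (h0 : 0 < p) (h1 : p < 1) (i : ℕ) (h : i ≤ m) :
    0 < binP m p i := by
  have := Nat.choose_pos h
  have : 0 < 1 - p := by linarith
  unfold binP
  positivity

lemma binP_nonneg (m : ℕ) (p : ℝ) (h0 : 0 < p) (h1 : p < 1) (i : ℕ) :
    0 ≤ binP m p i := by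
  have : 0 < 1 - p := by linarith
  unfold binP
  positivity

lemma binP_sum_ge (m : ℕ) (p : ℝ) (f : ℕ → ℝ) (M : ℕ) (h : m + 1 ≤ M) :
    ∑ i ∈ Finset.range M, f i * binP m p i = ∑ i ∈ Finset.range (m + 1), f i * binP m p i := by
  symm
  apply Finset.sum_subset (Finset.range_mono h)
  intro i _ hi
  rw [binP_zero m p i (by simpa using hi), mul_zero]

lemma binP_step (m k j : ℕ) (p : ℝ) (hj : j + 1 ≤ k) :
    (((k : ℝ) + 1) ^ 2 - ((j : ℝ) + 1) ^ 2) * (1 - p) ^ 2 *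
      (binP m p (k + 1 + (j + 1)) * binP m p (k - j)) =
    (((m : ℝ) - k) ^ 2 - ((j : ℝ) + 1) ^ 2) * p ^ 2 *
      (binP m p (k + 1 + j) * binP m p (k - (j + 1))) := by
  have h1 := binP_rec m p (k + 1 + j)
  obtain ⟨l, rfl⟩ : ∃ l, k = l + (j + 1) := ⟨k - (j + 1), by omega⟩
  have h2 := binP_rec m p l
  rw [show l + (j + 1) - j = l + 1 by omega, show l + (j + 1) - (j + 1) = l by omega]
  rw [show l + (j + 1) + 1 + (j + 1) = l + (j + 1) + 1 + j + 1 by ring]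
  push_cast at h1 h2 ⊢
  linear_combination (binP m p (l + 1) * ((l : ℝ) + 1) * (1 - p)) * h1 +
    (binP m p (l + (j + 1) + 1 + j) * ((m : ℝ) - (l + (j + 1) + 1 + j)) * p) * h2

lemma binP_sign (m k : ℕ) (p : ℝ) (h0 : 0 < p) (h1 : p < 1) (hk : k < m)
    (hmp : (m : ℝ) * p ≤ k) :
    ∃ J : ℕ, 0 < J ∧ (∀ j, j < J → j ≤ k ∧ binP m p (k + 1 + j) ≤ binP m p (k - j)) ∧
      (∀ j, J ≤ j → j ≤ k → binP m p (k - j) ≤ binP m p (k + 1 + j)) := by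
  classical
  have hq : 0 < 1 - p := by linarith
  have hkm : (k : ℝ) < m := by exact_mod_cast hk
  have hk0 : (0 : ℝ) ≤ k := by positivity
  have hc : ((m : ℝ) - k) * p ≤ k * (1 - p) := by nlinarith
  have hc0 : ((m : ℝ) - k) ^ 2 * p ^ 2 < ((k : ℝ) + 1) ^ 2 * (1 - p) ^ 2 := by
    rw [← mul_pow, ← mul_pow]
    apply pow_lt_pow_left₀ _ (by nlinarith) (by norm_num)
    nlinarith
  by_cases hex : ∃ j, j ≤ k ∧ binP m p (k - j) < binP m p (k + 1 + j)
  swap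
  · push Not at hex
    exact ⟨k + 1, by omega, fun j hj => ⟨by omega, hex j (by omega)⟩, fun j h h' => by omega⟩
  obtain ⟨hJk, hJ⟩ := Nat.find_spec hex
  have hmin := fun j => @Nat.find_min _ _ hex j
  set J := Nat.find hex with hJdef
  clear_value J
  have hJ0 : 0 < J := by
    rcases Nat.eq_zero_or_pos J with h | h
    · exfalso
      subst h
      have := binP_rec m p k
      simp only [Nat.sub_zero, Nat.add_zero] at hJ
      have hp := binP_pos m p h0 h1 k hk.le
      have : binP m p k * (((m : ℝ) - k) * p) ≤ binP m p k * (k * (1 - p)) := by gcongr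
      have : binP m p k * (((k : ℝ) + 1) * (1 - p)) < binP m p (k + 1) * (((k : ℝ) + 1) * (1 - p)) := by
        gcongr
      nlinarith [mul_pos hp hq]
    · exact h
  have hle : ∀ j, j < J → j ≤ k ∧ binP m p (k + 1 + j) ≤ binP m p (k - j) := by
    intro j hj
    refine ⟨by omega, ?_⟩
    have := hmin j hj
    push Not at this
    exact this (by omega)
  refine ⟨J, hJ0, hle, ?_⟩
  obtain ⟨l, rfl⟩ : ∃ l, J = l + 1 := ⟨J - 1, by omega⟩
  -- the step ratio at J exceeds one
  have hβ : ∀ j : ℕ, j + 1 ≤ k →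
      0 < (((k : ℝ) + 1) ^ 2 - ((j : ℝ) + 1) ^ 2) * (1 - p) ^ 2 := by
    intro j hj
    have : (j : ℝ) + 1 ≤ k := by exact_mod_cast hj
    have hj0 : (0 : ℝ) ≤ j := by positivity
    apply mul_pos _ (by positivity)
    nlinarith
  have hJstep : (((k : ℝ) + 1) ^ 2 - ((l : ℝ) + 1) ^ 2) * (1 - p) ^ 2 <
      (((m : ℝ) - k) ^ 2 - ((l : ℝ) + 1) ^ 2) * p ^ 2 := by
    have hs := binP_step m k l p hJk
    have hb := hβ l hJk
    have hl := (hle l (by omega)).2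
    have hu := binP_pos m p h0 h1 (k - l) (by omega)
    have hu' := binP_pos m p h0 h1 (k - (l + 1)) (by omega)
    have hv := binP_nonneg m p h0 h1 (k + 1 + l)
    by_contra hcon
    push Not at hcon
    have i1 : (((m : ℝ) - k) ^ 2 - ((l : ℝ) + 1) ^ 2) * p ^ 2 *
      (binP m p (k + 1 + l) * binP m p (k - (l + 1))) ≤
      (((k : ℝ) + 1) ^ 2 - ((l : ℝ) + 1) ^ 2) * (1 - p) ^ 2 *
      (binP m p (k + 1 + l) * binP m p (k - (l + 1))) :=
      mul_le_mul_of_nonneg_right hcon (by positivity)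
    have i2 : binP m p (k + 1 + l) * binP m p (k - (l + 1)) <
      binP m p (k + 1 + (l + 1)) * binP m p (k - l) := by nlinarith
    have i3 := mul_lt_mul_of_pos_left i2 hb
    linarith
  have hpq : p ^ 2 < (1 - p) ^ 2 := by
    have : (0 : ℝ) < ((l : ℝ) + 1) ^ 2 := by positivity
    by_contra hcon
    push Not at hcon
    nlinarith
  intro j hj
  induction j, hj using Nat.le_induction with
  | base => intro _; exact hJ.le
  | succ j hj ih =>
    intro hjk
    have ih := ih (by omega)
    have hs := binP_step m k j p hjk
    have hb := hβ j hjk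
    have hu := binP_pos m p h0 h1 (k - j) (by omega)
    have hu' := binP_pos m p h0 h1 (k - (j + 1)) (by omega)
    have hst : (((k : ℝ) + 1) ^ 2 - ((j : ℝ) + 1) ^ 2) * (1 - p) ^ 2 ≤
      (((m : ℝ) - k) ^ 2 - ((j : ℝ) + 1) ^ 2) * p ^ 2 := by
      have hlj : (l : ℝ) + 1 ≤ j + 1 := by exact_mod_cast (by omega : l + 1 ≤ j + 1)
      have : ((l : ℝ) + 1) ^ 2 ≤ ((j : ℝ) + 1) ^ 2 := by gcongr
      nlinarith
    have hv := binP_nonneg m p h0 h1 (k + 1 + j)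
    by_contra hcon
    push Not at hcon
    have i1 : (((k : ℝ) + 1) ^ 2 - ((j : ℝ) + 1) ^ 2) * (1 - p) ^ 2 *
      (binP m p (k + 1 + j) * binP m p (k - (j + 1))) ≤
      (((m : ℝ) - k) ^ 2 - ((j : ℝ) + 1) ^ 2) * p ^ 2 *
      (binP m p (k + 1 + j) * binP m p (k - (j + 1))) :=
      mul_le_mul_of_nonneg_right hst (by positivity)
    have i2 : binP m p (k + 1 + (j + 1)) * binP m p (k - j) <
      binP m p (k + 1 + j) * binP m p (k - (j + 1)) := by nlinarith
    have i3 := mul_lt_mul_of_pos_left i2 hb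
    linarith

lemma binP_median (m k : ℕ) (p : ℝ) (h0 : 0 < p) (h1 : p < 1) (hmp : (m : ℝ) * p ≤ k) :
    1 / 2 ≤ ∑ i ∈ Finset.range (k + 1), binP m p i := by
  rcases lt_or_ge k m with hk | hk
  swap
  · have := binP_sum_ge m p (fun _ => 1) (k + 1) (by omega)
    simp only [one_mul] at this
    rw [this, binP_sum]
    norm_num
  obtain ⟨J, hJ0, hJ1, hJ2⟩ := binP_sign m k p h0 h1 hk hmp
  have hS : ∑ i ∈ Finset.range (k + 1 + (m + 1)), binP m p i = 1 := by
    have := binP_sum_ge m p (fun _ => 1) (k + 1 + (m + 1)) (by omega)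
    simp only [one_mul] at this
    rw [this, binP_sum]
  have hM : ∑ i ∈ Finset.range (k + 1 + (m + 1)), ((i : ℝ) - k) * binP m p i = m * p - k := by
    simp only [sub_mul, Finset.sum_sub_distrib]
    rw [binP_sum_ge m p (fun i => (i : ℝ)) _ (by omega), binP_mean, ← Finset.mul_sum, hS, mul_one]
  rw [Finset.sum_range_add] at hS hM
  set u : ℕ → ℝ := fun j => if j ≤ k then binP m p (k - j) else 0 with hu
  have hext : ∀ f : ℕ → ℝ, ∑ j ∈ Finset.range (m + 1), f j * u j =
      ∑ i ∈ Finset.range (k + 1), f (k - i) * binP m p i := by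
    intro f
    rw [← Finset.sum_range_reflect (fun i => f (k - i) * binP m p i)]
    have : ∑ j ∈ Finset.range (k + 1), f j * u j = ∑ j ∈ Finset.range (m + 1), f j * u j := by
      apply Finset.sum_subset (Finset.range_mono (by omega))
      intro i _ hi
      have : ¬ i ≤ k := by simpa [Nat.lt_succ_iff] using hi
      simp [hu, this]
    rw [← this]
    apply Finset.sum_congr rfl
    intro i hi
    have hi' : i ≤ k := by simpa [Nat.lt_succ_iff] using hi
    simp only [hu, if_pos hi']
    rw [show k + 1 - 1 - i = k - i by omega, show k - (k - i) = i by omega]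
  have e1 := hext (fun _ => 1)
  simp only [one_mul] at e1
  have e2 : ∑ j ∈ Finset.range (m + 1), (j : ℝ) * u j =
      - ∑ i ∈ Finset.range (k + 1), ((i : ℝ) - k) * binP m p i := by
    rw [hext (fun j => (j : ℝ)), ← Finset.sum_neg_distrib]
    apply Finset.sum_congr rfl
    intro i hi
    have hi' : i ≤ k := by simpa [Nat.lt_succ_iff] using hi
    rw [Nat.cast_sub hi']
    ring
  have key := sign_change_sum (m + 1) u (fun j => binP m p (k + 1 + j)) J hJ0
    (fun j => binP_nonneg m p h0 h1 _)
    (fun j hj => by simp only [hu, if_pos (hJ1 j hj).1]; exact (hJ1 j hj).2)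
    (fun j hj => by
      by_cases hjk : j ≤ k
      · simp only [hu, if_pos hjk]; exact hJ2 j hj hjk
      · simp only [hu, if_neg hjk]; exact binP_nonneg m p h0 h1 _)
    (by
      rw [e2]
      have : ∑ j ∈ Finset.range (m + 1), ((j : ℝ) + 1) * binP m p (k + 1 + j) =
          ∑ x ∈ Finset.range (m + 1), (((k + 1 + x : ℕ) : ℝ) - k) * binP m p (k + 1 + x) := by
        apply Finset.sum_congr rfl
        intro i _
        push_cast
        ring
      rw [this]
      linarith)
  rw [e1] at key
  linarith

open Polynomial in
lemma pair_affine {n : ℕ} (d : ℕ) (p : Fin n → ℝ) (i j : Fin n) (hij : i ≠ j) :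
    ∃ c1 c2 c3 : ℝ, ∀ a b : ℝ,
      cdfP d (pbP (Function.update (Function.update p i a) j b) Finset.univ) =
        c1 + (a + b) * c2 + a * b * c3 := by
  classical
  set R := pbP p ((Finset.univ.erase i).erase j) with hR
  refine ⟨cdfP d R, cdfP d ((X - 1) * R), cdfP d ((X - 1) ^ 2 * R), fun a b => ?_⟩
  rw [← cdfP_C_mul, ← cdfP_C_mul, ← cdfP_add, ← cdfP_add]
  congr 1
  unfold pbP
  rw [← Finset.mul_prod_erase _ _ (Finset.mem_univ i),
    ← Finset.mul_prod_erase _ _ (Finset.mem_erase.2 ⟨hij.symm, Finset.mem_univ j⟩)]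
  have : ∏ x ∈ (Finset.univ.erase i).erase j,
      (C (1 - Function.update (Function.update p i a) j b x) +
        C (Function.update (Function.update p i a) j b x) * X) = R := by
    rw [hR, pbP]
    apply Finset.prod_congr rfl
    intro x hx
    simp only [Finset.mem_erase] at hx
    rw [Function.update_of_ne hx.1, Function.update_of_ne hx.2.1]
  rw [this]
  simp only [Function.update_self, Function.update_of_ne hij]
  simp only [C_sub, C_add, C_mul, C_1]
  ring

lemma pair_sum {n : ℕ} (p : Fin n → ℝ) (i j : Fin n) (hij : i ≠ j) (h : ℝ → ℝ) (a b : ℝ) :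
    ∑ l, h (Function.update (Function.update p i a) j b l) =
      ∑ l, h (p l) - h (p i) - h (p j) + h a + h b := by
  classical
  have hj : j ∈ Finset.univ.erase i := Finset.mem_erase.2 ⟨hij.symm, Finset.mem_univ j⟩
  rw [← Finset.add_sum_erase _ _ (Finset.mem_univ i), ← Finset.add_sum_erase _ _ hj,
    ← Finset.add_sum_erase Finset.univ (fun l => h (p l)) (Finset.mem_univ i),
    ← Finset.add_sum_erase _ (fun l => h (p l)) hj]
  have : ∑ x ∈ (Finset.univ.erase i).erase j,
      h (Function.update (Function.update p i a) j b x) =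
      ∑ x ∈ (Finset.univ.erase i).erase j, h (p x) := by
    apply Finset.sum_congr rfl
    intro x hx
    simp only [Finset.mem_erase] at hx
    rw [Function.update_of_ne hx.1, Function.update_of_ne hx.2.1]
  rw [this]
  simp only [Function.update_self, Function.update_of_ne hij]
  ring

open Polynomial in
/-- case where all non-integral parameters coincide -/
lemma pb_median_special {n : ℕ} (d : ℕ) (p : Fin n → ℝ) (c : ℝ) (h0 : 0 < c) (h1 : c < 1)
    (hp : ∀ i, p i = 0 ∨ p i = 1 ∨ p i = c) (hs : ∑ i, p i ≤ d) :
    1 / 2 ≤ cdfP d (pbP p Finset.univ) := by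
  classical
  set s := (Finset.univ.filter fun i => p i = 1).card with hsdef
  set m := (Finset.univ.filter fun i => p i = c).card with hmdef
  have hsum : ∑ i, p i = s + m * c := by
    have : ∀ i, p i = (if p i = 1 then 1 else 0) + (if p i = c then c else 0) := by
      intro i
      rcases hp i with h | h | h
      · simp [h, h0.ne]
      · simp [h, h1.ne']
      · simp [h, h1.ne]
    rw [Finset.sum_congr rfl fun i _ => this i, Finset.sum_add_distrib, ← Finset.sum_filter,
      ← Finset.sum_filter]
    simp [hsdef, hmdef]
  have hprod : pbP p Finset.univ = (C (1 - c) + C c * X) ^ m * X ^ s := by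
    have : ∀ i, (C (1 - p i) + C (p i) * X : Polynomial ℝ) =
        (if p i = c then (C (1 - c) + C c * X) else 1) * (if p i = 1 then X else 1) := by
      intro i
      rcases hp i with h | h | h
      · simp [h, h0.ne]
      · simp [h, h1.ne']
      · simp [h, h1.ne]
    rw [pbP, Finset.prod_congr rfl fun i _ => this i, Finset.prod_mul_distrib,
      ← Finset.prod_filter, ← Finset.prod_filter]
    simp [hsdef, hmdef]
  have hsd : s ≤ d := by
    have : (s : ℝ) ≤ d := by
      have : 0 ≤ (m : ℝ) * c := by positivity
      linarith
    exact_mod_cast this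
  obtain ⟨e, he⟩ := Nat.exists_eq_add_of_le hsd
  rw [hprod, he, cdfP_mul_X_pow]
  have hme : (m : ℝ) * c ≤ e := by
    rw [he] at hs
    push_cast at hs
    linarith
  have := binP_median m e c h0 h1 hme
  refine this.trans (le_of_eq ?_)
  unfold cdfP
  apply Finset.sum_congr rfl
  intro i _
  have hb : (C (1 - c) + C c * X : Polynomial ℝ) ^ m =
      ∑ k ∈ Finset.range (m + 1), C (binP m c k) * X ^ k := by
    rw [add_comm, add_pow]
    apply Finset.sum_congr rfl
    intro k _
    simp only [binP, mul_pow, C_mul, C_pow, map_natCast]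
    ring
  rw [hb]
  simp only [Polynomial.finset_sum_coeff, Polynomial.coeff_C_mul, Polynomial.coeff_X_pow]
  simp only [mul_ite, mul_one, mul_zero, Finset.sum_ite_eq, Finset.mem_range]
  split_ifs with h
  · rfl
  · exact binP_zero m c i (by omega)

lemma pb_median {n : ℕ} (d : ℕ) (p : Fin n → ℝ) (hp : ∀ i, 0 ≤ p i ∧ p i ≤ 1)
    (hs : ∑ i, p i ≤ d) : 1 / 2 ≤ cdfP d (pbP p Finset.univ) := by
  classical
  set g : (Fin n → ℝ) → ℝ := fun p => cdfP d (pbP p Finset.univ) with hg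
  have hgc : Continuous g := cdfP_continuous d Finset.univ
  set K : Set (Fin n → ℝ) := Set.Icc 0 1 ∩ {q | ∑ i, q i ≤ d} with hK
  have hKmem : ∀ q : Fin n → ℝ, q ∈ K ↔ (∀ i, 0 ≤ q i ∧ q i ≤ 1) ∧ ∑ i, q i ≤ d := by
    intro q
    simp only [hK, Set.mem_inter_iff, Set.mem_Icc, Pi.le_def, Set.mem_setOf_eq, Pi.zero_apply,
      Pi.one_apply, forall_and]
  have hKc : IsCompact K := isCompact_Icc.inter_right
    (isClosed_le (by fun_prop) continuous_const)
  obtain ⟨q0, hq0, hmin0⟩ := hKc.exists_isMinOn ⟨p, (hKmem p).2 ⟨hp, hs⟩⟩ hgc.continuousOn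
  have hK2c : IsCompact (K ∩ {q | g q ≤ g q0}) := hKc.inter_right
    (isClosed_le hgc continuous_const)
  obtain ⟨q, ⟨hqK, hqg⟩, hmin⟩ := hK2c.exists_isMinOn ⟨q0, hq0, le_refl (g q0)⟩
    (f := fun q => ∑ i, (q i) ^ 2) (by fun_prop)
  have hqle : ∀ r ∈ K, g q ≤ g r := fun r hr => le_trans hqg (hmin0 hr)
  have hqsq : ∀ r ∈ K, g r ≤ g q → ∑ i, (q i) ^ 2 ≤ ∑ i, (r i) ^ 2 :=
    fun r hr h => hmin ⟨hr, le_trans h hqg⟩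
  obtain ⟨hq1, hqs⟩ := (hKmem q).1 hqK
  refine le_trans ?_ (hqle p ((hKmem p).2 ⟨hp, hs⟩))
  have heqint : ∀ i j, 0 < q i → q i < 1 → 0 < q j → q j < 1 → q i = q j := by
    intro i j hi0 hi1 hj0 hj1
    by_contra hne
    have hij : i ≠ j := fun h => hne (by rw [h])
    obtain ⟨c1, c2, c3, hc⟩ := pair_affine d q i j hij
    have hself : g q = c1 + (q i + q j) * c2 + q i * q j * c3 := by
      rw [← hc]
      simp [hg]
    have hmemK : ∀ a b, 0 ≤ a → a ≤ 1 → 0 ≤ b → b ≤ 1 → a + b = q i + q j →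
        Function.update (Function.update q i a) j b ∈ K := by
      intro a b ha0 ha1 hb0 hb1 hab
      rw [hKmem]
      constructor
      · intro l
        by_cases hlj : l = j
        · subst hlj; simp [hb0, hb1]
        · rw [Function.update_of_ne hlj]
          by_cases hli : l = i
          · subst hli; simp [ha0, ha1]
          · rw [Function.update_of_ne hli]; exact hq1 l
      · have := pair_sum q i j hij id a b
        simp only [id] at this
        rw [this]
        linarith
    rcases le_or_gt c3 0 with h3 | h3
    · set a := (q i + q j) / 2 with ha
      have hm := hmemK a a (by linarith) (by linarith) (by linarith) (by linarith) (by linarith)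
      have hle : g (Function.update (Function.update q i a) j a) ≤ g q := by
        rw [hself]
        simp only [hg]
        rw [hc]
        have : 0 ≤ a * a - q i * q j := by rw [ha]; nlinarith [sq_nonneg (q i - q j)]
        have : a + a = q i + q j := by rw [ha]; ring
        rw [this]
        nlinarith
      have h2 := hqsq _ hm hle
      have h4 := pair_sum q i j hij (fun t => t ^ 2) a a
      rw [h4, ha] at h2
      have : 0 < (q i - q j) ^ 2 := by
        have : q i - q j ≠ 0 := sub_ne_zero.2 hne
        positivity
      nlinarith
    · -- spread the two coordinates
      have main : ∃ t : ℝ, 0 ≤ q i + t ∧ q i + t ≤ 1 ∧ 0 ≤ q j - t ∧ q j - t ≤ 1 ∧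
          (q i + t) * (q j - t) < q i * q j := by
        rcases lt_or_gt_of_ne hne with h | h
        · refine ⟨- min (q i) (1 - q j), ?_⟩
          have m1 := min_le_left (q i) (1 - q j)
          have m2 := min_le_right (q i) (1 - q j)
          have m3 : 0 < min (q i) (1 - q j) := lt_min hi0 (by linarith)
          refine ⟨by linarith, by linarith, by linarith, by linarith, by nlinarith⟩
        · refine ⟨min (q j) (1 - q i), ?_⟩
          have m1 := min_le_left (q j) (1 - q i)
          have m2 := min_le_right (q j) (1 - q i)
          have m3 : 0 < min (q j) (1 - q i) := lt_min hj0 (by linarith)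
          refine ⟨by linarith, by linarith, by linarith, by linarith, by nlinarith⟩
      obtain ⟨t, t1, t2, t3, t4, t5⟩ := main
      have h5 := hqle _ (hmemK (q i + t) (q j - t) t1 t2 t3 t4 (by ring))
      rw [hself] at h5
      simp only [hg] at h5
      rw [hc] at h5
      have h6 := mul_lt_mul_of_pos_right t5 h3
      have h7 : q i + t + (q j - t) = q i + q j := by ring
      rw [h7] at h5
      linarith
  by_cases hex : ∃ i, 0 < q i ∧ q i < 1
  · obtain ⟨i, hi0, hi1⟩ := hex
    apply pb_median_special d q (q i) hi0 hi1 _ hqs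
    intro j
    rcases (hq1 j).1.eq_or_lt with h | h
    · exact Or.inl h.symm
    · rcases (hq1 j).2.eq_or_lt with h' | h'
      · exact Or.inr (Or.inl h')
      · exact Or.inr (Or.inr (heqint j i h h' hi0 hi1))
  · push Not at hex
    apply pb_median_special d q (1 / 2) (by norm_num) (by norm_num) _ hqs
    intro j
    rcases (hq1 j).1.eq_or_lt with h | h
    · exact Or.inl h.symm
    · exact Or.inr (Or.inl (le_antisymm (hq1 j).2 (hex j h)))

/-- weight of a Boolean vector under independent rounding -/
noncomputable def wtB {n : ℕ} (x : Fin n → ℝ) (y : Fin n → Bool) : ℝ :=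
  ∏ i, (if y i then x i else 1 - x i)

open Polynomial in
lemma rounding {n : ℕ} (d : ℕ) (x : Fin n → ℝ) (a : Fin n → Bool) :
    ∑ y : Fin n → Bool, wtB x y * (if hammingDist a y ≤ d then 1 else 0) =
      cdfP d (pbP (fun i => if a i then 1 - x i else x i) Finset.univ) := by
  classical
  have h : pbP (fun i => if a i then 1 - x i else x i) Finset.univ =
      ∑ y : Fin n → Bool, C (wtB x y) * X ^ (hammingDist a y) := by
    have h1 : ∀ i, (C (1 - (if a i then 1 - x i else x i)) +
        C (if a i then 1 - x i else x i) * X : Polynomial ℝ) =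
        ∑ b : Bool, C (if b then x i else 1 - x i) * X ^ (if a i ≠ b then 1 else 0) := by
      intro i
      rw [Fintype.sum_bool]
      cases a i <;> simp
      ring
    rw [pbP, Finset.prod_congr rfl fun i _ => h1 i, Finset.prod_univ_sum, Fintype.piFinset_univ]
    apply Finset.sum_congr rfl
    intro y _
    rw [Finset.prod_mul_distrib, Finset.prod_pow_eq_pow_sum, wtB, map_prod, hammingDist,
      Finset.card_filter]
  rw [h, cdfP_sum]
  apply Finset.sum_congr rfl
  intro y _
  rw [cdfP_C_mul, cdfP_X_pow]

lemma wtB_sum {n : ℕ} (x : Fin n → ℝ) : ∑ y : Fin n → Bool, wtB x y = 1 := by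
  classical
  have := Finset.prod_univ_sum (fun _ : Fin n => (Finset.univ : Finset Bool))
    (fun i b => if b then x i else 1 - x i)
  rw [Fintype.piFinset_univ] at this
  unfold wtB
  rw [← this]
  simp

lemma ham_sum {n : ℕ} (a y : Fin n → Bool) :
    ∑ i, |(if a i then (1 : ℝ) else 0) - (if y i then (1 : ℝ) else 0)| = hammingDist a y := by
  rw [hammingDist, Finset.card_filter]
  push_cast
  apply Finset.sum_congr rfl
  intro i _
  cases a i <;> cases y i <;> simp


/-- **ℓ₁-balls versus Hamming balls.** For any integer radius `d > 0`, any point `x ∈ ℝⁿ` and any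
subset `A` of the points of the discrete cube `{0,1}ⁿ` lying in the ℓ₁-ball of radius `d` around
`x`, there is a point `y ∈ {0,1}ⁿ` whose ℓ₁-ball (Hamming ball) of radius `d` contains at least
half of the points of `A`. (Points of `{0,1}ⁿ` are encoded as Boolean vectors.) -/
theorem l1_ball_hamming_ball (n d : ℕ) (hd : 0 < d) (x : Fin n → ℝ)
    (A : Set (Fin n → Bool))
    (hA : ∀ a ∈ A, ∑ i, |(if a i then (1 : ℝ) else 0) - x i| ≤ d) :
    ∃ y : Fin n → Bool,
      A.ncard ≤ 2 *
        {a ∈ A | ∑ i, |(if a i then (1 : ℝ) else 0) - (if y i then (1 : ℝ) else 0)| ≤ d}.ncard := by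
  classical
  -- clip to the cube
  set z : Fin n → ℝ := fun i => max 0 (min 1 (x i)) with hz
  have hz0 : ∀ i, 0 ≤ z i := fun i => le_max_left _ _
  have hz1 : ∀ i, z i ≤ 1 := fun i => max_le zero_le_one (min_le_left _ _)
  have hmed : ∀ a ∈ A,
      1 / 2 ≤ ∑ y : Fin n → Bool, wtB z y * (if hammingDist a y ≤ d then 1 else 0) := by
    intro a ha
    rw [rounding]
    apply pb_median
    · intro i
      have := hz0 i
      have := hz1 i
      split_ifs <;> constructor <;> linarith
    · refine le_trans (Finset.sum_le_sum ?_) (hA a ha)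
      intro i _
      simp only [hz]
      split_ifs
      · rcases le_total 1 (x i) with h | h
        · rw [min_eq_left h]
          simp
        · rw [min_eq_right h]
          have := le_max_right 0 (x i)
          exact le_trans (by linarith) (le_abs_self _)
      · rw [zero_sub, abs_neg]
        exact max_le (abs_nonneg _) ((min_le_right _ _).trans (le_abs_self _))
  have hw0 : ∀ y, 0 ≤ wtB z y := by
    intro y
    apply Finset.prod_nonneg
    intro i _
    have := hz0 i
    have := hz1 i
    split_ifs <;> linarith
  by_contra hcon
  push Not at hcon
  have hcnt : ∀ y : Fin n → Bool,
      2 * ∑ a ∈ A.toFinset, (if hammingDist a y ≤ d then (1 : ℝ) else 0) ≤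
        (A.toFinset.card : ℝ) - 1 := by
    intro y
    have h := hcon y
    have e : {a ∈ A | ∑ i, |(if a i then (1 : ℝ) else 0) - (if y i then (1 : ℝ) else 0)| ≤ d} =
        ((A.toFinset.filter fun a => hammingDist a y ≤ d : Finset (Fin n → Bool)) :
          Set (Fin n → Bool)) := by
      ext a
      simp [ham_sum]
    rw [e, Set.ncard_coe_finset, Set.ncard_eq_toFinset_card'] at h
    rw [Finset.sum_boole]
    have h' : 2 * (A.toFinset.filter fun a => hammingDist a y ≤ d).card + 1 ≤ A.toFinset.card := h
    have h'' : (2 : ℝ) * ((A.toFinset.filter fun a => hammingDist a y ≤ d).card : ℝ) + 1 ≤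
      A.toFinset.card := by exact_mod_cast h'
    linarith
  have hlow : (A.toFinset.card : ℝ) * (1 / 2) ≤
      ∑ a ∈ A.toFinset, ∑ y : Fin n → Bool, wtB z y * (if hammingDist a y ≤ d then 1 else 0) := by
    rw [← nsmul_eq_mul]
    apply Finset.card_nsmul_le_sum
    intro a ha
    exact hmed a (by simpa using ha)
  rw [Finset.sum_comm] at hlow
  have hup : ∑ y : Fin n → Bool, ∑ a ∈ A.toFinset,
      wtB z y * (if hammingDist a y ≤ d then 1 else 0) ≤
      ∑ y : Fin n → Bool, wtB z y * (((A.toFinset.card : ℝ) - 1) / 2) := by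
    apply Finset.sum_le_sum
    intro y _
    rw [← Finset.mul_sum]
    apply mul_le_mul_of_nonneg_left _ (hw0 y)
    linarith [hcnt y]
  rw [← Finset.sum_mul, wtB_sum] at hup
  linarith
end

section
/- There exist absolute positive constants c > 1 and c' such that the following holds. Let 𝓒 be a family of binary vectors of length n with VC-dimension at most d, let B > 2 be an integer, let ε ∈ (0,1), and let X be a random multiset of m coordinates of {1,...,n} chosen independently and uniformly with repetitions, where m = c·(B^2·d/ε)·log(B/ε). Then with probability at least 1 - e^{-c'·ε·m/B^2}, every C ∈ 𝓒 satisfying Σ_{i=1}^n C_i ≥ ε·n also satisfies Σ_{i ∈ X} C_i ≥ ((B-1)/(B+1))·ε·m (where the sum over i ∈ X counts multiplicity). -/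
/-- A family `𝓒` of binary vectors of length `n` shatters a set `I` of coordinates if every
binary pattern on `I` is realized by some member of `𝓒`. -/
def Shatters {n : ℕ} (𝓒 : Set (Fin n → Bool)) (I : Finset (Fin n)) : Prop :=
  ∀ b : Fin n → Bool, ∃ C ∈ 𝓒, ∀ i ∈ I, C i = b i

namespace VCS

/-- indicator -/
noncomputable def ind (b : Bool) : ℝ := if b = true then 1 else 0

/-- pair weight -/
noncomputable def wt (s t : ℝ) (a b : Bool) : ℝ := Real.exp (t * ind b - s * ind a)

lemma wt_pair {s : ℝ} (hs : 0 ≤ s) (hs2 : s ≤ 1 / 2) (a b : Bool) :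
    wt s (s - 2 * s ^ 2) a b + wt s (s - 2 * s ^ 2) b a ≤ 2 := by
  have key : Real.exp (-s) + Real.exp (s - 2 * s ^ 2) ≤ 2 := by
    have h1 := Real.abs_exp_sub_one_sub_id_le (x := -s) (by rw [abs_neg, abs_of_nonneg hs]; linarith)
    have h0 : 0 ≤ s - 2 * s ^ 2 := by nlinarith
    have h2 := Real.abs_exp_sub_one_sub_id_le (x := s - 2 * s ^ 2) (by
      rw [abs_of_nonneg h0]; nlinarith)
    have h3 : (s - 2 * s ^ 2) ^ 2 ≤ s ^ 2 := by
      apply pow_le_pow_left₀ h0; nlinarith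
    have h1' := (abs_le.1 h1).2
    have h2' := (abs_le.1 h2).2
    nlinarith
  cases a <;> cases b <;> simp [wt, ind]
  · norm_num
  · linarith
  · linarith
  · have : Real.exp (-(2 * s ^ 2)) ≤ 1 := by
      rw [Real.exp_le_one_iff]; nlinarith
    linarith

/-- total weight of a trace -/
noncomputable def F (s t : ℝ) {m : ℕ} (f : Fin m × Bool → Bool) : ℝ :=
  ∏ j, wt s t (f (j, false)) (f (j, true))

/-- the swap -/
def tau {m : ℕ} (σ : Fin m → Bool) : Fin m × Bool → Fin m × Bool :=
  fun p => (p.1, xor p.2 (σ p.1))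

lemma tau_tau {m : ℕ} (σ : Fin m → Bool) (p) : tau σ (tau σ p) = p := by
  simp [tau]

lemma tau_comp {m : ℕ} (σ : Fin m → Bool) : tau σ ∘ tau σ = id := by
  funext p; simp [tau_tau]

lemma sum_swap {s : ℝ} (hs : 0 ≤ s) (hs2 : s ≤ 1 / 2) {m : ℕ} (f : Fin m × Bool → Bool) :
    ∑ σ : Fin m → Bool, F s (s - 2 * s ^ 2) (f ∘ tau σ) ≤ 2 ^ m := by
  have h : ∑ σ : Fin m → Bool, F s (s - 2 * s ^ 2) (f ∘ tau σ)
      = ∏ j : Fin m, ∑ b : Bool,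
        wt s (s - 2 * s ^ 2) (f (j, xor false b)) (f (j, xor true b)) := by
    rw [Finset.prod_univ_sum, Fintype.piFinset_univ]
    rfl
  rw [h]
  calc _ ≤ ∏ j : Fin m, (2 : ℝ) := by
        apply Finset.prod_le_prod
        · intro j _
          exact Finset.sum_nonneg fun b _ => (Real.exp_pos _).le
        · intro j _
          simp only [Fintype.sum_bool]
          simpa using wt_pair hs hs2 (f (j, true)) (f (j, false))
    _ = 2 ^ m := by simp

open Classical in
/-- traces -/
noncomputable def T {n m : ℕ} (𝓕 : Finset (Fin n → Bool)) (z : Fin m × Bool → Fin n) :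
    Finset (Fin m × Bool → Bool) := 𝓕.image (fun C => C ∘ z)

lemma T_sum {n m : ℕ} (𝓕 : Finset (Fin n → Bool)) (z : Fin m × Bool → Fin n)
    (σ : Fin m → Bool) (G : (Fin m × Bool → Bool) → ℝ) :
    ∑ f ∈ T 𝓕 (z ∘ tau σ), G f = ∑ f ∈ T 𝓕 z, G (f ∘ tau σ) := by
  classical
  have : T 𝓕 (z ∘ tau σ) = (T 𝓕 z).image (fun f => f ∘ tau σ) := by
    unfold T
    rw [Finset.image_image]
    rfl
  rw [this, Finset.sum_image]
  intro f _ g _ h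
  have := congrArg (fun f => f ∘ tau σ) h
  simpa [Function.comp_assoc, tau_comp] using this

lemma main_sum {s : ℝ} (hs : 0 ≤ s) (hs2 : s ≤ 1 / 2) {n m : ℕ} (𝓕 : Finset (Fin n → Bool))
    (K : ℝ) (hK : ∀ z : Fin m × Bool → Fin n, ((T 𝓕 z).card : ℝ) ≤ K) :
    ∑ z : Fin m × Bool → Fin n, ∑ f ∈ T 𝓕 z, F s (s - 2 * s ^ 2) f
      ≤ (n : ℝ) ^ m * (n : ℝ) ^ m * K := by
  have h1 : ∀ σ : Fin m → Bool,
      ∑ z : Fin m × Bool → Fin n, ∑ f ∈ T 𝓕 z, F s (s - 2 * s ^ 2) f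
      = ∑ z : Fin m × Bool → Fin n, ∑ f ∈ T 𝓕 z, F s (s - 2 * s ^ 2) (f ∘ tau σ) := by
    intro σ
    simp_rw [← T_sum]
    refine Fintype.sum_bijective (fun z => z ∘ tau σ) ?_ _ _ ?_
    · apply Function.Involutive.bijective
      intro z
      simp [Function.comp_assoc, tau_comp]
    · intro z
      simp [Function.comp_assoc, tau_comp]
  have h2 : (2 : ℝ) ^ m * ∑ z : Fin m × Bool → Fin n, ∑ f ∈ T 𝓕 z, F s (s - 2 * s ^ 2) f
      = ∑ σ : Fin m → Bool,
        ∑ z : Fin m × Bool → Fin n, ∑ f ∈ T 𝓕 z, F s (s - 2 * s ^ 2) (f ∘ tau σ) := by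
    rw [← Finset.sum_congr rfl (fun σ _ => h1 σ)]
    simp
  have h3 : ∑ σ : Fin m → Bool,
        ∑ z : Fin m × Bool → Fin n, ∑ f ∈ T 𝓕 z, F s (s - 2 * s ^ 2) (f ∘ tau σ)
      ≤ ∑ z : Fin m × Bool → Fin n, 2 ^ m * K := by
    rw [Finset.sum_comm]
    apply Finset.sum_le_sum
    intro z _
    rw [Finset.sum_comm]
    calc _ ≤ ∑ f ∈ T 𝓕 z, (2 : ℝ) ^ m := Finset.sum_le_sum fun f _ => sum_swap hs hs2 f
      _ = 2 ^ m * (T 𝓕 z).card := by simp [mul_comm]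
      _ ≤ _ := by gcongr; exact hK z
  rw [← h2] at h3
  have h4 : ∑ z : Fin m × Bool → Fin n, (2 : ℝ) ^ m * K
      = 2 ^ m * ((n : ℝ) ^ m * (n : ℝ) ^ m * K) := by
    simp [pow_mul, mul_comm m 2, ← mul_pow]
    ring
  rw [h4] at h3
  exact le_of_mul_le_mul_left h3 (by positivity)

lemma choose_sum {x : ℝ} (hx : 0 < x) (hx1 : x ≤ 1) (N d : ℕ) :
    ((∑ k ∈ Finset.Iic d, N.choose k : ℕ) : ℝ) ≤ (x⁻¹) ^ d * Real.exp (x * N) := by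
  have h1 : x ^ d * ((∑ k ∈ Finset.Iic d, N.choose k : ℕ) : ℝ) ≤ (x + 1) ^ N := by
    push_cast
    rw [Finset.mul_sum, add_pow]
    calc _ ≤ ∑ k ∈ Finset.Iic d, x ^ k * (N.choose k : ℝ) := by
          apply Finset.sum_le_sum
          intro k hk
          gcongr ?_ * _
          exact pow_le_pow_of_le_one hx.le hx1 (Finset.mem_Iic.1 hk)
      _ ≤ ∑ k ∈ Finset.Iic d ∪ Finset.range (N + 1), x ^ k * (N.choose k : ℝ) :=
          Finset.sum_le_sum_of_subset_of_nonneg Finset.subset_union_left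
            (fun _ _ _ => by positivity)
      _ = ∑ k ∈ Finset.range (N + 1), x ^ k * (N.choose k : ℝ) := by
          symm
          apply Finset.sum_subset Finset.subset_union_right
          intro k _ hk
          rw [Nat.choose_eq_zero_of_lt (by simpa using hk)]
          simp
      _ ≤ _ := by simp
  have h2 : (x + 1) ^ N ≤ Real.exp (x * N) := by
    rw [mul_comm, Real.exp_nat_mul]
    gcongr
    exact Real.add_one_le_exp x
  rw [inv_pow, inv_mul_eq_div, le_div_iff₀ (by positivity), mul_comm]
  exact h1.trans h2

lemma sauer {n m d : ℕ} (𝓕 : Finset (Fin n → Bool))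
    (h : ∀ I : Finset (Fin n), Shatters (𝓕 : Set (Fin n → Bool)) I → I.card ≤ d)
    (z : Fin m × Bool → Fin n) :
    (T 𝓕 z).card ≤ ∑ k ∈ Finset.Iic d, (2 * m).choose k := by
  classical
  let φ : (Fin m × Bool → Bool) → Finset (Fin m × Bool) := fun f => Finset.univ.filter (f · = true)
  have hφ : Function.Injective φ := by
    intro f g hfg
    funext p
    have : p ∈ φ f ↔ p ∈ φ g := by rw [hfg]
    simp only [φ, Finset.mem_filter, Finset.mem_univ, true_and] at this
    exact Bool.eq_iff_iff.2 this
  let 𝒜 := (T 𝓕 z).image φ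
  have hc : 𝒜.card = (T 𝓕 z).card := Finset.card_image_of_injective _ hφ
  rw [← hc]
  have hvc : 𝒜.vcDim ≤ d := by
    unfold Finset.vcDim
    apply Finset.sup_le
    intro S hS
    rw [Finset.mem_shatterer] at hS
    have hreal : ∀ t ⊆ S, ∃ C ∈ 𝓕, ∀ p ∈ S, (C (z p) = true ↔ p ∈ t) := by
      intro t ht
      obtain ⟨u, hu, hut⟩ := hS ht
      simp only [𝒜, T, Finset.mem_image] at hu
      obtain ⟨f, ⟨C, hC, rfl⟩, rfl⟩ := hu
      refine ⟨C, hC, fun p hp => ?_⟩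
      rw [← hut]
      simp [φ, hp]
    have hinj : Set.InjOn z S := by
      intro p hp q hq hpq
      obtain ⟨C, _, hC⟩ := hreal {p} (by simpa using hp)
      have h1 := hC p hp
      have h2 := hC q hq
      rw [← hpq] at h2
      have := h2.1 (h1.2 (by simp))
      exact (Finset.mem_singleton.1 this).symm
    rw [← Finset.card_image_of_injOn hinj]
    apply h
    intro b
    obtain ⟨C, hC, hC2⟩ := hreal (S.filter fun p => b (z p) = true) (Finset.filter_subset _ _)
    refine ⟨C, hC, fun i hi => ?_⟩
    obtain ⟨p, hp, rfl⟩ := Finset.mem_image.1 hi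
    have := hC2 p hp
    simp only [Finset.mem_filter, hp, true_and] at this
    exact Bool.eq_iff_iff.2 this
  calc 𝒜.card ≤ 𝒜.shatterer.card := Finset.card_le_card_shatterer _
    _ ≤ ∑ k ∈ Finset.Iic 𝒜.vcDim, (Fintype.card (Fin m × Bool)).choose k :=
        Finset.card_shatterer_le_sum_vcDim
    _ = ∑ k ∈ Finset.Iic 𝒜.vcDim, (2 * m).choose k := by simp [mul_comm]
    _ ≤ _ := Finset.sum_le_sum_of_subset (Finset.Iic_subset_Iic.2 hvc)

/-- gluing two samples -/
def glue {n m : ℕ} (q : (Fin m → Fin n) × (Fin m → Fin n)) : Fin m × Bool → Fin n :=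
  fun p => if p.2 = true then q.2 p.1 else q.1 p.1

lemma glue_bij {n m : ℕ} : Function.Bijective (glue (n := n) (m := m)) := by
  refine Function.bijective_iff_has_inverse.2
    ⟨fun z => (fun j => z (j, false), fun j => z (j, true)), ?_, ?_⟩
  · intro q; simp [glue]
  · intro z; funext ⟨j, b⟩; cases b <;> simp [glue]

lemma F_glue (s t : ℝ) {n m : ℕ} (C : Fin n → Bool) (ω η : Fin m → Fin n) :
    F s t (C ∘ glue (ω, η)) =
      Real.exp (-(s * ((Finset.univ.filter fun j : Fin m => C (ω j) = true).card : ℝ)))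
        * ∏ j, Real.exp (t * ind (C (η j))) := by
  have : ((Finset.univ.filter fun j : Fin m => C (ω j) = true).card : ℝ)
      = ∑ j, ind (C (ω j)) := by
    simp [ind]
  rw [this, Finset.mul_sum, ← Finset.sum_neg_distrib, Real.exp_sum, ← Finset.prod_mul_distrib]
  unfold F
  refine Finset.prod_congr rfl fun j _ => ?_
  rw [← Real.exp_add]
  simp only [wt, glue, Function.comp]
  congr 1
  simp
  ring

lemma ghost {t : ℝ} (ht : 0 ≤ t) {n m : ℕ} (C : Fin n → Bool) {ε : ℝ}
    (hC : ε * n ≤ ((Finset.univ.filter fun i => C i = true).card : ℝ)) :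
    (n : ℝ) ^ m * Real.exp (t * ε * m) ≤
      ∑ η : Fin m → Fin n, ∏ j, Real.exp (t * ind (C (η j))) := by
  have h1 : ∑ η : Fin m → Fin n, ∏ j, Real.exp (t * ind (C (η j)))
      = (∑ i, Real.exp (t * ind (C i))) ^ m := by
    rw [← Fintype.piFinset_univ,
      ← Finset.prod_univ_sum (fun _ : Fin m => Finset.univ) (fun _ i => Real.exp (t * ind (C i)))]
    simp
  rw [h1]
  have h2 : (n : ℝ) * Real.exp (t * ε) ≤ ∑ i, Real.exp (t * ind (C i)) := by
    have h3 : ∀ i, Real.exp (t * ε) * (1 + (t * ind (C i) - t * ε)) ≤ Real.exp (t * ind (C i)) := by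
      intro i
      have := Real.add_one_le_exp (t * ind (C i) - t * ε)
      calc _ ≤ Real.exp (t * ε) * Real.exp (t * ind (C i) - t * ε) := by
            gcongr; linarith
        _ = _ := by rw [← Real.exp_add]; congr 1; ring
    refine le_trans ?_ (Finset.sum_le_sum fun i _ => h3 i)
    rw [← Finset.mul_sum, Finset.sum_add_distrib, Finset.sum_sub_distrib, ← Finset.mul_sum]
    have h4 : ∑ i, ind (C i) = ((Finset.univ.filter fun i => C i = true).card : ℝ) := by
      simp [ind]
    rw [h4]
    simp only [Finset.sum_const, Finset.card_univ, Fintype.card_fin, nsmul_eq_mul]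
    have : t * (ε * n) ≤ t * ((Finset.univ.filter fun i => C i = true).card : ℝ) := by gcongr
    rw [mul_comm]
    gcongr
    linarith
  calc (n : ℝ) ^ m * Real.exp (t * ε * m) = ((n : ℝ) * Real.exp (t * ε)) ^ m := by
        rw [mul_pow, ← Real.exp_nat_mul]; congr 2; ring
    _ ≤ _ := by gcongr

lemma bad_bound {s : ℝ} (hs : 0 ≤ s) (hs2 : s ≤ 1 / 2) {n m : ℕ} (hn : 0 < n)
    (𝓕 : Finset (Fin n → Bool)) {K ε θ : ℝ}
    (hK : ∀ z : Fin m × Bool → Fin n, ((T 𝓕 z).card : ℝ) ≤ K)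
    (bad : Finset (Fin m → Fin n))
    (hbad : ∀ ω ∈ bad, ∃ C ∈ 𝓕, ε * n ≤ ((Finset.univ.filter fun i => C i = true).card : ℝ) ∧
      ((Finset.univ.filter fun j : Fin m => C (ω j) = true).card : ℝ) ≤ θ) :
    (bad.card : ℝ) * Real.exp ((s - 2 * s ^ 2) * ε * m - s * θ) ≤ (n : ℝ) ^ m * K := by
  classical
  have ht : 0 ≤ s - 2 * s ^ 2 := by nlinarith
  have h := main_sum hs hs2 𝓕 K hK
  rw [← Fintype.sum_bijective glue glue_bij
    (fun q => ∑ f ∈ T 𝓕 (glue q), F s (s - 2 * s ^ 2) f) _ (fun _ => rfl),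
    Fintype.sum_prod_type] at h
  have hF : ∀ f : Fin m × Bool → Bool, 0 ≤ F s (s - 2 * s ^ 2) f := fun f =>
    Finset.prod_nonneg fun _ _ => (Real.exp_pos _).le
  have h2 : (bad.card : ℝ) * ((n : ℝ) ^ m * Real.exp ((s - 2 * s ^ 2) * ε * m - s * θ)) ≤
      ∑ ω : Fin m → Fin n, ∑ η : Fin m → Fin n,
        ∑ f ∈ T 𝓕 (glue (ω, η)), F s (s - 2 * s ^ 2) f := by
    calc _ = ∑ ω ∈ bad, ((n : ℝ) ^ m * Real.exp ((s - 2 * s ^ 2) * ε * m - s * θ)) := by simp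
      _ ≤ ∑ ω ∈ bad, ∑ η : Fin m → Fin n,
        ∑ f ∈ T 𝓕 (glue (ω, η)), F s (s - 2 * s ^ 2) f := by
          apply Finset.sum_le_sum
          intro ω hω
          obtain ⟨C, hC, h1, h2⟩ := hbad ω hω
          calc _ = Real.exp (-(s * θ)) * ((n : ℝ) ^ m * Real.exp ((s - 2 * s ^ 2) * ε * m)) := by
                rw [sub_eq_add_neg, Real.exp_add]; ring
            _ ≤ Real.exp (-(s * ((Finset.univ.filter fun j : Fin m => C (ω j) = true).card : ℝ)))
                * ∑ η : Fin m → Fin n, ∏ j, Real.exp ((s - 2 * s ^ 2) * ind (C (η j))) := by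
                gcongr
                exact ghost ht C h1
            _ = ∑ η : Fin m → Fin n, F s (s - 2 * s ^ 2) (C ∘ glue (ω, η)) := by
                rw [Finset.mul_sum]
                exact Finset.sum_congr rfl fun η _ => (F_glue _ _ C ω η).symm
            _ ≤ _ := by
                apply Finset.sum_le_sum
                intro η _
                exact Finset.single_le_sum (f := F s (s - 2 * s ^ 2)) (fun f _ => hF f)
                  (Finset.mem_image_of_mem _ hC)
      _ ≤ _ := Finset.sum_le_sum_of_subset_of_nonneg (Finset.subset_univ _)
          (fun ω _ _ => Finset.sum_nonneg fun η _ => Finset.sum_nonneg fun f _ => hF f)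
  have h3 := h2.trans h
  have hn' : (0 : ℝ) < (n : ℝ) ^ m := by positivity
  refine le_of_mul_le_mul_left ?_ hn'
  linarith

lemma numeric {d B m : ℕ} {ε : ℝ} (hB : 2 < B) (h0 : 0 < ε) (h1 : ε < 1)
    (hm : 96 * ((B : ℝ) ^ 2 * d / ε) * Real.log ((B : ℝ) / ε) ≤ (m : ℝ)) :
    ((∑ k ∈ Finset.Iic d, (2 * m).choose k : ℕ) : ℝ) ≤ Real.exp (ε * m / (8 * (B : ℝ) ^ 2)) := by
  have hB3 : (3 : ℝ) ≤ B := by exact_mod_cast hB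
  have hB2 : (9 : ℝ) ≤ (B : ℝ) ^ 2 := by nlinarith
  have hx : 0 < ε / (32 * (B : ℝ) ^ 2) := by positivity
  refine (choose_sum hx (by rw [div_le_one (by positivity)]; nlinarith) (2 * m) d).trans ?_
  have hl : Real.log ((ε / (32 * (B : ℝ) ^ 2))⁻¹) ≤ 6 * Real.log ((B : ℝ) / ε) := by
    rw [show (6 : ℝ) * Real.log ((B : ℝ) / ε) = Real.log (((B : ℝ) / ε) ^ 6) by
      rw [Real.log_pow]; norm_num]
    apply Real.log_le_log (by positivity)
    rw [inv_div, div_pow, div_le_div_iff₀ h0 (by positivity)]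
    have e1 : ε ^ 6 ≤ ε := by
      calc ε ^ 6 ≤ ε ^ 1 := pow_le_pow_of_le_one h0.le h1.le (by norm_num)
        _ = ε := pow_one _
    have e2 : 32 * (B : ℝ) ^ 2 ≤ (B : ℝ) ^ 6 := by
      have : (81 : ℝ) ≤ (B : ℝ) ^ 4 := by nlinarith
      calc 32 * (B : ℝ) ^ 2 ≤ (B : ℝ) ^ 4 * (B : ℝ) ^ 2 := by gcongr; linarith
        _ = _ := by ring
    gcongr
  have hp : ((ε / (32 * (B : ℝ) ^ 2))⁻¹) ^ d
      = Real.exp (d * Real.log ((ε / (32 * (B : ℝ) ^ 2))⁻¹)) := by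
    rw [Real.exp_nat_mul, Real.exp_log (by positivity)]
  rw [hp, ← Real.exp_add]
  apply Real.exp_le_exp.2
  have h3 : (d : ℝ) * Real.log ((ε / (32 * (B : ℝ) ^ 2))⁻¹) ≤ ε * m / (16 * (B : ℝ) ^ 2) := by
    calc _ ≤ (d : ℝ) * (6 * Real.log ((B : ℝ) / ε)) := by gcongr
      _ = ε / (16 * (B : ℝ) ^ 2) * (96 * ((B : ℝ) ^ 2 * d / ε) * Real.log ((B : ℝ) / ε)) := by
          field_simp; ring
      _ ≤ ε / (16 * (B : ℝ) ^ 2) * m := by gcongr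
      _ = _ := by ring
  have h4 : ε / (32 * (B : ℝ) ^ 2) * ((2 * m : ℕ) : ℝ) = ε * m / (16 * (B : ℝ) ^ 2) := by
    push_cast; field_simp; ring
  rw [h4]
  have h5 : ε * m / (8 * (B : ℝ) ^ 2) = ε * m / (16 * (B : ℝ) ^ 2) + ε * m / (16 * (B : ℝ) ^ 2) := by
    field_simp; ring
  linarith

end VCS

/-- **Heavy-vector preservation under random sampling for bounded VC-dimension.** There are
absolute constants `c > 1` and `c' > 0` such that: if `𝓒` is a family of binary vectors of
length `n` of VC-dimension at most `d`, `B > 2` an integer, `ε ∈ (0,1)`, and `X = ω` is a random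
multiset of `m ≥ c·(B²d/ε)·log(B/ε)` coordinates (chosen uniformly and independently with
repetitions), then with probability at least `1 - e^{-c'·ε·m/B²}` every `C ∈ 𝓒` with
`Σᵢ Cᵢ ≥ ε·n` satisfies `Σ_{i ∈ X} Cᵢ ≥ ((B-1)/(B+1))·ε·m` (counted with multiplicity). -/
theorem vc_dimension_sampling :
    ∃ c c' : ℝ, 1 < c ∧ 0 < c' ∧
      ∀ (n d B m : ℕ) (ε : ℝ) (𝓒 : Set (Fin n → Bool)),
        (∀ I : Finset (Fin n), Shatters 𝓒 I → I.card ≤ d) →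
        2 < B → 0 < ε → ε < 1 →
        c * ((B : ℝ) ^ 2 * d / ε) * Real.log ((B : ℝ) / ε) ≤ (m : ℝ) →
        (1 - Real.exp (-(c' * ε * m / (B : ℝ) ^ 2))) * (n : ℝ) ^ m ≤
          (({ω : Fin m → Fin n | ∀ C ∈ 𝓒,
            ε * n ≤ ((Finset.univ.filter fun i => C i = true).card : ℝ) →
            ((B : ℝ) - 1) / ((B : ℝ) + 1) * ε * m ≤
              ((Finset.univ.filter fun j : Fin m => C (ω j) = true).card : ℝ)}).ncard : ℝ) := by
  refine ⟨96, 1 / 8, by norm_num, by norm_num, ?_⟩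
  intro n d B m ε 𝓒 hvc hB h0 h1 hm
  classical
  rcases Nat.eq_zero_or_pos n with rfl | hn
  · rcases Nat.eq_zero_or_pos m with rfl | hm0
    · simp
    · simp [hm0.ne']
  set good : Set (Fin m → Fin n) := {ω : Fin m → Fin n | ∀ C ∈ 𝓒,
            ε * n ≤ ((Finset.univ.filter fun i => C i = true).card : ℝ) →
            ((B : ℝ) - 1) / ((B : ℝ) + 1) * ε * m ≤
              ((Finset.univ.filter fun j : Fin m => C (ω j) = true).card : ℝ)} with hgood
  have hB3 : (3 : ℝ) ≤ B := by exact_mod_cast hB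
  have hbb := VCS.bad_bound (s := 1 / (2 * ((B : ℝ) + 1))) (by positivity)
    (by rw [div_le_div_iff₀ (by positivity) (by norm_num)]; linarith) hn 𝓒.toFinset
    (K := Real.exp (ε * m / (8 * (B : ℝ) ^ 2))) (ε := ε)
    (θ := ((B : ℝ) - 1) / ((B : ℝ) + 1) * ε * m)
    (fun z => le_trans (by exact_mod_cast VCS.sauer 𝓒.toFinset (by simpa using hvc) z)
      (VCS.numeric hB h0 h1 hm))
    (goodᶜ).toFinset (by
      intro ω hω
      simp only [Set.mem_toFinset, Set.mem_compl_iff, hgood, Set.mem_ofPred_eq] at hω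
      push Not at hω
      obtain ⟨C, hC, h2, h3⟩ := hω
      exact ⟨C, by simpa using hC, h2, h3.le⟩)
  have hcard : ((goodᶜ).toFinset.card : ℝ) + (good.ncard : ℝ) = (n : ℝ) ^ m := by
    rw [← Set.ncard_eq_toFinset_card']
    have := Set.ncard_add_ncard_compl good
    rw [Nat.card_eq_fintype_card] at this
    simp only [Fintype.card_fun, Fintype.card_fin] at this
    rw [add_comm]
    exact_mod_cast this
  have hexp : ε * m / (4 * (B : ℝ) ^ 2) ≤
      (1 / (2 * ((B : ℝ) + 1)) - 2 * (1 / (2 * ((B : ℝ) + 1))) ^ 2) * ε * m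
        - 1 / (2 * ((B : ℝ) + 1)) * (((B : ℝ) - 1) / ((B : ℝ) + 1) * ε * m) := by
    have : (1 / (2 * ((B : ℝ) + 1)) - 2 * (1 / (2 * ((B : ℝ) + 1))) ^ 2) * ε * m
        - 1 / (2 * ((B : ℝ) + 1)) * (((B : ℝ) - 1) / ((B : ℝ) + 1) * ε * m)
        = ε * m / (2 * ((B : ℝ) + 1) ^ 2) := by
      field_simp; ring
    rw [this]
    apply div_le_div_of_nonneg_left (by positivity) (by positivity)
    nlinarith
  have hb2 : ((goodᶜ).toFinset.card : ℝ) ≤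
      Real.exp (-(1 / 8 * ε * m / (B : ℝ) ^ 2)) * (n : ℝ) ^ m := by
    have h4 : ((goodᶜ).toFinset.card : ℝ) * Real.exp (ε * m / (4 * (B : ℝ) ^ 2))
        ≤ (n : ℝ) ^ m * Real.exp (ε * m / (8 * (B : ℝ) ^ 2)) :=
      le_trans (by gcongr) hbb
    refine le_of_mul_le_mul_right (h4.trans_eq ?_) (Real.exp_pos (ε * m / (4 * (B : ℝ) ^ 2)))
    rw [mul_right_comm, ← Real.exp_add, mul_comm]
    congr 2
    field_simp
    ring
  linarith
end
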